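/- arXiv:2409.20321 — 2 statements merged into one kernel-verified Lean document; each statement's English description precedes it below -/
import Mathlib

section
/- Let σ ∈ ℂ\{0}, let p, q ∈ C¹([0,ℓ];ℝ), a ∈ C²([0,ℓ];ℝ) with a(x) > 0 on [0,ℓ], and let b ∈ C³([0,ℓ];ℂ) be such that its set of zeros in [0,ℓ] is finite and every zero is of order at most one (i.e. b(x)=0 implies b'(x)≠0). Suppose u, ũ ∈ C^{1,2}([0,T]×[0,ℓ];ℂ) satisfy σ∂_t u = a(x)∂_x²u − p(x)u and σ∂_t ũ = a(x)∂_x²ũ − q(x)ũ for 0<t<T, 0<x<ℓ, together with u(0,·) = ũ(0,·) = b on (0,ℓ), u(t,0) = ũ(t,0) for 0<t<T, and ∂_x u(t,0) = ∂_x ũ(t,0) = 0 for 0<t<T. Then p = q on [0,ℓ]. -/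
open Set MeasureTheory intervalIntegral

noncomputable section

/-- `u` is of class `C^{1,2}` on `[0,T] × [0,ℓ]`, with `ut`, `ux`, `uxx` its
partial derivatives `∂ₜu`, `∂ₓu`, `∂ₓ²u`. -/
def IsC12 (T ℓ : ℝ) (u ut ux uxx : ℝ → ℝ → ℂ) : Prop :=
  (∀ t ∈ Icc (0:ℝ) T, ∀ x ∈ Icc (0:ℝ) ℓ,
      HasDerivWithinAt (fun s => u s x) (ut t x) (Icc 0 T) t ∧
      HasDerivWithinAt (fun y => u t y) (ux t x) (Icc 0 ℓ) x ∧
      HasDerivWithinAt (fun y => ux t y) (uxx t x) (Icc 0 ℓ) x) ∧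
  ContinuousOn (fun z : ℝ × ℝ => u z.1 z.2) (Icc 0 T ×ˢ Icc 0 ℓ) ∧
  ContinuousOn (fun z : ℝ × ℝ => ut z.1 z.2) (Icc 0 T ×ˢ Icc 0 ℓ) ∧
  ContinuousOn (fun z : ℝ × ℝ => ux z.1 z.2) (Icc 0 T ×ˢ Icc 0 ℓ) ∧
  ContinuousOn (fun z : ℝ × ℝ => uxx z.1 z.2) (Icc 0 T ×ˢ Icc 0 ℓ)

open Function Filter Topology

/-- The primitive in the second variable of a jointly continuous function is jointly continuous. -/
theorem continuous_uncurry_primitive {H : ℝ → ℝ → ℂ} (hH : Continuous (uncurry H)) :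
    Continuous (uncurry fun x z => ∫ y in (0:ℝ)..z, H x y) := by
  have : Continuous (uncurry fun (p : ℝ × ℝ) y => H p.1 y) := by
    unfold uncurry at hH ⊢
    fun_prop
  exact continuous_parametric_intervalIntegral_of_continuous this continuous_snd

theorem continuous_integral_of_continuous {X : Type*} [TopologicalSpace X]
    [FirstCountableTopology X] {H : X → ℝ → ℂ} (hH : Continuous (uncurry H)) {α β : X → ℝ}
    (hα : Continuous α) (hβ : Continuous β) :
    Continuous fun x => ∫ y in α x..β x, H x y := by
  have hc : ∀ x, Continuous (H x) := fun x => by fun_prop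
  have : (fun x => ∫ y in α x..β x, H x y) =
      fun x => (∫ y in (0:ℝ)..β x, H x y) - ∫ y in (0:ℝ)..α x, H x y := by
    ext x
    rw [integral_interval_sub_left ((hc x).intervalIntegrable _ _)
      ((hc x).intervalIntegrable _ _)]
  rw [this]
  exact (continuous_parametric_intervalIntegral_of_continuous hH hβ).sub
    (continuous_parametric_intervalIntegral_of_continuous hH hα)

/-- The Leibniz rule with moving endpoints. -/
theorem hasDerivAt_integral_of_continuous_deriv {H H' : ℝ → ℝ → ℂ}
    (hH : Continuous (uncurry H)) (hH' : Continuous (uncurry H'))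
    (hd : ∀ x y, HasDerivAt (fun s => H s y) (H' x y) x)
    {α β : ℝ → ℝ} {α' β' x : ℝ} (hα : HasDerivAt α α' x) (hβ : HasDerivAt β β' x) :
    HasDerivAt (fun s => ∫ y in α s..β s, H s y)
      (β' * H x (β x) - α' * H x (α x) + ∫ y in α x..β x, H' x y) x := by
  have hc : ∀ x, Continuous (H x) := fun x => hH.comp (by fun_prop : Continuous fun y => (x, y))
  have hc' : ∀ x, Continuous (H' x) := fun x => hH'.comp (by fun_prop : Continuous fun y => (x, y))
  have key : ∀ {β : ℝ → ℝ} {β' : ℝ}, HasDerivAt β β' x →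
      HasDerivAt (fun s => ∫ y in (0:ℝ)..β s, H s y)
        (β' * H x (β x) + ∫ y in (0:ℝ)..β x, H' x y) x := by
    intro β β' hβ
    have h1 : ∀ v : ℝ × ℝ, HasDerivAt (fun s => ∫ y in (0:ℝ)..v.2, H s y)
        (∫ y in (0:ℝ)..v.2, H' v.1 y) v.1 := by
      rintro ⟨s, z⟩
      obtain ⟨C, hC⟩ := ((isCompact_Icc (a := s - 1) (b := s + 1)).prod
        (isCompact_uIcc (a := (0:ℝ)) (b := z))).exists_bound_of_continuousOn hH'.continuousOn
      refine (hasDerivAt_integral_of_dominated_loc_of_deriv_le (F := H) (F' := H')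
        (bound := fun _ => C)
        (s := Icc (s - 1) (s + 1)) (Icc_mem_nhds (by linarith) (by linarith))
        (Eventually.of_forall fun t => (hc t).aestronglyMeasurable)
        ((hc s).intervalIntegrable _ _) (hc' s).aestronglyMeasurable
        (Eventually.of_forall fun y hy t ht => hC (t, y) ⟨ht, uIoc_subset_uIcc hy⟩)
        intervalIntegrable_const (Eventually.of_forall fun y _ t _ => hd t y)).2
    have h2 : ∀ v : ℝ × ℝ, HasDerivAt (fun z => ∫ y in (0:ℝ)..z, H v.1 y) (H v.1 v.2) v.2 :=
      fun v => integral_hasDerivAt_right ((hc _).intervalIntegrable _ _)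
        (hc _).stronglyMeasurable.stronglyMeasurableAtFilter (hc _).continuousAt
    have h3 := (hasStrictFDerivAt_uncurry_coprod (𝕜 := ℝ) (u := (x, β x))
      (f := fun s z => ∫ y in (0:ℝ)..z, H s y)
      (f₁ := fun s z => ContinuousLinearMap.toSpanSingleton ℝ (∫ y in (0:ℝ)..z, H' s y))
      (f₂ := fun s z => ContinuousLinearMap.toSpanSingleton ℝ (H s z))
      (Eventually.of_forall fun v => (h1 v).hasFDerivAt)
      (Eventually.of_forall fun v => (h2 v).hasFDerivAt)
      (by
        have := continuous_uncurry_primitive hH'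
        exact ((ContinuousLinearMap.toSpanSingletonCLE (𝕜 := ℝ) (E := ℂ)).continuous.comp this).continuousAt)
      (by
        exact ((ContinuousLinearMap.toSpanSingletonCLE (𝕜 := ℝ) (E := ℂ)).continuous.comp hH).continuousAt)).hasFDerivAt
    have h4 := h3.comp_hasDerivAt x ((hasDerivAt_id x).prodMk hβ)
    refine HasDerivAt.congr_deriv (f := fun s => ∫ y in (0:ℝ)..β s, H s y) h4 ?_
    simp [HasUncurry.uncurry, add_comm]
  have e : (fun s => ∫ y in α s..β s, H s y) =
      fun s => (∫ y in (0:ℝ)..β s, H s y) - ∫ y in (0:ℝ)..α s, H s y := by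
    ext s
    rw [integral_interval_sub_left ((hc s).intervalIntegrable _ _)
      ((hc s).intervalIntegrable _ _)]
  rw [e]
  refine ((key hβ).sub (key hα)).congr_deriv ?_
  rw [← integral_interval_sub_left ((hc' x).intervalIntegrable 0 (β x))
      ((hc' x).intervalIntegrable 0 (α x))]
  ring

/-- The `ξ`-derivative of `goursatMap M R h k`. -/
def goursatSlope (M : ℝ → ℝ → ℂ) (R : ℝ → ℂ) (k : ℝ → ℝ → ℂ) (ξ η : ℝ) : ℂ :=
  R ξ / 2 + ∫ s in (0:ℝ)..η, M ξ s * k ξ s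

/-- The integral operator whose fixed points `k` on the triangle `0 ≤ η ≤ ξ` solve the Goursat
problem `∂_ξ ∂_η k = M k`, `2 k(ξ, 0) = ∫₀^ξ R`, `(∂_ξ - ∂_η) k = 2 h k` on `ξ = η`. -/
def goursatMap (M : ℝ → ℝ → ℂ) (R : ℝ → ℂ) (h : ℂ) (k : ℝ → ℝ → ℂ) (ξ η : ℝ) : ℂ :=
  (∫ τ in (0:ℝ)..η, (2 * goursatSlope M R k τ τ - 2 * h * k τ τ)) +
    ∫ s in η..ξ, goursatSlope M R k s η

section Goursat

variable {M : ℝ → ℝ → ℂ} {R : ℝ → ℂ} {h : ℂ} {k : ℝ → ℝ → ℂ}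

theorem continuous_goursatSlope (hM : Continuous (uncurry M)) (hR : Continuous R)
    (hk : Continuous (uncurry k)) : Continuous (uncurry (goursatSlope M R k)) := by
  refine Continuous.add (by fun_prop) ?_
  exact continuous_uncurry_primitive (H := fun ξ s => M ξ s * k ξ s) (by fun_prop)

theorem continuous_goursatMap (hM : Continuous (uncurry M)) (hR : Continuous R)
    (hk : Continuous (uncurry k)) : Continuous (uncurry (goursatMap M R h k)) := by
  have hA := continuous_goursatSlope hM hR hk
  refine Continuous.add ?_ ?_
  · exact continuous_integral_of_continuous (X := ℝ × ℝ)
      (H := fun _ τ => 2 * goursatSlope M R k τ τ - 2 * h * k τ τ) (by fun_prop)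
      continuous_const continuous_snd
  · exact continuous_integral_of_continuous (X := ℝ × ℝ)
      (H := fun p s => goursatSlope M R k s p.2) (by fun_prop) continuous_snd continuous_fst

theorem norm_goursatMap_sub_le (hM : Continuous (uncurry M)) (hR : Continuous R)
    {k₁ k₂ : ℝ → ℝ → ℂ} (hk₁ : Continuous (uncurry k₁)) (hk₂ : Continuous (uncurry k₂))
    {L B c d ξ η : ℝ} (hc : 0 < c) (hd : 0 ≤ d) (hB : 0 ≤ B)
    (hMB : ∀ s t, 0 ≤ t → t ≤ s → s ≤ L → ‖M s t‖ ≤ B)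
    (hη : 0 ≤ η) (hηξ : η ≤ ξ) (hξ : ξ ≤ L)
    (hkd : ∀ s t, 0 ≤ t → t ≤ s → s ≤ ξ → ‖k₁ s t - k₂ s t‖ ≤ d * Real.exp (c * s)) :
    ‖goursatMap M R h k₁ ξ η - goursatMap M R h k₂ ξ η‖ ≤
      (2 * B * L + 2 * ‖h‖) / c * d * Real.exp (c * ξ) := by
  have hA₁ := continuous_goursatSlope hM hR hk₁
  have hA₂ := continuous_goursatSlope hM hR hk₂
  have hL : 0 ≤ L := by linarith
  have hslope : ∀ s t, 0 ≤ t → t ≤ s → s ≤ ξ →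
      ‖goursatSlope M R k₁ s t - goursatSlope M R k₂ s t‖ ≤ B * L * d * Real.exp (c * s) := by
    intro s t ht hts hs
    have e : goursatSlope M R k₁ s t - goursatSlope M R k₂ s t =
        ∫ r in (0:ℝ)..t, M s r * (k₁ s r - k₂ s r) := by
      simp only [goursatSlope, add_sub_add_left_eq_sub, mul_sub]
      rw [intervalIntegral.integral_sub] <;> exact Continuous.intervalIntegrable (by fun_prop) _ _
    rw [e]
    have := norm_integral_le_of_norm_le_const (a := 0) (b := t)
      (f := fun r => M s r * (k₁ s r - k₂ s r)) (C := B * (d * Real.exp (c * s))) ?_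
    · refine this.trans ?_
      rw [sub_zero, abs_of_nonneg ht]
      have : t ≤ L := by linarith
      calc B * (d * Real.exp (c * s)) * t ≤ B * (d * Real.exp (c * s)) * L := by gcongr
        _ = _ := by ring
    · intro r hr
      rw [uIoc_of_le ht] at hr
      rw [norm_mul]
      have h1 := hMB s r hr.1.le (hr.2.trans hts) (hs.trans hξ)
      have h2 := hkd s r hr.1.le (hr.2.trans hts) hs
      gcongr
  set C := 2 * B * L + 2 * ‖h‖ with hC
  have hexp : ∀ a b : ℝ, IntervalIntegrable (fun τ => C * d * Real.exp (c * τ)) volume a b :=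
    fun a b => Continuous.intervalIntegrable (by fun_prop) _ _
  have e : goursatMap M R h k₁ ξ η - goursatMap M R h k₂ ξ η =
      (∫ τ in (0:ℝ)..η, (2 * (goursatSlope M R k₁ τ τ - goursatSlope M R k₂ τ τ)
        - 2 * h * (k₁ τ τ - k₂ τ τ))) +
      ∫ s in η..ξ, (goursatSlope M R k₁ s η - goursatSlope M R k₂ s η) := by
    simp only [goursatMap]
    rw [add_sub_add_comm, ← intervalIntegral.integral_sub, ← intervalIntegral.integral_sub]
    · congr 1
      refine integral_congr fun τ _ => ?_
      ring
    all_goals exact Continuous.intervalIntegrable (by fun_prop) _ _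
  rw [e]
  have i1 : ‖∫ τ in (0:ℝ)..η, (2 * (goursatSlope M R k₁ τ τ - goursatSlope M R k₂ τ τ)
        - 2 * h * (k₁ τ τ - k₂ τ τ))‖ ≤ ∫ τ in (0:ℝ)..η, C * d * Real.exp (c * τ) := by
    refine norm_integral_le_of_norm_le hη (Eventually.of_forall fun τ hτ => ?_) (hexp _ _)
    have h1 := hslope τ τ hτ.1.le le_rfl (hτ.2.trans hηξ)
    have h2 := hkd τ τ hτ.1.le le_rfl (hτ.2.trans hηξ)
    refine (norm_sub_le _ _).trans ?_
    rw [norm_mul, norm_mul, norm_mul, Complex.norm_ofNat]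
    have h3 : 2 * ‖h‖ * ‖k₁ τ τ - k₂ τ τ‖ ≤ 2 * ‖h‖ * (d * Real.exp (c * τ)) := by gcongr
    rw [hC]
    nlinarith
  have i2 : ‖∫ s in η..ξ, (goursatSlope M R k₁ s η - goursatSlope M R k₂ s η)‖ ≤
      ∫ τ in η..ξ, C * d * Real.exp (c * τ) := by
    refine norm_integral_le_of_norm_le hηξ (Eventually.of_forall fun τ hτ => ?_) (hexp _ _)
    refine (hslope τ η hη hτ.1.le hτ.2).trans ?_
    rw [hC]
    have : 0 ≤ B * L := by positivity
    have : B * L ≤ 2 * B * L + 2 * ‖h‖ := by nlinarith [norm_nonneg h]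
    gcongr
  have i3 : (∫ τ in (0:ℝ)..η, C * d * Real.exp (c * τ)) + ∫ τ in η..ξ, C * d * Real.exp (c * τ)
      = C * d * ((Real.exp (c * ξ) - 1) / c) := by
    rw [integral_add_adjacent_intervals (hexp _ _) (hexp _ _), intervalIntegral.integral_const_mul,
      intervalIntegral.integral_comp_mul_left _ hc.ne', integral_exp]
    simp
    left
    field_simp
  refine (norm_add_le _ _).trans ((add_le_add i1 i2).trans ?_)
  rw [i3]
  have : 0 ≤ C := by positivity
  calc C * d * ((Real.exp (c * ξ) - 1) / c) ≤ C * d * (Real.exp (c * ξ) / c) := by gcongr; linarith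
    _ = _ := by ring

theorem norm_goursatMap_zero_le (hR : Continuous R) {ξ η : ℝ} (hη : 0 ≤ η) (hηξ : η ≤ ξ) :
    ‖goursatMap M R h (fun _ _ => 0) ξ η‖ ≤ ∫ s in (0:ℝ)..ξ, ‖R s‖ := by
  have e : goursatMap M R h (fun _ _ => 0) ξ η =
      (∫ s in (0:ℝ)..η, R s) + ∫ s in η..ξ, R s / 2 := by
    simp only [goursatMap, goursatSlope]
    congr 1
    · refine integral_congr fun s _ => ?_
      simp
      ring
    · simp
  have hi : ∀ a b, IntervalIntegrable (fun s => ‖R s‖) volume a b := fun a b =>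
    Continuous.intervalIntegrable (by fun_prop) _ _
  rw [e, ← integral_add_adjacent_intervals (hi 0 η) (hi η ξ)]
  refine (norm_add_le _ _).trans (add_le_add (norm_integral_le_integral_norm hη) ?_)
  refine norm_integral_le_of_norm_le hηξ (Eventually.of_forall fun s _ => ?_) (hi _ _)
  rw [norm_div, Complex.norm_ofNat]
  linarith [norm_nonneg (R s)]

/-- Solvability of the Goursat problem on a triangle, with an a priori bound. -/
theorem exists_goursatMap_fixedPoint (hM : Continuous (uncurry M)) (hR : Continuous R) (h : ℂ)
    {L : ℝ} (hL : 0 ≤ L) :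
    ∃ k : ℝ → ℝ → ℂ, Continuous (uncurry k) ∧ ∃ C, 0 ≤ C ∧ ∀ ξ η, 0 ≤ η → η ≤ ξ → ξ ≤ L →
      k ξ η = goursatMap M R h k ξ η ∧ ‖k ξ η‖ ≤ C * ∫ s in (0:ℝ)..ξ, ‖R s‖ := by
  obtain ⟨B, hB⟩ := ((isCompact_Icc (a := (0:ℝ)) (b := L)).prod
    (isCompact_Icc (a := (0:ℝ)) (b := L))).exists_bound_of_continuousOn hM.continuousOn
  have hB0 : 0 ≤ B := (norm_nonneg _).trans (hB (0, 0) (by simp [hL]))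
  have hMB : ∀ s t, 0 ≤ t → t ≤ s → s ≤ L → ‖M s t‖ ≤ B := fun s t h1 h2 h3 =>
    hB (s, t) ⟨⟨h1.trans h2, h3⟩, ⟨h1, h2.trans h3⟩⟩
  set C := 2 * B * L + 2 * ‖h‖ with hC
  have hC0 : 0 ≤ C := by positivity
  set c := 2 * C + 1 with hc
  have hc0 : 0 < c := by positivity
  have hCc : C / c ≤ 1 / 2 := by rw [div_le_div_iff₀ hc0 two_pos]; linarith
  let Δ : Set (ℝ × ℝ) := {p | 0 ≤ p.2 ∧ p.2 ≤ p.1 ∧ p.1 ≤ L}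
  have hΔc : ∀ X ≤ L, IsCompact {p : ℝ × ℝ | 0 ≤ p.2 ∧ p.2 ≤ p.1 ∧ p.1 ≤ X} := by
    intro X _
    refine ((isCompact_Icc (a := (0:ℝ)) (b := X)).prod
      (isCompact_Icc (a := (0:ℝ)) (b := X))).of_isClosed_subset ?_ ?_
    · exact (isClosed_le continuous_const continuous_snd).inter
        ((isClosed_le continuous_snd continuous_fst).inter
          (isClosed_le continuous_fst continuous_const))
    · rintro ⟨s, t⟩ ⟨h1, h2, h3⟩
      exact ⟨⟨h1.trans h2, h3⟩, ⟨h1, h2.trans h3⟩⟩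
  have : CompactSpace Δ := isCompact_iff_compactSpace.1 (hΔc L le_rfl)
  let π : ℝ × ℝ → ℝ × ℝ := fun p => (max (max 0 (min p.2 L)) (min p.1 L), max 0 (min p.2 L))
  have hπ : ∀ p, π p ∈ Δ := fun p => ⟨le_max_left _ _, le_max_left _ _,
    max_le (max_le hL (min_le_right _ _)) (min_le_right _ _)⟩
  have hπid : ∀ p ∈ Δ, π p = p := by
    rintro ⟨s, t⟩ ⟨h1, h2, h3⟩
    simp only at h1 h2 h3
    simp [π, min_eq_left h3, min_eq_left (h2.trans h3), h1, h2]
  have hπc : Continuous π := by fun_prop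
  let ext : C(Δ, ℂ) → ℝ → ℝ → ℂ := fun κ ξ η => Real.exp (c * ξ) * κ ⟨π (ξ, η), hπ _⟩
  have hext : ∀ κ, Continuous (uncurry (ext κ)) := by
    intro κ
    have : Continuous fun z : ℝ × ℝ => (⟨π z, hπ z⟩ : Δ) := hπc.subtype_mk _
    exact Continuous.mul (by fun_prop) (κ.continuous.comp this)
  let G : C(Δ, ℂ) → C(Δ, ℂ) := fun κ =>
    ⟨fun p => Real.exp (-(c * p.1.1)) * goursatMap M R h (ext κ) p.1.1 p.1.2, by
      have := (continuous_goursatMap (h := h) hM hR (hext κ)).comp (continuous_subtype_val (p := (· ∈ Δ)))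
      exact Continuous.mul (by fun_prop) this⟩
  have hG : ContractingWith (1 / 2) G := by
    refine ⟨by norm_num, LipschitzWith.of_dist_le_mul fun κ₁ κ₂ => ?_⟩
    rw [ContinuousMap.dist_le (by positivity)]
    rintro ⟨⟨ξ, η⟩, hp⟩
    have := norm_goursatMap_sub_le (h := h) hM hR (hext κ₁) (hext κ₂) hc0
      (dist_nonneg (x := κ₁) (y := κ₂)) hB0 hMB hp.1 hp.2.1 hp.2.2 (by
        intro s t ht hts hs
        simp only [ext]
        rw [← mul_sub, norm_mul, mul_comm, Complex.norm_real, Real.norm_eq_abs, Real.abs_exp]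
        gcongr
        rw [← dist_eq_norm]
        exact ContinuousMap.dist_apply_le_dist _)
    simp only [G, ContinuousMap.coe_mk]
    rw [dist_eq_norm, ← mul_sub, norm_mul, Complex.norm_real, Real.norm_eq_abs, Real.abs_exp]
    calc Real.exp (-(c * ξ)) * _ ≤ Real.exp (-(c * ξ)) * (C / c * dist κ₁ κ₂ * Real.exp (c * ξ)) := by
          gcongr
      _ = C / c * dist κ₁ κ₂ := by
          rw [mul_comm, mul_assoc, ← Real.exp_add]
          simp
      _ ≤ _ := by
          push_cast
          gcongr
  let κ := ContractingWith.fixedPoint G hG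
  have hκ : G κ = κ := hG.fixedPoint_isFixedPt
  have hfix : ∀ ξ η, 0 ≤ η → η ≤ ξ → ξ ≤ L → ext κ ξ η = goursatMap M R h (ext κ) ξ η := by
    intro ξ η h1 h2 h3
    have hp : (ξ, η) ∈ Δ := ⟨h1, h2, h3⟩
    have e := congrArg (fun f : C(Δ, ℂ) => f ⟨(ξ, η), hp⟩) hκ
    simp only [G, ContinuousMap.coe_mk] at e
    have e2 : ext κ ξ η = Real.exp (c * ξ) * κ ⟨(ξ, η), hp⟩ := by
      simp only [ext, hπid _ hp]
    rw [e2, ← e, ← mul_assoc, ← Complex.ofReal_mul, ← Real.exp_add]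
    simp
  refine ⟨ext κ, hext κ, 2 * Real.exp (c * L), by positivity, fun ξ η h1 h2 h3 =>
    ⟨hfix ξ η h1 h2 h3, ?_⟩⟩
  set ρ := ∫ s in (0:ℝ)..ξ, ‖R s‖ with hρ
  obtain ⟨⟨s₀, t₀⟩, hs₀, hmax⟩ := (hΔc ξ h3).exists_isMaxOn ⟨(ξ, η), h1, h2, le_rfl⟩
    (f := fun p => ‖ext κ p.1 p.2‖ * Real.exp (-(c * p.1)))
    (by have := hext κ; fun_prop)
  set m := ‖ext κ s₀ t₀‖ * Real.exp (-(c * s₀)) with hm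
  have hm0 : 0 ≤ m := by positivity
  have hbound : ∀ s t, 0 ≤ t → t ≤ s → s ≤ ξ → ‖ext κ s t‖ ≤ m * Real.exp (c * s) := by
    intro s t h1 h2 h3
    have := hmax (show (s, t) ∈ {p : ℝ × ℝ | 0 ≤ p.2 ∧ p.2 ≤ p.1 ∧ p.1 ≤ ξ} from ⟨h1, h2, h3⟩)
    simp only [mem_ofPred_eq] at this
    calc ‖ext κ s t‖ = ‖ext κ s t‖ * Real.exp (-(c * s)) * Real.exp (c * s) := by
          rw [mul_assoc, ← Real.exp_add]; simp
      _ ≤ _ := by gcongr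
  obtain ⟨g1, g2, g3⟩ := hs₀
  simp only at g1 g2 g3
  have hk₀ : ‖ext κ s₀ t₀‖ ≤ ρ + 1 / 2 * m * Real.exp (c * s₀) := by
    have a1 := norm_goursatMap_sub_le (h := h) (k₂ := fun _ _ => 0) hM hR (hext κ)
      continuous_const hc0 hm0 hB0 hMB g1 g2 (g3.trans h3) (by
        intro s t q1 q2 q3
        rw [sub_zero]
        exact hbound s t q1 q2 (q3.trans g3))
    have a2 := norm_goursatMap_zero_le (M := M) (h := h) hR g1 g2
    have a3 : (∫ s in (0:ℝ)..s₀, ‖R s‖) ≤ ρ :=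
      integral_mono_interval le_rfl (g1.trans g2) g3 (Eventually.of_forall fun s => norm_nonneg _)
        (Continuous.intervalIntegrable (by fun_prop) _ _)
    have a4 : C / c * m * Real.exp (c * s₀) ≤ 1 / 2 * m * Real.exp (c * s₀) := by gcongr
    rw [hfix s₀ t₀ g1 g2 (g3.trans h3)]
    have a5 := norm_sub_norm_le (goursatMap M R h (ext κ) s₀ t₀) (goursatMap M R h (fun _ _ => 0) s₀ t₀)
    linarith
  have hρ0 : 0 ≤ ρ := integral_nonneg (h1.trans h2) fun s _ => norm_nonneg _
  have hmρ : m ≤ ρ + 1 / 2 * m := by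
    calc m ≤ (ρ + 1 / 2 * m * Real.exp (c * s₀)) * Real.exp (-(c * s₀)) := by rw [hm]; gcongr
      _ = ρ * Real.exp (-(c * s₀)) + 1 / 2 * m := by
          rw [add_mul, mul_assoc (1 / 2 * m), ← Real.exp_add]; simp
      _ ≤ ρ * 1 + 1 / 2 * m := by
          gcongr
          rw [Real.exp_le_one_iff]
          nlinarith
      _ = _ := by ring
  calc ‖ext κ ξ η‖ ≤ m * Real.exp (c * ξ) := hbound ξ η h1 h2 le_rfl
    _ ≤ (2 * ρ) * Real.exp (c * L) := by gcongr; linarith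
    _ = _ := by ring

end Goursat

/-- The `η`-derivative of `goursatMap M R h k`. -/
def goursatCoslope (M : ℝ → ℝ → ℂ) (R : ℝ → ℂ) (h : ℂ) (k : ℝ → ℝ → ℂ) (ξ η : ℝ) : ℂ :=
  goursatSlope M R k η η - 2 * h * k η η + ∫ s in η..ξ, M s η * k s η

section GoursatDeriv

variable {M : ℝ → ℝ → ℂ} {R : ℝ → ℂ} {h : ℂ} {k : ℝ → ℝ → ℂ}

theorem continuous_goursatCoslope (hM : Continuous (uncurry M)) (hR : Continuous R)
    (hk : Continuous (uncurry k)) : Continuous (uncurry (goursatCoslope M R h k)) := by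
  have hA := continuous_goursatSlope hM hR hk
  refine Continuous.add (by fun_prop) ?_
  exact continuous_integral_of_continuous (X := ℝ × ℝ)
    (H := fun p s => M s p.2 * k s p.2) (by fun_prop) continuous_snd continuous_fst

theorem hasDerivAt_goursatSlope (hM : Continuous (uncurry M)) (hk : Continuous (uncurry k))
    (ξ η : ℝ) : HasDerivAt (fun t => goursatSlope M R k ξ t) (M ξ η * k ξ η) η := by
  have hc : Continuous fun s => M ξ s * k ξ s := by fun_prop
  exact (hc.integral_hasStrictDerivAt 0 η).hasDerivAt.const_add _

theorem hasDerivAt_goursatCoslope (hM : Continuous (uncurry M)) (hk : Continuous (uncurry k))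
    (ξ η : ℝ) : HasDerivAt (fun s => goursatCoslope M R h k s η) (M ξ η * k ξ η) ξ := by
  have hc : Continuous fun s => M s η * k s η := by fun_prop
  exact (hc.integral_hasStrictDerivAt η ξ).hasDerivAt.const_add _

theorem hasDerivAt_goursatMap_comp (hM : Continuous (uncurry M)) (hR : Continuous R)
    (hk : Continuous (uncurry k)) {ξ η : ℝ → ℝ} {ξ' η' : ℝ} (hξ : ∀ s, HasDerivAt ξ ξ' s)
    (hη : ∀ s, HasDerivAt η η' s) (x : ℝ) :
    HasDerivAt (fun s => goursatMap M R h k (ξ s) (η s))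
      (ξ' * goursatSlope M R k (ξ x) (η x) + η' * goursatCoslope M R h k (ξ x) (η x)) x := by
  have hA := continuous_goursatSlope hM hR hk
  have hηc : Continuous η := continuous_iff_continuousAt.2 fun s => (hη s).continuousAt
  have hc : Continuous fun τ => 2 * goursatSlope M R k τ τ - 2 * h * k τ τ := by fun_prop
  have h1 := (hc.integral_hasStrictDerivAt 0 (η x)).hasDerivAt.scomp x (hη x)
  have h3 := hasDerivAt_integral_of_continuous_deriv
      (H := fun t s => goursatSlope M R k s (η t))
      (H' := fun t s => η' * (M s (η t) * k s (η t))) (by fun_prop)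
      (by fun_prop) (fun t s => (hasDerivAt_goursatSlope hM hk s (η t)).scomp t (hη t))
      (hη x) (hξ x)
  refine (h1.add h3).congr_deriv ?_
  simp only [goursatCoslope, Complex.real_smul, intervalIntegral.integral_const_mul]
  ring

/-- Differentiating an integral of a function known to be differentiable only along the lines
`x + y = const`. -/
theorem hasDerivAt_integral_slope {A m : ℝ → ℝ → ℂ} (hA : Continuous (uncurry A))
    (hm : Continuous (uncurry m)) (hAm : ∀ ξ η, HasDerivAt (fun t => A ξ t) (m ξ η) η)
    {f f' : ℝ → ℂ} (hf : ∀ x, HasDerivAt f (f' x) x) (hf' : Continuous f') (x : ℝ) :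
    HasDerivAt (fun x => ∫ y in (0:ℝ)..x, A ((x + y) / 2) ((x - y) / 2) * f y)
      (2 * A x 0 * f x - A (x / 2) (x / 2) * f 0 +
        ∫ y in (0:ℝ)..x, (m ((x + y) / 2) ((x - y) / 2) * f y
          - A ((x + y) / 2) ((x - y) / 2) * f' y)) x := by
  have hfc : Continuous f := continuous_iff_continuousAt.2 fun s => (hf s).continuousAt
  have sub : ∀ (g : ℝ → ℝ → ℂ) (x : ℝ), ∫ y in (0:ℝ)..x, g ((x + y) / 2) y =
      2 * ∫ s in x / 2..x, g s (2 * s - x) := by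
    intro g x
    have := intervalIntegral.integral_comp_mul_sub (fun y => g ((x + y) / 2) y)
      (two_ne_zero (α := ℝ)) x (a := x / 2) (b := x)
    have e : ∀ s : ℝ, (x + (2 * s - x)) / 2 = s := fun s => by ring
    simp only [e] at this
    rw [this, show 2 * (x / 2) - x = 0 by ring, show 2 * x - x = x by ring, Complex.real_smul]
    push_cast
    ring
  have e : (fun x => ∫ y in (0:ℝ)..x, A ((x + y) / 2) ((x - y) / 2) * f y) =
      fun x => 2 * ∫ s in x / 2..x, A s (x - s) * f (2 * s - x) := by
    ext x
    rw [← sub (fun s y => A s (x - s) * f y) x]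
    refine integral_congr fun y _ => ?_
    rw [show x - (x + y) / 2 = (x - y) / 2 by ring]
  rw [e]
  have h1 := hasDerivAt_integral_of_continuous_deriv
    (H := fun x s => A s (x - s) * f (2 * s - x))
    (H' := fun x s => m s (x - s) * f (2 * s - x) - A s (x - s) * f' (2 * s - x))
    (by fun_prop) (by fun_prop) (fun x s => by
      have a1 := (hAm s (x - s)).scomp x ((hasDerivAt_id x).sub_const s)
      have a2 := (hf (2 * s - x)).scomp x ((hasDerivAt_id x).const_sub (2 * s))
      refine (a1.mul a2).congr_deriv ?_
      simp [sub_eq_add_neg])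
    ((hasDerivAt_id x).div_const 2) (hasDerivAt_id x)
  refine (h1.const_mul 2).congr_deriv ?_
  have e2 := sub (fun s y => m s (x - s) * f y - A s (x - s) * f' y) x
  have e3 : ∀ y : ℝ, x - (x + y) / 2 = (x - y) / 2 := fun y => by ring
  simp only [e3] at e2
  rw [e2]
  simp only [id, sub_self, show x - x / 2 = x / 2 by ring, show 2 * (x / 2) - x = 0 by ring,
    show 2 * x - x = x by ring]
  push_cast
  ring

/-- Differentiating an integral of a function known to be differentiable only along the lines
`x - y = const`. -/
theorem hasDerivAt_integral_coslope {B m : ℝ → ℝ → ℂ} (hB : Continuous (uncurry B))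
    (hm : Continuous (uncurry m)) (hBm : ∀ ξ η, HasDerivAt (fun s => B s η) (m ξ η) ξ)
    {f f' : ℝ → ℂ} (hf : ∀ x, HasDerivAt f (f' x) x) (hf' : Continuous f') (x : ℝ) :
    HasDerivAt (fun x => ∫ y in (0:ℝ)..x, B ((x + y) / 2) ((x - y) / 2) * f y)
      (B (x / 2) (x / 2) * f 0 +
        ∫ y in (0:ℝ)..x, (m ((x + y) / 2) ((x - y) / 2) * f y
          + B ((x + y) / 2) ((x - y) / 2) * f' y)) x := by
  have hfc : Continuous f := continuous_iff_continuousAt.2 fun s => (hf s).continuousAt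
  have sub : ∀ (g : ℝ → ℝ → ℂ) (x : ℝ), ∫ y in (0:ℝ)..x, g ((x - y) / 2) y =
      2 * ∫ s in (0:ℝ)..x / 2, g s (x - 2 * s) := by
    intro g x
    have := intervalIntegral.integral_comp_sub_mul (fun y => g ((x - y) / 2) y)
      (two_ne_zero (α := ℝ)) x (a := 0) (b := x / 2)
    have e : ∀ s : ℝ, (x - (x - 2 * s)) / 2 = s := fun s => by ring
    simp only [e] at this
    rw [this, show x - 2 * (x / 2) = 0 by ring, show x - 2 * 0 = x by ring, Complex.real_smul]
    push_cast
    ring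
  have e : (fun x => ∫ y in (0:ℝ)..x, B ((x + y) / 2) ((x - y) / 2) * f y) =
      fun x => 2 * ∫ s in (0:ℝ)..x / 2, B (x - s) s * f (x - 2 * s) := by
    ext x
    rw [← sub (fun s y => B (x - s) s * f y) x]
    refine integral_congr fun y _ => ?_
    rw [show x - (x - y) / 2 = (x + y) / 2 by ring]
  rw [e]
  have h1 := hasDerivAt_integral_of_continuous_deriv
    (H := fun x s => B (x - s) s * f (x - 2 * s))
    (H' := fun x s => m (x - s) s * f (x - 2 * s) + B (x - s) s * f' (x - 2 * s))
    (by fun_prop) (by fun_prop) (fun x s => by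
      have a1 := (hBm (x - s) s).scomp x ((hasDerivAt_id x).sub_const s)
      have a2 := (hf (x - 2 * s)).scomp x ((hasDerivAt_id x).sub_const (2 * s))
      refine (a1.mul a2).congr_deriv ?_
      simp)
    (hasDerivAt_const x 0) ((hasDerivAt_id x).div_const 2)
  refine (h1.const_mul 2).congr_deriv ?_
  have e2 := sub (fun s y => m (x - s) s * f y + B (x - s) s * f' y) x
  have e3 : ∀ y : ℝ, x - (x - y) / 2 = (x + y) / 2 := fun y => by ring
  simp only [e3] at e2
  rw [e2]
  simp only [id, show x - x / 2 = x / 2 by ring, show x - 2 * (x / 2) = 0 by ring]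
  push_cast
  ring

end GoursatDeriv

/-- A Volterra operator `f ↦ f + ∫₀ˣ K(x, y) f(y) dy` intertwining `∂² - P` and `∂² - Q` on
functions satisfying a Robin condition at the origin, whose kernel is controlled by `Q - P`. -/
theorem exists_transmutation {P Q : ℝ → ℂ} (hP : Continuous P) (hQ : Continuous Q) (h : ℂ)
    {L : ℝ} (hL : 0 ≤ L) :
    ∃ K : ℝ → ℝ → ℂ, Continuous (uncurry K) ∧
      (∃ C, 0 ≤ C ∧ ∀ x y, 0 ≤ y → y ≤ x → x ≤ L →
        ‖K x y‖ ≤ C * ∫ s in (0:ℝ)..(x + y) / 2, ‖Q s - P s‖) ∧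
      ∀ f f₁ f₂ : ℝ → ℂ, (∀ x, HasDerivAt f (f₁ x) x) → (∀ x, HasDerivAt f₁ (f₂ x) x) →
        Continuous f₂ → f₁ 0 = h * f 0 →
        ∃ g₁ : ℝ → ℂ, g₁ 0 = f₁ 0 ∧ ∀ x ∈ Icc 0 L,
          HasDerivAt (fun x => f x + ∫ y in (0:ℝ)..x, K x y * f y) (g₁ x) x ∧
          HasDerivAt g₁ (Q x * (f x + ∫ y in (0:ℝ)..x, K x y * f y) +
            (f₂ x - P x * f x + ∫ y in (0:ℝ)..x, K x y * (f₂ y - P y * f y))) x := by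
  set M : ℝ → ℝ → ℂ := fun ξ η => Q (ξ + η) - P (ξ - η) with hMdef
  set R : ℝ → ℂ := fun x => Q x - P x with hRdef
  have hM : Continuous (uncurry M) := by fun_prop
  have hR : Continuous R := by fun_prop
  obtain ⟨k, hk, C, hC, hkC⟩ := exists_goursatMap_fixedPoint hM hR h hL
  set A := goursatSlope M R k with hA_def
  set B := goursatCoslope M R h k with hB_def
  have hA : Continuous (uncurry A) := continuous_goursatSlope hM hR hk
  have hB : Continuous (uncurry B) := continuous_goursatCoslope hM hR hk
  have hN : Continuous (uncurry (goursatMap M R h k)) := continuous_goursatMap hM hR hk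
  set K : ℝ → ℝ → ℂ := fun x y => goursatMap M R h k ((x + y) / 2) ((x - y) / 2) with hK_def
  have hK : Continuous (uncurry K) := by fun_prop
  have hKk : ∀ x y, 0 ≤ y → y ≤ x → x ≤ L → K x y = k ((x + y) / 2) ((x - y) / 2) ∧
      ‖K x y‖ ≤ C * ∫ s in (0:ℝ)..(x + y) / 2, ‖R s‖ := by
    intro x y h1 h2 h3
    have := hkC ((x + y) / 2) ((x - y) / 2) (by linarith) (by linarith) (by linarith)
    refine ⟨this.1.symm, ?_⟩
    rw [hK_def]
    simp only
    rw [← this.1]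
    exact this.2
  refine ⟨K, hK, ⟨C, hC, fun x y h1 h2 h3 => (hKk x y h1 h2 h3).2⟩, ?_⟩
  intro f f₁ f₂ hf hf₁ hf₂ hbc
  have hfc : Continuous f := continuous_iff_continuousAt.2 fun s => (hf s).continuousAt
  have hfc₁ : Continuous f₁ := continuous_iff_continuousAt.2 fun s => (hf₁ s).continuousAt
  have hKx : ∀ x y, HasDerivAt (fun s => K s y)
      ((A ((x + y) / 2) ((x - y) / 2) + B ((x + y) / 2) ((x - y) / 2)) / 2) x := by
    intro x y
    refine (hasDerivAt_goursatMap_comp (h := h) hM hR hk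
      (ξ := fun s => (s + y) / 2) (η := fun s => (s - y) / 2)
      (fun s => ((hasDerivAt_id s).add_const y).div_const 2)
      (fun s => ((hasDerivAt_id s).sub_const y).div_const 2) x).congr_deriv ?_
    push_cast
    ring
  have hKy : ∀ x y, HasDerivAt (fun s => K x s)
      ((A ((x + y) / 2) ((x - y) / 2) - B ((x + y) / 2) ((x - y) / 2)) / 2) y := by
    intro x y
    refine (hasDerivAt_goursatMap_comp (h := h) hM hR hk
      (ξ := fun s => (x + s) / 2) (η := fun s => (x - s) / 2)
      (fun s => ((hasDerivAt_id s).const_add x).div_const 2)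
      (fun s => ((hasDerivAt_id s).const_sub x).div_const 2) y).congr_deriv ?_
    push_cast
    ring
  have hdiag : ∀ x, K x x = ∫ s in (0:ℝ)..x, R s / 2 := by
    intro x
    simp [hK_def, goursatMap, goursatSlope]
  have hdiag' : ∀ x, HasDerivAt (fun x => K x x) (R x / 2) x := by
    intro x
    simp only [hdiag]
    exact (Continuous.integral_hasStrictDerivAt (by fun_prop) 0 x).hasDerivAt
  set SA : ℝ → ℂ := fun x => ∫ y in (0:ℝ)..x, A ((x + y) / 2) ((x - y) / 2) * f y with hSA
  set SB : ℝ → ℂ := fun x => ∫ y in (0:ℝ)..x, B ((x + y) / 2) ((x - y) / 2) * f y with hSB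
  refine ⟨fun x => f₁ x + K x x * f x + (SA x + SB x) / 2, by simp [hdiag, SA, SB], ?_⟩
  intro x hx
  constructor
  · have h1 := hasDerivAt_integral_of_continuous_deriv
      (H := fun x y => K x y * f y)
      (H' := fun x y => (A ((x + y) / 2) ((x - y) / 2) + B ((x + y) / 2) ((x - y) / 2)) / 2 * f y)
      (by fun_prop) (by fun_prop) (fun x y => (hKx x y).mul_const _)
      (hasDerivAt_const x 0) (hasDerivAt_id x)
    refine ((hf x).add h1).congr_deriv ?_
    simp only [SA, SB, id]
    rw [← intervalIntegral.integral_add (Continuous.intervalIntegrable (by fun_prop) _ _)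
      (Continuous.intervalIntegrable (by fun_prop) _ _), ← intervalIntegral.integral_div]
    push_cast
    have : ∀ y, (A ((x + y) / 2) ((x - y) / 2) + B ((x + y) / 2) ((x - y) / 2)) / 2 * f y =
      (A ((x + y) / 2) ((x - y) / 2) * f y + B ((x + y) / 2) ((x - y) / 2) * f y) / 2 :=
      fun y => by ring
    simp only [this]
    ring
  · have h1 := hasDerivAt_integral_slope (m := fun ξ η => M ξ η * k ξ η) hA (by fun_prop)
      (hasDerivAt_goursatSlope hM hk) hf hfc₁ x
    have h2 := hasDerivAt_integral_coslope (m := fun ξ η => M ξ η * k ξ η) hB (by fun_prop)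
      (hasDerivAt_goursatCoslope hM hk) hf hfc₁ x
    refine (((hf₁ x).add ((hdiag' x).mul (hf x))).add ((h1.add h2).div_const 2)).congr_deriv ?_
    have parts := integral_mul_deriv_eq_deriv_mul (a := 0) (b := x)
      (u := fun y => K x y) (v := f₁) (v' := f₂) (fun y _ => hKy x y) (fun y _ => hf₁ y)
      (Continuous.intervalIntegrable (by fun_prop) _ _)
      (Continuous.intervalIntegrable (by fun_prop) _ _)
    have hA0 : A x 0 = R x / 2 := by simp [hA_def, goursatSlope]
    have hBA : B (x / 2) (x / 2) = A (x / 2) (x / 2) - 2 * h * k (x / 2) (x / 2) := by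
      simp [hB_def, hA_def, goursatCoslope]
    have hK0 : K x 0 = k (x / 2) (x / 2) := by
      simpa using (hKk x 0 le_rfl hx.1 hx.2).1
    have hMK : ∀ y ∈ uIcc 0 x, M ((x + y) / 2) ((x - y) / 2) * k ((x + y) / 2) ((x - y) / 2) =
        (Q x - P y) * K x y := by
      intro y hy
      rw [uIcc_of_le hx.1] at hy
      rw [(hKk x y hy.1 hy.2 hx.2).1, hMdef]
      simp only
      rw [show (x + y) / 2 + (x - y) / 2 = x by ring, show (x + y) / 2 - (x - y) / 2 = y by ring]
    have i1 : ∫ y in (0:ℝ)..x, (M ((x + y) / 2) ((x - y) / 2) * k ((x + y) / 2) ((x - y) / 2) * f y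
          - A ((x + y) / 2) ((x - y) / 2) * f₁ y) =
        Q x * (∫ y in (0:ℝ)..x, K x y * f y) - (∫ y in (0:ℝ)..x, K x y * (P y * f y)) -
          ∫ y in (0:ℝ)..x, A ((x + y) / 2) ((x - y) / 2) * f₁ y := by
      rw [← intervalIntegral.integral_const_mul, ← intervalIntegral.integral_sub,
        ← intervalIntegral.integral_sub]
      · refine integral_congr fun y hy => ?_
        simp only [hMK y hy]
        ring
      all_goals exact Continuous.intervalIntegrable (by fun_prop) _ _
    have i2 : ∫ y in (0:ℝ)..x, (M ((x + y) / 2) ((x - y) / 2) * k ((x + y) / 2) ((x - y) / 2) * f y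
          + B ((x + y) / 2) ((x - y) / 2) * f₁ y) =
        Q x * (∫ y in (0:ℝ)..x, K x y * f y) - (∫ y in (0:ℝ)..x, K x y * (P y * f y)) +
          ∫ y in (0:ℝ)..x, B ((x + y) / 2) ((x - y) / 2) * f₁ y := by
      rw [← intervalIntegral.integral_const_mul, ← intervalIntegral.integral_sub,
        ← intervalIntegral.integral_add]
      · refine integral_congr fun y hy => ?_
        simp only [hMK y hy]
        ring
      all_goals exact Continuous.intervalIntegrable (by fun_prop) _ _
    have i3 : ∫ y in (0:ℝ)..x, (A ((x + y) / 2) ((x - y) / 2) - B ((x + y) / 2) ((x - y) / 2)) / 2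
          * f₁ y = ((∫ y in (0:ℝ)..x, A ((x + y) / 2) ((x - y) / 2) * f₁ y) -
            ∫ y in (0:ℝ)..x, B ((x + y) / 2) ((x - y) / 2) * f₁ y) / 2 := by
      rw [← intervalIntegral.integral_sub, ← intervalIntegral.integral_div]
      · refine integral_congr fun y hy => ?_
        ring
      all_goals exact Continuous.intervalIntegrable (by fun_prop) _ _
    have i4 : ∫ y in (0:ℝ)..x, K x y * (f₂ y - P y * f y) =
        (∫ y in (0:ℝ)..x, K x y * f₂ y) - ∫ y in (0:ℝ)..x, K x y * (P y * f y) := by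
      rw [← intervalIntegral.integral_sub]
      · refine integral_congr fun y hy => ?_
        ring
      all_goals exact Continuous.intervalIntegrable (by fun_prop) _ _
    rw [i3] at parts
    rw [i1, i2, i4, hA0, hBA, parts, hK0, hbc]
    simp only [hRdef]
    ring

section UniqueContinuation

theorem norm_le_exp_of_deriv_deriv_eq {Q y z w : ℝ → ℂ} {σ : ℂ} {L q κ W : ℝ}
    (hκ : 0 < κ) (hqκ : q ≤ κ ^ 2) (hW : 0 < W) (hQ : ∀ x ∈ Icc 0 L, ‖Q x‖ ≤ q)
    (hy : ∀ x ∈ Icc 0 L, HasDerivAt y (z x) x)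
    (hz : ∀ x ∈ Icc 0 L, HasDerivAt z (Q x * y x - σ * w x) x)
    (hy0 : y 0 = 0) (hz0 : z 0 = 0)
    (hw : ∀ x ∈ Icc 0 L, ‖w x‖ ≤ W * Real.exp (2 * κ * x)) :
    ∀ x ∈ Icc 0 L, ‖y x‖ ≤ (‖σ‖ + 1) / κ ^ 2 * W * Real.exp (2 * κ * x) := by
  set M : ℝ := (‖σ‖ + 1) / κ * W with hM
  have hM0 : 0 < M := by positivity
  have hd : ∀ x ∈ Icc 0 L, HasDerivAt (fun x => ((κ : ℂ) * y x, z x))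
      ((κ : ℂ) * z x, Q x * y x - σ * w x) x := fun x hx =>
    ((hy x hx).const_mul (κ : ℂ)).prodMk (hz x hx)
  have key := image_norm_le_of_norm_deriv_right_lt_deriv_boundary (a := 0) (b := L)
    (f := fun x => ((κ : ℂ) * y x, z x)) (f' := fun x => ((κ : ℂ) * z x, Q x * y x - σ * w x))
    (B := fun x => M * Real.exp (2 * κ * x)) (B' := fun x => M * (Real.exp (2 * κ * x) * (2 * κ)))
    (fun x hx => (hd x hx).continuousAt.continuousWithinAt)
    (fun x hx => (hd x (Ico_subset_Icc_self hx)).hasDerivWithinAt)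
    (by simp [hy0, hz0, hM0.le])
    (fun x => (((hasDerivAt_id x).const_mul (2 * κ)).exp.congr_deriv (by simp)).const_mul M)
    (fun x hx hn => by
      have hx := Ico_subset_Icc_self hx
      have he := Real.exp_pos (2 * κ * x)
      set e := Real.exp (2 * κ * x)
      have h1 : κ * ‖y x‖ ≤ M * e := by
        rw [← hn]
        refine le_trans (le_of_eq ?_) (norm_fst_le _)
        simp [abs_of_pos hκ]
      have h2 : ‖z x‖ ≤ M * e := by
        rw [← hn]
        exact norm_snd_le (κ * y x, z x)
      refine max_lt ?_ ?_
      · simp only [norm_mul, Complex.norm_real, Real.norm_eq_abs, abs_of_pos hκ]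
        have : κ * ‖z x‖ ≤ κ * (M * e) := by gcongr
        have : 0 < κ * (M * e) := by positivity
        linarith
      · have h3 : ‖Q x * y x‖ ≤ κ * (M * e) := by
          rw [norm_mul]
          calc ‖Q x‖ * ‖y x‖ ≤ κ ^ 2 * ‖y x‖ := by
                gcongr
                exact (hQ x hx).trans hqκ
            _ = κ * (κ * ‖y x‖) := by ring
            _ ≤ κ * (M * e) := by gcongr
        have h4 : ‖σ * w x‖ ≤ ‖σ‖ * (W * e) := by
          rw [norm_mul]
          gcongr
          exact hw x hx
        have h5 : κ * (M * e) = (‖σ‖ + 1) * (W * e) := by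
          rw [hM]
          field_simp
        have h6 : 0 < W * e := by positivity
        calc ‖Q x * y x - σ * w x‖ ≤ _ := norm_sub_le _ _
          _ ≤ κ * (M * e) + ‖σ‖ * (W * e) := add_le_add h3 h4
          _ < M * (e * (2 * κ)) := by linarith)
  intro x hx
  have h1 : κ * ‖y x‖ ≤ M * Real.exp (2 * κ * x) := by
    refine le_trans (le_trans (le_of_eq ?_) (norm_fst_le _)) (key hx)
    simp [abs_of_pos hκ]
  have : (‖σ‖ + 1) / κ ^ 2 * W * Real.exp (2 * κ * x) = M * Real.exp (2 * κ * x) / κ := by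
    rw [hM]
    field_simp
  rw [this, le_div_iff₀ hκ]
  linarith

theorem norm_le_of_deriv_deriv_chain {Q : ℝ → ℂ} {y z : ℕ → ℝ → ℂ} {σ : ℂ} {L q κ W : ℝ} {n : ℕ}
    (hκ : 0 < κ) (hqκ : q ≤ κ ^ 2) (hW : 0 < W) (hQ : ∀ x ∈ Icc 0 L, ‖Q x‖ ≤ q)
    (hy : ∀ j < n, ∀ x ∈ Icc 0 L, HasDerivAt (y j) (z j x) x)
    (hz : ∀ j < n, ∀ x ∈ Icc 0 L, HasDerivAt (z j) (Q x * y j x - σ * y (j + 1) x) x)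
    (hy0 : ∀ j < n, y j 0 = 0) (hz0 : ∀ j < n, z j 0 = 0)
    (hn : ∀ x ∈ Icc 0 L, ‖y n x‖ ≤ W) :
    ∀ x ∈ Icc 0 L, ‖y 0 x‖ ≤ ((‖σ‖ + 1) / κ ^ 2) ^ n * W * Real.exp (2 * κ * x) := by
  have key : ∀ j ≤ n, ∀ x ∈ Icc 0 L,
      ‖y (n - j) x‖ ≤ ((‖σ‖ + 1) / κ ^ 2) ^ j * W * Real.exp (2 * κ * x) := by
    intro j
    induction j with
    | zero =>
      intro _ x hx
      have : 1 ≤ Real.exp (2 * κ * x) := Real.one_le_exp (by have := hx.1; positivity)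
      simpa using (hn x hx).trans (le_mul_of_one_le_right hW.le this)
    | succ j ih =>
      intro hj
      have e : n - (j + 1) + 1 = n - j := by omega
      have hlt : n - (j + 1) < n := by omega
      have := norm_le_exp_of_deriv_deriv_eq
        (W := ((‖σ‖ + 1) / κ ^ 2) ^ j * W) hκ hqκ (by positivity) hQ (hy _ hlt) (hz _ hlt)
        (hy0 _ hlt) (hz0 _ hlt) (by rw [e]; exact ih (by omega))
      intro x hx
      refine (this x hx).trans (le_of_eq ?_)
      ring
  simpa using key n le_rfl

theorem Polynomial.iteratedDeriv_eval (p : Polynomial ℂ) (n : ℕ) :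
    iteratedDeriv n (fun z => p.eval z) = fun z => (Polynomial.derivative^[n] p).eval z := by
  induction n with
  | zero => simp
  | succ n ih =>
    rw [iteratedDeriv_succ, ih]
    ext z
    rw [Polynomial.deriv, Function.iterate_succ_apply']

theorem norm_iterate_derivative_eval_le (α β t : ℝ) (ht : t ∈ Icc α β) (n : ℕ) :
    ‖(Polynomial.derivative^[n] (((Polynomial.X - Polynomial.C (α : ℂ)) *
      (Polynomial.C (β : ℂ) - Polynomial.X)) ^ n)).eval (t : ℂ)‖ ≤
      n.factorial * ((β - α + 1) ^ 2) ^ n := by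
  set p := ((Polynomial.X - Polynomial.C (α : ℂ)) * (Polynomial.C (β : ℂ) - Polynomial.X)) ^ n
  have h := Complex.norm_iteratedDeriv_le_of_forall_mem_sphere_norm_le (c := (t : ℂ)) (R := 1)
    (C := ((β - α + 1) ^ 2) ^ n) (f := fun z => p.eval z) n one_pos
    p.differentiable.diffContOnCl (by
      intro z hz
      rw [mem_sphere_iff_norm] at hz
      have h1 : ‖z - α‖ ≤ β - α + 1 := by
        have : ‖((t - α : ℝ) : ℂ)‖ = t - α := by
          rw [Complex.norm_real, Real.norm_of_nonneg (by linarith [ht.1])]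
        calc ‖z - α‖ = ‖(z - t) + ((t - α : ℝ) : ℂ)‖ := by
              congr 1
              push_cast
              ring
          _ ≤ 1 + (t - α) := (norm_add_le _ _).trans (by rw [hz, this])
          _ ≤ _ := by linarith [ht.2]
      have h2 : ‖β - z‖ ≤ β - α + 1 := by
        have : ‖((β - t : ℝ) : ℂ)‖ = β - t := by
          rw [Complex.norm_real, Real.norm_of_nonneg (by linarith [ht.2])]
        calc ‖β - z‖ = ‖((β - t : ℝ) : ℂ) - (z - t)‖ := by
              congr 1
              push_cast
              ring
          _ ≤ (β - t) + 1 := (norm_sub_le _ _).trans (by rw [hz, this])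
          _ ≤ _ := by linarith [ht.1]
      simp only [p, Polynomial.eval_pow, Polynomial.eval_mul, Polynomial.eval_sub,
        Polynomial.eval_X, Polynomial.eval_C, norm_pow, norm_mul]
      gcongr
      rw [sq]
      exact mul_le_mul h1 h2 (norm_nonneg _) ((norm_nonneg _).trans h1))
  rw [Polynomial.iteratedDeriv_eval] at h
  simpa using h

/-- If the moments `∫ φ(t) g(t, ·) dt` against polynomials `φ` vanishing at both endpoints solve
the Cauchy problem for the associated ordinary differential equation with zero data,
then `g` vanishes at the midpoint. -/
theorem eq_zero_of_polynomial_moments {g : ℝ → ℝ → ℂ} (hg : Continuous (uncurry g)) {Q : ℝ → ℂ}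
    {σ : ℂ} {L q t₀ δ : ℝ} (hδ : 0 < δ) (hQ : ∀ x ∈ Icc 0 L, ‖Q x‖ ≤ q)
    (H : ∀ φ : Polynomial ℂ, φ.eval ((t₀ - δ : ℝ) : ℂ) = 0 → φ.eval ((t₀ + δ : ℝ) : ℂ) = 0 →
      ∃ z : ℝ → ℂ, ∫ t in (t₀ - δ)..(t₀ + δ), φ.eval (t : ℂ) * g t 0 = 0 ∧ z 0 = 0 ∧
        ∀ x ∈ Icc 0 L,
          HasDerivAt (fun x => ∫ t in (t₀ - δ)..(t₀ + δ), φ.eval (t : ℂ) * g t x) (z x) x ∧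
          HasDerivAt z (Q x * (∫ t in (t₀ - δ)..(t₀ + δ), φ.eval (t : ℂ) * g t x) -
            σ * ∫ t in (t₀ - δ)..(t₀ + δ), φ.derivative.eval (t : ℂ) * g t x) x) :
    ∀ x ∈ Icc 0 L, g t₀ x = 0 := by
  intro x hx
  set α := t₀ - δ with hα
  set β := t₀ + δ with hβ
  have hαβ : α ≤ β := by linarith
  obtain ⟨G, hG⟩ := (isCompact_Icc (a := α) (b := β)).prod (isCompact_Icc (a := 0) (b := L))
    |>.exists_bound_of_continuousOn hg.continuousOn
  have hG : ∀ t ∈ Icc α β, ∀ x ∈ Icc 0 L, ‖g t x‖ ≤ max G 1 := fun t ht x hx =>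
    (hG (t, x) ⟨ht, hx⟩).trans (le_max_left _ _)
  set G' := max G 1
  have hG' : 0 < G' := lt_of_lt_of_le one_pos (le_max_right _ _)
  set φ : ℕ → Polynomial ℂ := fun n =>
    ((Polynomial.X - Polynomial.C (α : ℂ)) * (Polynomial.C (β : ℂ) - Polynomial.X)) ^ n with hφ
  have hvan : ∀ n j, j < n → ∀ r : ℂ, r = α ∨ r = β →
      (Polynomial.derivative^[j] (φ n)).eval r = 0 := by
    intro n j hj r hr
    obtain ⟨s, hs⟩ := Polynomial.pow_sub_dvd_iterate_derivative_pow
      ((Polynomial.X - Polynomial.C (α : ℂ)) * (Polynomial.C (β : ℂ) - Polynomial.X)) n j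
    simp only [hφ]
    rw [hs]
    have : n - j ≠ 0 := by omega
    rcases hr with rfl | rfl <;> simp [this]
  set D : ℝ := (β - α + 1) ^ 2
  have hD : 0 < D := by
    have : 0 < β - α + 1 := by linarith
    positivity
  set W : ℕ → ℝ := fun n => n.factorial * D ^ n * G' * (β - α) with hWdef
  have hβα : 0 < β - α := by linarith
  have bound : ∀ n : ℕ, 0 < n → q ≤ (n : ℝ) ^ 2 →
      ‖∫ t in α..β, (φ n).eval (t : ℂ) * g t x‖ ≤
        ((‖σ‖ + 1) / (n : ℝ) ^ 2) ^ n * W n * Real.exp (2 * n * x) := by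
    intro n hn hqn
    have hn' : (0 : ℝ) < n := by exact_mod_cast hn
    choose! z hz0 hz1 hz2 using fun j (hj : j < n) =>
      H (Polynomial.derivative^[j] (φ n)) (hvan n j hj _ (.inl rfl)) (hvan n j hj _ (.inr rfl))
    refine norm_le_of_deriv_deriv_chain (σ := σ) (W := W n) (z := z)
      (y := fun j x => ∫ t in α..β, (Polynomial.derivative^[j] (φ n)).eval (t : ℂ) * g t x)
      hn' hqn (by positivity) hQ (fun j hj x hx => (hz2 j hj x hx).1) (fun j hj x hx => ?_)
      hz0 hz1 (fun x hx => ?_) x hx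
    · simp only [Function.iterate_succ_apply']
      exact (hz2 j hj x hx).2
    · have := intervalIntegral.norm_integral_le_of_norm_le_const (a := α) (b := β)
        (f := fun t => (Polynomial.derivative^[n] (φ n)).eval (t : ℂ) * g t x)
        (C := n.factorial * D ^ n * G') (fun t ht => by
          rw [uIoc_of_le hαβ] at ht
          rw [norm_mul]
          exact mul_le_mul (norm_iterate_derivative_eval_le α β t (Ioc_subset_Icc_self ht) n)
            (hG t (Ioc_subset_Icc_self ht) x hx) (norm_nonneg _) (by positivity))
      rwa [abs_of_pos hβα] at this
  set c : ℝ → ℝ := fun t => (t - α) * (β - t) with hc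
  have hcc : Continuous c := by fun_prop
  have hc' : ∀ t, c t = δ ^ 2 - (t - t₀) ^ 2 := fun t => by simp only [hc, hα, hβ]; ring
  have hgx : Continuous fun t => g t x := by fun_prop
  have lim := tendsto_setIntegral_pow_smul_of_unique_maximum_of_isCompact_of_continuousOn
    (μ := volume) (s := Icc α β) (x₀ := t₀) (g := fun t => g t x) (c := c) isCompact_Icc
    hcc.continuousOn (fun t _ ht => by
      rw [hc', hc']
      have : 0 < (t - t₀) ^ 2 := by
        have := sub_ne_zero.2 ht
        positivity
      simpa using this)
    (fun t ht => mul_nonneg (by linarith [ht.1]) (by linarith [ht.2]))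
    (by rw [hc']; simpa using pow_pos hδ 2)
    (by
      rw [interior_Icc, closure_Ioo (by linarith)]
      exact ⟨by linarith, by linarith⟩) hgx.continuousOn
  refine tendsto_nhds_unique lim ?_
  have lower : ∀ n : ℕ, δ * (δ ^ 2 / 2) ^ n ≤ ∫ t in Icc α β, c t ^ n := by
    intro n
    have h1 : ∫ t in Icc (t₀ - δ / 2) (t₀ + δ / 2), (δ ^ 2 / 2) ^ n ≤
        ∫ t in Icc (t₀ - δ / 2) (t₀ + δ / 2), c t ^ n := by
      refine setIntegral_mono_on (by simp) (hcc.pow n).continuousOn.integrableOn_Icc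
        measurableSet_Icc fun t ht => ?_
      have : δ ^ 2 / 2 ≤ c t := by
        rw [hc']
        nlinarith [ht.1, ht.2, mul_nonneg (sub_nonneg.2 ht.1) (sub_nonneg.2 ht.2)]
      gcongr
    have h2 : ∫ t in Icc (t₀ - δ / 2) (t₀ + δ / 2), c t ^ n ≤ ∫ t in Icc α β, c t ^ n := by
      refine setIntegral_mono_set (hcc.pow n).continuousOn.integrableOn_Icc ?_ ?_
      · refine (ae_restrict_iff' measurableSet_Icc).2 (Eventually.of_forall fun t ht => ?_)
        exact pow_nonneg (mul_nonneg (by linarith [ht.1]) (by linarith [ht.2])) n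
      · exact (Icc_subset_Icc (by linarith) (by linarith)).eventuallyLE
    refine le_trans (le_of_eq ?_) (h1.trans h2)
    simp [show t₀ + δ / 2 - (t₀ - δ / 2) = δ by ring, hδ.le]
  set E : ℝ := (‖σ‖ + 1) * D * Real.exp (2 * x) / (δ ^ 2 / 2) with hE
  have hE0 : 0 < E := by positivity
  have up : ∀ᶠ n : ℕ in atTop, ‖(∫ t in Icc α β, c t ^ n)⁻¹ • ∫ t in Icc α β, c t ^ n • g t x‖ ≤
      G' * (β - α) / δ * (1 / 2) ^ n := by
    filter_upwards [eventually_gt_atTop 0, tendsto_natCast_atTop_atTop.eventually_ge_atTop (max q 1),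
      tendsto_natCast_atTop_atTop.eventually_ge_atTop (2 * E)] with n hn hn1 hn2
    have hn' : (0 : ℝ) < n := by exact_mod_cast hn
    have hqn : q ≤ (n : ℝ) ^ 2 := by
      have := le_max_left q 1
      have := le_max_right q 1
      nlinarith
    have hb := bound n hn hqn
    have e1 : ∫ t in Icc α β, c t ^ n • g t x = ∫ t in α..β, (φ n).eval (t : ℂ) * g t x := by
      rw [integral_of_le hαβ, ← integral_Icc_eq_integral_Ioc]
      congr 1
      ext t
      simp [hφ, hc, Complex.real_smul]
    rw [e1, norm_smul, norm_inv]
    have hl := lower n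
    have hpos : 0 < δ * (δ ^ 2 / 2) ^ n := by positivity
    have h3 : ‖∫ t in Icc α β, c t ^ n‖ ≥ δ * (δ ^ 2 / 2) ^ n :=
      hl.trans (Real.le_norm_self _)
    have h4 : ((‖σ‖ + 1) / (n : ℝ) ^ 2) ^ n * W n * Real.exp (2 * n * x) ≤
        ((‖σ‖ + 1) * D * Real.exp (2 * x) / n) ^ n * (G' * (β - α)) := by
      have hf : (n.factorial : ℝ) ≤ (n : ℝ) ^ n := by exact_mod_cast Nat.factorial_le_pow n
      have he : Real.exp (2 * n * x) = Real.exp (2 * x) ^ n := by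
        rw [← Real.exp_nat_mul]
        congr 1
        ring
      rw [he]
      calc _ = ((‖σ‖ + 1) / (n : ℝ) ^ 2) ^ n * (n.factorial * D ^ n * G' * (β - α))
            * Real.exp (2 * x) ^ n := rfl
        _ ≤ ((‖σ‖ + 1) / (n : ℝ) ^ 2) ^ n * ((n : ℝ) ^ n * D ^ n * G' * (β - α))
            * Real.exp (2 * x) ^ n := by gcongr
        _ = (((‖σ‖ + 1) / (n : ℝ) ^ 2) * n * D * Real.exp (2 * x)) ^ n * (G' * (β - α)) := by
          simp only [mul_pow]
          ring
        _ = _ := by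
          congr 2
          field_simp
    have h5 : (‖σ‖ + 1) * D * Real.exp (2 * x) / n ≤ (δ ^ 2 / 2) * (1 / 2) := by
      have : (‖σ‖ + 1) * D * Real.exp (2 * x) = E * (δ ^ 2 / 2) := by
        rw [hE]
        field_simp
      rw [div_le_iff₀ hn', this]
      have : 0 < δ ^ 2 / 2 := by positivity
      nlinarith
    calc _ ≤ (δ * (δ ^ 2 / 2) ^ n)⁻¹ * (((δ ^ 2 / 2) * (1 / 2)) ^ n * (G' * (β - α))) := by
          gcongr
          exact hb.trans (h4.trans (by gcongr))
      _ = _ := by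
        rw [mul_pow]
        field_simp
  refine squeeze_zero_norm' up ?_
  simpa using (tendsto_pow_atTop_nhds_zero_of_lt_one (r := (1 / 2 : ℝ)) (by norm_num)
    (by norm_num)).const_mul (G' * (β - α) / δ)

end UniqueContinuation

/-- A function of class `C^{1,2}` on a rectangle agrees there with a function on the plane that is
twice continuously differentiable in the second variable. -/
theorem IsC12.exists_extension {T ℓ : ℝ} (hT : 0 ≤ T) (hℓ : 0 ≤ ℓ) {u ut ux uxx : ℝ → ℝ → ℂ}
    (hu : IsC12 T ℓ u ut ux uxx) :
    ∃ U Ux Uxx : ℝ → ℝ → ℂ, Continuous (uncurry U) ∧ Continuous (uncurry Ux) ∧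
      Continuous (uncurry Uxx) ∧ (∀ t x, HasDerivAt (U t) (Ux t x) x) ∧
      (∀ t x, HasDerivAt (Ux t) (Uxx t x) x) ∧
      ∀ t ∈ Icc 0 T, ∀ x ∈ Icc 0 ℓ, U t x = u t x ∧ Ux t x = ux t x ∧ Uxx t x = uxx t x := by
  obtain ⟨hd, hcu, -, hcx, hcxx⟩ := hu
  set τ : ℝ → ℝ := fun t => max 0 (min T t) with hτdef
  set ξ : ℝ → ℝ := fun x => max 0 (min ℓ x) with hξdef
  have hτc : Continuous τ := by fun_prop
  have hξc : Continuous ξ := by fun_prop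
  have hτ : ∀ t, τ t ∈ Icc 0 T := fun t => ⟨le_max_left _ _, max_le hT (min_le_left _ _)⟩
  have hξ : ∀ x, ξ x ∈ Icc 0 ℓ := fun x => ⟨le_max_left _ _, max_le hℓ (min_le_left _ _)⟩
  have hτe : ∀ t ∈ Icc 0 T, τ t = t := fun t ht => by simp [hτdef, ht.1, ht.2]
  have hξe : ∀ x ∈ Icc 0 ℓ, ξ x = x := fun x hx => by simp [hξdef, hx.1, hx.2]
  have h0 : (0 : ℝ) ∈ Icc 0 ℓ := ⟨le_rfl, hℓ⟩
  have cxx : Continuous (uncurry fun t x => uxx (τ t) (ξ x)) :=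
    hcxx.comp_continuous (f := fun z : ℝ × ℝ => (τ z.1, ξ z.2)) (by fun_prop)
      fun z => ⟨hτ _, hξ _⟩
  have cx0 : Continuous fun t => ux (τ t) 0 :=
    hcx.comp_continuous (f := fun t => (τ t, (0 : ℝ))) (by fun_prop) fun t => ⟨hτ _, h0⟩
  have c0 : Continuous fun t => u (τ t) 0 :=
    hcu.comp_continuous (f := fun t => (τ t, (0 : ℝ))) (by fun_prop) fun t => ⟨hτ _, h0⟩
  set Uxx : ℝ → ℝ → ℂ := fun t x => uxx (τ t) (ξ x) with hUxx
  set Ux : ℝ → ℝ → ℂ := fun t x => ux (τ t) 0 + ∫ s in (0:ℝ)..x, Uxx t s with hUx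
  have cx : Continuous (uncurry Ux) := by
    exact (cx0.comp continuous_fst).add (continuous_uncurry_primitive cxx)
  set U : ℝ → ℝ → ℂ := fun t x => u (τ t) 0 + ∫ s in (0:ℝ)..x, Ux t s with hU
  have c : Continuous (uncurry U) := by
    exact (c0.comp continuous_fst).add (continuous_uncurry_primitive cx)
  have key : ∀ (f f' : ℝ → ℂ), (∀ x ∈ Icc 0 ℓ, HasDerivWithinAt f (f' x) (Icc 0 ℓ) x) →
      ∀ F : ℝ → ℂ, Continuous F → (∀ x ∈ Icc 0 ℓ, F x = f' x) →
      ∀ x ∈ Icc 0 ℓ, f 0 + ∫ s in (0:ℝ)..x, F s = f x := by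
    intro f f' hf F hF hFf x hx
    rw [integral_eq_sub_of_hasDerivAt_of_le (f := f) hx.1
      (fun y hy => (hf y ⟨hy.1, hy.2.trans hx.2⟩).continuousWithinAt.mono
        (Icc_subset_Icc_right hx.2)) (fun y hy => ?_) (hF.intervalIntegrable _ _)]
    · ring
    · rw [hFf y ⟨hy.1.le, hy.2.le.trans hx.2⟩]
      exact (hf y ⟨hy.1.le, hy.2.le.trans hx.2⟩).hasDerivAt
        (Icc_mem_nhds hy.1 (hy.2.trans_le hx.2))
  have ex : ∀ t ∈ Icc 0 T, ∀ x ∈ Icc 0 ℓ, Ux t x = ux t x := by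
    intro t ht x hx
    simp only [hUx, hτe t ht]
    exact key (ux t) (uxx t) (fun x hx => (hd t ht x hx).2.2) (Uxx t) (by fun_prop)
      (fun x hx => by simp only [hUxx, hτe t ht, hξe x hx]) x hx
  refine ⟨U, Ux, Uxx, c, cx, cxx, fun t x => ?_, fun t x => ?_, fun t ht x hx =>
    ⟨?_, ex t ht x hx, by simp only [hUxx, hτe t ht, hξe x hx]⟩⟩
  · exact ((Continuous.integral_hasStrictDerivAt (f := Ux t) (by fun_prop) 0 x).hasDerivAt).const_add
      _
  · exact ((Continuous.integral_hasStrictDerivAt (f := Uxx t) (by fun_prop) 0 x).hasDerivAt).const_add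
      _
  · simp only [hU, hτe t ht]
    exact key (u t) (ux t) (fun x hx => (hd t ht x hx).2.1) (Ux t) (by fun_prop) (ex t ht) x hx

section VolterraUniqueness

theorem exists_mul_abs_sub_le_norm {f : ℝ → ℂ} {f' : ℂ} {x₀ : ℝ} (hf : HasDerivAt f f' x₀)
    (h : f x₀ = 0 → f' ≠ 0) : ∃ c > 0, ∀ᶠ x in 𝓝 x₀, c * |x - x₀| ≤ ‖f x‖ := by
  by_cases h0 : f x₀ = 0
  · have hf' : 0 < ‖f'‖ := norm_pos_iff.2 (h h0)
    refine ⟨‖f'‖ / 2, by positivity, ?_⟩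
    filter_upwards [(hasDerivAt_iff_isLittleO.1 hf).def (half_pos hf')] with x hx
    rw [h0, sub_zero, Real.norm_eq_abs] at hx
    have h1 := norm_sub_norm_le ((x - x₀) • f') (f x)
    rw [norm_sub_rev, norm_smul, Real.norm_eq_abs] at h1
    linarith
  · have hpos : 0 < ‖f x₀‖ := norm_pos_iff.2 h0
    refine ⟨‖f x₀‖ / 2, by positivity, ?_⟩
    filter_upwards [hf.continuousAt.norm.eventually_const_le (half_lt_self hpos),
      Metric.ball_mem_nhds x₀ one_pos] with x hx hx1
    rw [Metric.mem_ball, Real.dist_eq] at hx1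
    nlinarith

theorem eq_zero_of_mul_eq_volterra {R F f f' : ℝ → ℂ} {K : ℝ → ℝ → ℂ} {L C : ℝ} (hL : 0 < L)
    (hR : Continuous R) (hF : Continuous F) (hK : Continuous (uncurry K)) (hC : 0 ≤ C)
    (hKC : ∀ x y, 0 ≤ y → y ≤ x → x ≤ L → ‖K x y‖ ≤ C * ∫ s in (0:ℝ)..(x + y) / 2, ‖R s‖)
    (hf : ∀ x, HasDerivAt f (f' x) x) (hf0 : ∀ x ∈ Ico 0 L, f x = 0 → f' x ≠ 0)
    (heq : ∀ x ∈ Ioo 0 L, R x * f x = ∫ y in (0:ℝ)..x, K x y * F y) :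
    ∀ x ∈ Icc 0 L, R x = 0 := by
  set ρ : ℝ → ℝ := fun x => ∫ s in (0:ℝ)..x, ‖R s‖ with hρ
  have hρd : ∀ x, HasDerivAt ρ ‖R x‖ x := fun x =>
    (Continuous.integral_hasStrictDerivAt (by fun_prop) 0 x).hasDerivAt
  have hρc : Continuous ρ := continuous_iff_continuousAt.2 fun x => (hρd x).continuousAt
  have hρmono : Monotone ρ := monotone_of_hasDerivAt_nonneg hρd fun x => norm_nonneg _
  have hρ0 : ρ 0 = 0 := by simp [hρ]
  obtain ⟨B, hB⟩ := (isCompact_Icc (a := 0) (b := L)).exists_bound_of_continuousOn hF.continuousOn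
  have hB0 : 0 ≤ B := (norm_nonneg _).trans (hB 0 ⟨le_rfl, hL.le⟩)
  have main : Icc 0 L ⊆ {x | ρ x = 0} := by
    refine IsClosed.Icc_subset_of_forall_exists_gt
      ((isClosed_eq hρc continuous_const).inter isClosed_Icc) hρ0 ?_
    rintro x₀ ⟨hx₀ : ρ x₀ = 0, hx₀L⟩ y hy
    obtain ⟨c, hc, hev⟩ := exists_mul_abs_sub_le_norm (hf x₀) (hf0 x₀ hx₀L)
    obtain ⟨ε, hε, hball⟩ := Metric.eventually_nhds_iff.1 hev
    set b := min (min y (x₀ + ε / 2)) ((x₀ + L) / 2) with hb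
    have hbx : x₀ < b := lt_min (lt_min hy (by linarith)) (by linarith [hx₀L.2])
    have hby : b ≤ y := (min_le_left _ _).trans (min_le_left _ _)
    have hbε : b ≤ x₀ + ε / 2 := (min_le_left _ _).trans (min_le_right _ _)
    have hbL : b < L := (min_le_right _ _).trans_lt (by linarith [hx₀L.2])
    have est : Ioc x₀ b ⊆ {x | ‖R x‖ ≤ 2 * C * B / c * ρ x} := by
      intro x hx
      have hxL : x < L := hx.2.trans_lt hbL
      have hx0 : 0 < x := hx₀L.1.trans_lt hx.1
      have hd : 0 < x - x₀ := sub_pos.2 hx.1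
      have hlow : c * (x - x₀) ≤ ‖f x‖ := by
        have := hball (y := x) (by rw [Real.dist_eq, abs_of_pos hd]; linarith [hx.2])
        rwa [abs_of_pos hd] at this
      have hKF : ∀ y, 0 ≤ y → y ≤ x → ‖K x y * F y‖ ≤ C * ρ ((x + y) / 2) * B := fun y h1 h2 => by
        rw [norm_mul]
        exact mul_le_mul (hKC x y h1 h2 hxL.le) (hB y ⟨h1, h2.trans hxL.le⟩) (norm_nonneg _)
          (mul_nonneg hC (by
            rw [← hρ0]
            exact hρmono (by linarith)))
      set m := max 0 (2 * x₀ - x) with hm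
      have hm0 : 0 ≤ m := le_max_left _ _
      have hmx : m ≤ x := max_le hx0.le (by linarith)
      have hcont : Continuous fun y => K x y * F y := by fun_prop
      have i1 : ∫ y in (0:ℝ)..m, K x y * F y = 0 := by
        rcases le_total (2 * x₀ - x) 0 with h | h
        · simp [hm, h]
        rw [integral_congr (g := fun _ => 0), intervalIntegral.integral_zero]
        intro y hy
        rw [uIcc_of_le hm0] at hy
        refine norm_le_zero_iff.1 ((hKF y hy.1 (hy.2.trans hmx)).trans_eq ?_)
        rw [hm, max_eq_right h] at hy
        have h1 : ρ ((x + y) / 2) ≤ 0 := by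
          rw [← hx₀]
          exact hρmono (by linarith [hy.2])
        have h2 : 0 ≤ ρ ((x + y) / 2) := by
          rw [← hρ0]
          exact hρmono (by linarith [hy.1])
        rw [le_antisymm h1 h2]
        ring
      have i2 : ‖∫ y in m..x, K x y * F y‖ ≤ C * ρ x * B * |x - m| := by
        refine intervalIntegral.norm_integral_le_of_norm_le_const fun y hy => ?_
        rw [uIoc_of_le hmx] at hy
        refine (hKF y (hm0.trans hy.1.le) hy.2).trans ?_
        have : ρ ((x + y) / 2) ≤ ρ x := hρmono (by linarith [hy.2])
        gcongr
      have i3 := heq x ⟨hx0, hxL⟩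
      rw [← intervalIntegral.integral_add_adjacent_intervals (hcont.intervalIntegrable 0 m)
        (hcont.intervalIntegrable m x), i1, zero_add] at i3
      have hρx : 0 ≤ ρ x := by
        rw [← hρ0]
        exact hρmono hx0.le
      have hxm : |x - m| ≤ 2 * (x - x₀) := by
        rw [abs_of_nonneg (sub_nonneg.2 hmx)]
        have := le_max_right 0 (2 * x₀ - x)
        linarith
      have i4 : ‖R x‖ * (c * (x - x₀)) ≤ C * ρ x * B * (2 * (x - x₀)) :=
        calc ‖R x‖ * (c * (x - x₀)) ≤ ‖R x‖ * ‖f x‖ := by gcongr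
          _ = ‖∫ y in m..x, K x y * F y‖ := by rw [← norm_mul, i3]
          _ ≤ C * ρ x * B * |x - m| := i2
          _ ≤ _ := by gcongr
      have i5 : ‖R x‖ * c ≤ 2 * C * B * ρ x := by
        refine le_of_mul_le_mul_right ?_ hd
        linarith
      change ‖R x‖ ≤ _
      rw [div_mul_eq_mul_div, le_div_iff₀ hc]
      exact i5
    have est' : Icc x₀ b ⊆ {x | ‖R x‖ ≤ 2 * C * B / c * ρ x} := by
      rw [← closure_Ioc hbx.ne]
      exact closure_minimal est (isClosed_le (by fun_prop) (by fun_prop))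
    have gron := norm_le_gronwallBound_of_norm_deriv_right_le (f := ρ) (f' := fun x => ‖R x‖)
      (δ := 0) (ε := 0) (K := 2 * C * B / c) (a := x₀) (b := b) hρc.continuousOn
      (fun x _ => (hρd x).hasDerivWithinAt) (by simp [hx₀]) (fun x hx => by
        have h1 : ‖R x‖ ≤ _ := est' (Ico_subset_Icc_self hx)
        have h2 : 0 ≤ ρ x := by
          rw [← hx₀]
          exact hρmono hx.1
        simpa [abs_of_nonneg h2] using h1) b ⟨hbx.le, le_rfl⟩
    refine ⟨b, ?_, hbx, hby⟩
    simpa [gronwallBound_ε0] using gron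
  have hIoo : ∀ x ∈ Ioo 0 L, R x = 0 := by
    intro x hx
    have h1 : ρ =ᶠ[𝓝 x] fun _ => 0 := by
      filter_upwards [Icc_mem_nhds hx.1 hx.2] with y hy using main hy
    have := ((hρd x).congr_of_eventuallyEq h1.symm).unique (hasDerivAt_const x 0)
    simpa using this
  exact Set.EqOn.of_subset_closure (g := fun _ => 0) hIoo hR.continuousOn continuousOn_const
    Ioo_subset_Icc_self (by rw [closure_Ioo hL.ne])

end VolterraUniqueness

section NormalForm

/-- Continuous functions agreeing on an open interval agree on its closure. -/
theorem eqOn_Icc_of_eqOn_Ioo {f g : ℝ → ℂ} {L : ℝ} (hL : 0 < L) (h : EqOn f g (Ioo 0 L))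
    (hf : ContinuousOn f (Icc 0 L)) (hg : ContinuousOn g (Icc 0 L)) : EqOn f g (Icc 0 L) :=
  h.of_subset_closure hf hg Ioo_subset_Icc_self (by rw [closure_Ioo hL.ne])

/-- The moments of a solution against a polynomial vanishing at both endpoints solve an ordinary
differential equation. -/
theorem IsC12.moment_eq {T L : ℝ} (hL : 0 < L) {u ut ux uxx : ℝ → ℝ → ℂ}
    (hu : IsC12 T L u ut ux uxx) {σ : ℂ} {P : ℝ → ℂ} (hP : Continuous P)
    (hpde : ∀ t ∈ Ioo 0 T, ∀ x ∈ Ioo 0 L, σ * ut t x = uxx t x - P x * u t x)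
    {α β : ℝ} (hα : 0 < α) (hαβ : α ≤ β) (hβ : β < T) (φ : Polynomial ℂ)
    (hφα : φ.eval (α : ℂ) = 0) (hφβ : φ.eval (β : ℂ) = 0) {x : ℝ} (hx : x ∈ Icc 0 L) :
    (∫ t in α..β, φ.eval (t : ℂ) * uxx t x) - P x * (∫ t in α..β, φ.eval (t : ℂ) * u t x) =
      -σ * ∫ t in α..β, φ.derivative.eval (t : ℂ) * u t x := by
  obtain ⟨hd, hcu, hct, hcx, hcxx⟩ := hu
  have hsub : Icc α β ⊆ Ioo 0 T := fun t ht => ⟨hα.trans_le ht.1, ht.2.trans_lt hβ⟩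
  have slice : ∀ {f : ℝ → ℝ → ℂ}, ContinuousOn (fun z : ℝ × ℝ => f z.1 z.2) (Icc 0 T ×ˢ Icc 0 L) →
      ContinuousOn (fun t => f t x) (uIcc α β) := fun {f} hf => by
    rw [uIcc_of_le hαβ]
    exact hf.comp (f := fun t : ℝ => (t, x)) (by fun_prop) fun t ht =>
      ⟨Ioo_subset_Icc_self (hsub ht), hx⟩
  have hpde' : ∀ t ∈ Icc α β, σ * ut t x = uxx t x - P x * u t x := by
    intro t ht
    have ht' := hsub ht
    have sl : ∀ {f : ℝ → ℝ → ℂ}, ContinuousOn (fun z : ℝ × ℝ => f z.1 z.2) (Icc 0 T ×ˢ Icc 0 L) →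
        ContinuousOn (fun x => f t x) (Icc 0 L) := fun {f} hf =>
      hf.comp (f := fun x : ℝ => (t, x)) (by fun_prop) fun x hx => ⟨Ioo_subset_Icc_self ht', hx⟩
    exact eqOn_Icc_of_eqOn_Ioo hL (f := fun x => σ * ut t x)
      (g := fun x => uxx t x - P x * u t x) (fun x hx => hpde t ht' x hx)
      (continuousOn_const.mul (sl hct)) ((sl hcxx).sub (hP.continuousOn.mul (sl hcu))) hx
  have hev : ∀ ψ : Polynomial ℂ, Continuous fun t : ℝ => ψ.eval (t : ℂ) := fun ψ => by fun_prop
  have parts := integral_mul_deriv_eq_deriv_mul (a := α) (b := β)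
    (u := fun t : ℝ => φ.eval (t : ℂ)) (u' := fun t : ℝ => φ.derivative.eval (t : ℂ))
    (v := fun t => u t x) (v' := fun t => ut t x)
    (fun t _ => (φ.hasDerivAt (t : ℂ)).comp_ofReal)
    (fun t ht => by
      rw [uIcc_of_le hαβ] at ht
      have := hsub ht
      exact (hd t (Ioo_subset_Icc_self this) x hx).1.hasDerivAt (Icc_mem_nhds this.1 this.2))
    ((hev _).intervalIntegrable _ _) (slice hct).intervalIntegrable
  rw [hφα, hφβ] at parts
  have e : ∫ t in α..β, φ.eval (t : ℂ) * (σ * ut t x) =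
      (∫ t in α..β, φ.eval (t : ℂ) * uxx t x) -
        P x * (∫ t in α..β, φ.eval (t : ℂ) * u t x) := by
    rw [← intervalIntegral.integral_const_mul, ← intervalIntegral.integral_sub]
    · refine integral_congr fun t ht => ?_
      rw [uIcc_of_le hαβ] at ht
      simp only [hpde' t ht]
      ring
    · exact ((hev _).continuousOn.mul (slice hcxx)).intervalIntegrable
    · exact (continuousOn_const.mul ((hev _).continuousOn.mul (slice hcu))).intervalIntegrable
  have e' : ∫ t in α..β, φ.eval (t : ℂ) * (σ * ut t x) =
      σ * ∫ t in α..β, φ.eval (t : ℂ) * ut t x := by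
    rw [← intervalIntegral.integral_const_mul]
    exact integral_congr fun t _ => by ring
  rw [← e, e', parts]
  ring

theorem hasDerivAt_moment {U U' : ℝ → ℝ → ℂ} (hU : Continuous (uncurry U))
    (hU' : Continuous (uncurry U')) (hd : ∀ t x, HasDerivAt (U t) (U' t x) x) (φ : Polynomial ℂ)
    (α β x : ℝ) :
    HasDerivAt (fun x => ∫ t in α..β, φ.eval (t : ℂ) * U t x)
      (∫ t in α..β, φ.eval (t : ℂ) * U' t x) x := by
  have := hasDerivAt_integral_of_continuous_deriv (H := fun x t => φ.eval (t : ℂ) * U t x)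
    (H' := fun x t => φ.eval (t : ℂ) * U' t x) (by fun_prop) (by fun_prop)
    (fun x t => (hd t x).const_mul _) (hasDerivAt_const x α) (hasDerivAt_const x β)
  simpa using this

/-- Uniqueness of the potential from one boundary measurement, for equations whose leading
coefficient is one. -/
theorem potential_eq_of_normal_form {T L : ℝ} (hT : 0 < T) (hL : 0 < L) {σ h : ℂ} {P Q : ℝ → ℂ}
    (hP : Continuous P) (hQ : Continuous Q) {u ut ux uxx v vt vx vxx : ℝ → ℝ → ℂ}
    (hu : IsC12 T L u ut ux uxx) (hv : IsC12 T L v vt vx vxx)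
    (hupde : ∀ t ∈ Ioo 0 T, ∀ x ∈ Ioo 0 L, σ * ut t x = uxx t x - P x * u t x)
    (hvpde : ∀ t ∈ Ioo 0 T, ∀ x ∈ Ioo 0 L, σ * vt t x = vxx t x - Q x * v t x)
    (hinit : ∀ x ∈ Icc 0 L, u 0 x = v 0 x) (hdir : ∀ t ∈ Ioo 0 T, u t 0 = v t 0)
    (hu0 : ∀ t ∈ Ioo 0 T, ux t 0 = h * u t 0) (hv0 : ∀ t ∈ Ioo 0 T, vx t 0 = h * v t 0)
    (hord : ∀ x ∈ Icc 0 L, u 0 x = 0 → ux 0 x ≠ 0) :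
    ∀ x ∈ Icc 0 L, P x = Q x := by
  obtain ⟨U, Ux, Uxx, cU, cUx, cUxx, dU, dUx, eU⟩ := hu.exists_extension hT.le hL.le
  obtain ⟨V, Vx, Vxx, cV, cVx, cVxx, dV, dVx, eV⟩ := hv.exists_extension hT.le hL.le
  obtain ⟨K, cK, ⟨C, hC, hKC⟩, hK⟩ := exists_transmutation hP hQ h hL.le
  have h0L : (0 : ℝ) ∈ Icc 0 L := ⟨le_rfl, hL.le⟩
  have h0T : (0 : ℝ) ∈ Icc 0 T := ⟨le_rfl, hT.le⟩
  have cKU : Continuous (uncurry fun t x => ∫ y in (0:ℝ)..x, K x y * U t y) :=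
    continuous_integral_of_continuous (X := ℝ × ℝ) (H := fun z y => K z.2 y * U z.1 y)
      (by fun_prop) (α := fun _ => 0) (β := fun z => z.2) (by fun_prop) (by fun_prop)
  set g : ℝ → ℝ → ℂ := fun t x => U t x + (∫ y in (0:ℝ)..x, K x y * U t y) - V t x with hg
  have cg : Continuous (uncurry g) := (cU.add cKU).sub cV
  have swap : ∀ (φ : Polynomial ℂ) (α β x : ℝ),
      ∫ t in α..β, φ.eval (t : ℂ) * g t x = (∫ t in α..β, φ.eval (t : ℂ) * U t x) +
        (∫ y in (0:ℝ)..x, K x y * ∫ t in α..β, φ.eval (t : ℂ) * U t y) -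
          ∫ t in α..β, φ.eval (t : ℂ) * V t x := by
    intro φ α β x
    have e1 : ∫ y in (0:ℝ)..x, K x y * ∫ t in α..β, φ.eval (t : ℂ) * U t y =
        ∫ t in α..β, φ.eval (t : ℂ) * ∫ y in (0:ℝ)..x, K x y * U t y := by
      simp only [← intervalIntegral.integral_const_mul]
      rw [intervalIntegral_intervalIntegral_swap]
      · refine integral_congr fun t _ => integral_congr fun y _ => ?_
        ring
      · have : Continuous (uncurry fun y t : ℝ => K x y * (φ.eval (t : ℂ) * U t y)) := by fun_prop
        exact (this.continuousOn.integrableOn_compact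
          (isCompact_uIcc.prod isCompact_uIcc)).mono_set
            (Set.prod_mono uIoc_subset_uIcc uIoc_subset_uIcc)
    rw [e1, ← intervalIntegral.integral_add, ← intervalIntegral.integral_sub]
    · refine integral_congr fun t _ => ?_
      simp only [hg]
      ring
    · exact Continuous.intervalIntegrable (by fun_prop) _ _
    · exact Continuous.intervalIntegrable (by fun_prop) _ _
    · exact Continuous.intervalIntegrable (by fun_prop) _ _
    · exact Continuous.intervalIntegrable (by fun_prop) _ _
  obtain ⟨q, hq⟩ := (isCompact_Icc (a := 0) (b := L)).exists_bound_of_continuousOn hQ.continuousOn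
  have g_zero : ∀ t ∈ Ioo 0 T, ∀ x ∈ Icc 0 L, g t x = 0 := by
    intro t₀ ht₀
    obtain ⟨δ, hδ, hδ1, hδ2⟩ : ∃ δ > 0, 0 < t₀ - δ ∧ t₀ + δ < T := by
      refine ⟨min (t₀ / 2) ((T - t₀) / 2), lt_min (by linarith [ht₀.1]) (by linarith [ht₀.2]), ?_, ?_⟩
      · linarith [min_le_left (t₀ / 2) ((T - t₀) / 2), ht₀.1]
      · linarith [min_le_right (t₀ / 2) ((T - t₀) / 2), ht₀.2]
    refine eq_zero_of_polynomial_moments (σ := σ) cg hδ hq fun φ hφα hφβ => ?_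
    set α := t₀ - δ
    set β := t₀ + δ
    have hαβ : α ≤ β := by linarith
    have hsub : ∀ t ∈ uIcc α β, t ∈ Ioo 0 T := fun t ht => by
      rw [uIcc_of_le hαβ] at ht
      exact ⟨hδ1.trans_le ht.1, ht.2.trans_lt hδ2⟩
    have bc : ∀ {W Wx w wx : ℝ → ℝ → ℂ}, (∀ t ∈ Icc 0 T, W t 0 = w t 0 ∧ Wx t 0 = wx t 0) →
        (∀ t ∈ Ioo 0 T, wx t 0 = h * w t 0) →
        ∫ t in α..β, φ.eval (t : ℂ) * Wx t 0 = h * ∫ t in α..β, φ.eval (t : ℂ) * W t 0 := by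
      intro W Wx w wx he hw
      rw [← intervalIntegral.integral_const_mul]
      refine integral_congr fun t ht => ?_
      simp only [(he t (Ioo_subset_Icc_self (hsub t ht))).1,
        (he t (Ioo_subset_Icc_self (hsub t ht))).2, hw t (hsub t ht)]
      ring
    have hUbc := bc (fun t ht => ⟨(eU t ht 0 h0L).1, (eU t ht 0 h0L).2.1⟩) hu0
    have hVbc := bc (fun t ht => ⟨(eV t ht 0 h0L).1, (eV t ht 0 h0L).2.1⟩) hv0
    have hUV : ∀ ψ : Polynomial ℂ, ∫ t in α..β, ψ.eval (t : ℂ) * U t 0 =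
        ∫ t in α..β, ψ.eval (t : ℂ) * V t 0 := fun ψ => integral_congr fun t ht => by
      have := Ioo_subset_Icc_self (hsub t ht)
      simp only [(eU t this 0 h0L).1, (eV t this 0 h0L).1, hdir t (hsub t ht)]
    have ext : ∀ {W w : ℝ → ℝ → ℂ} {x : ℝ}, (∀ t ∈ Icc 0 T, W t x = w t x) →
        ∀ ψ : Polynomial ℂ, ∫ t in α..β, ψ.eval (t : ℂ) * W t x =
          ∫ t in α..β, ψ.eval (t : ℂ) * w t x := fun he ψ => integral_congr fun t ht => by
      simp only [he t (Ioo_subset_Icc_self (hsub t ht))]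
    have odeU : ∀ x ∈ Icc 0 L, (∫ t in α..β, φ.eval (t : ℂ) * Uxx t x) -
        P x * (∫ t in α..β, φ.eval (t : ℂ) * U t x) =
          -σ * ∫ t in α..β, φ.derivative.eval (t : ℂ) * U t x := fun x hx => by
      rw [ext fun t ht => (eU t ht x hx).1, ext fun t ht => (eU t ht x hx).1,
        ext fun t ht => (eU t ht x hx).2.2]
      exact hu.moment_eq hL hP hupde hδ1 hαβ hδ2 φ hφα hφβ hx
    have odeV : ∀ x ∈ Icc 0 L, (∫ t in α..β, φ.eval (t : ℂ) * Vxx t x) -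
        Q x * (∫ t in α..β, φ.eval (t : ℂ) * V t x) =
          -σ * ∫ t in α..β, φ.derivative.eval (t : ℂ) * V t x := fun x hx => by
      rw [ext fun t ht => (eV t ht x hx).1, ext fun t ht => (eV t ht x hx).1,
        ext fun t ht => (eV t ht x hx).2.2]
      exact hv.moment_eq hL hQ hvpde hδ1 hαβ hδ2 φ hφα hφβ hx
    obtain ⟨g₁, hg₁0, hg₁⟩ := hK _ _ _ (hasDerivAt_moment cU cUx dU φ α β)
      (hasDerivAt_moment cUx cUxx dUx φ α β)
      (continuous_integral_of_continuous (X := ℝ) (H := fun x t => φ.eval (t : ℂ) * Uxx t x)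
        (by fun_prop) continuous_const continuous_const) hUbc
    refine ⟨fun x => g₁ x - ∫ t in α..β, φ.eval (t : ℂ) * Vx t x, ?_, ?_, fun x hx => ⟨?_, ?_⟩⟩
    · rw [swap, hUV]
      simp
    · simp only [hg₁0]
      rw [hUbc, hVbc, hUV, sub_self]
    · simp only [swap]
      exact (hg₁ x hx).1.sub (hasDerivAt_moment cV cVx dV φ α β x)
    · refine ((hg₁ x hx).2.sub (hasDerivAt_moment cVx cVxx dVx φ α β x)).congr_deriv ?_
      rw [swap, swap, odeU x hx, sub_eq_iff_eq_add.1 (odeV x hx)]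
      have : ∫ y in (0:ℝ)..x, K x y * ((∫ t in α..β, φ.eval (t : ℂ) * Uxx t y) -
          P y * ∫ t in α..β, φ.eval (t : ℂ) * U t y) =
          -σ * ∫ y in (0:ℝ)..x, K x y * ∫ t in α..β, φ.derivative.eval (t : ℂ) * U t y := by
        rw [← intervalIntegral.integral_const_mul]
        refine integral_congr fun y hy => ?_
        rw [uIcc_of_le hx.1] at hy
        simp only [odeU y ⟨hy.1, hy.2.trans hx.2⟩]
        ring
      rw [this]
      ring
  have transmute_eq : ∀ x ∈ Icc 0 L, U 0 x + ∫ y in (0:ℝ)..x, K x y * U 0 y = U 0 x := by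
    intro x hx
    have h1 : g 0 x = 0 := eqOn_Icc_of_eqOn_Ioo hT (f := fun t => g t x) (g := fun _ => 0)
      (fun t ht => g_zero t ht x hx) (by fun_prop) continuousOn_const h0T
    have h2 : V 0 x = U 0 x := by
      rw [(eU 0 h0T x hx).1, (eV 0 h0T x hx).1, hinit x hx]
    simp only [hg, h2] at h1
    exact sub_eq_zero.1 h1
  have bc0 : Ux 0 0 = h * U 0 0 := eqOn_Icc_of_eqOn_Ioo hT (f := fun t => Ux t 0)
    (g := fun t => h * U t 0) (fun t ht => by
      have := Ioo_subset_Icc_self ht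
      simp only [(eU t this 0 h0L).1, (eU t this 0 h0L).2.1, hu0 t ht]) (by fun_prop) (by fun_prop)
      h0T
  obtain ⟨g₁, -, hg₁⟩ := hK (U 0) (Ux 0) (Uxx 0) (dU 0) (dUx 0) (by fun_prop) bc0
  have hg₁' : ∀ x ∈ Ioo 0 L, g₁ x = Ux 0 x := fun x hx =>
    ((hg₁ x (Ioo_subset_Icc_self hx)).1.congr_of_eventuallyEq (by
      filter_upwards [Icc_mem_nhds hx.1 hx.2] with y hy using (transmute_eq y hy).symm)).unique (dU 0 x)
  have volterra : ∀ x ∈ Ioo 0 L, (P x - Q x) * U 0 x =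
      ∫ y in (0:ℝ)..x, K x y * (Uxx 0 y - P y * U 0 y) := by
    intro x hx
    have hx' := Ioo_subset_Icc_self hx
    have := ((hg₁ x hx').2.congr_of_eventuallyEq (by
      filter_upwards [Ioo_mem_nhds hx.1 hx.2] with y hy using (hg₁' y hy).symm)).unique (dUx 0 x)
    rw [transmute_eq x hx'] at this
    linear_combination -this
  have := eq_zero_of_mul_eq_volterra (R := fun x => P x - Q x)
    (F := fun y => Uxx 0 y - P y * U 0 y) hL (by fun_prop) (by fun_prop) cK hC
    (fun x y h1 h2 h3 => by
      simp only [norm_sub_rev (P _)]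
      exact hKC x y h1 h2 h3) (dU 0) (fun x hx => by
      have hx := Ico_subset_Icc_self hx
      rw [(eU 0 h0T x hx).1, (eU 0 h0T x hx).2.1]
      exact hord x hx) volterra
  exact fun x hx => sub_eq_zero.1 (this x hx)

end NormalForm

section LiouvilleTransform

/-- Change of the space variable with prescribed derivative `1 / w`. -/
theorem exists_change_of_variable {ℓ : ℝ} (hℓ : 0 < ℓ) {w : ℝ → ℝ} (hw : ContinuousOn w (Icc 0 ℓ))
    (hpos : ∀ x ∈ Icc 0 ℓ, 0 < w x) :
    ∃ L > 0, ∃ X : ℝ → ℝ, X 0 = 0 ∧ MapsTo X (Icc 0 L) (Icc 0 ℓ) ∧ MapsTo X (Ioo 0 L) (Ioo 0 ℓ) ∧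
      SurjOn X (Icc 0 L) (Icc 0 ℓ) ∧ ∀ z ∈ Icc 0 L, HasDerivAt X (w (X z))⁻¹ z := by
  set W : ℝ → ℝ := IccExtend hℓ.le ((Icc 0 ℓ).domRestrict w) with hW
  have cW : Continuous W := (continuousOn_iff_continuous_domRestrict.1 hw).Icc_extend'
  have eW : ∀ x ∈ Icc 0 ℓ, W x = w x := fun x hx => IccExtend_of_mem _ _ hx
  obtain ⟨x₀, hx₀, hmin⟩ := isCompact_Icc.exists_isMinOn (nonempty_Icc.2 hℓ.le) hw
  have hm : 0 < w x₀ := hpos x₀ hx₀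
  have hWm : ∀ x, w x₀ ≤ W x := fun x => hmin (projIcc 0 ℓ hℓ.le x).2
  set Z : ℝ → ℝ := fun x => ∫ s in (0:ℝ)..x, W s with hZ
  have dZ : ∀ x, HasDerivAt Z (W x) x := fun x =>
    (Continuous.integral_hasStrictDerivAt cW 0 x).hasDerivAt
  have cZ : Continuous Z := continuous_iff_continuousAt.2 fun x => (dZ x).continuousAt
  have mono : StrictMono Z := strictMono_of_hasDerivAt_pos dZ fun x => hm.trans_le (hWm x)
  have mono' : Monotone fun x => Z x - w x₀ * x :=
    monotone_of_hasDerivAt_nonneg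
      (fun x => (dZ x).sub (((hasDerivAt_id x).const_mul (w x₀)).congr_deriv (mul_one _)))
      fun x => sub_nonneg.2 (hWm x)
  have Z0 : Z 0 = 0 := by simp [hZ]
  have surj : Surjective Z := cZ.surjective
    (tendsto_atTop_mono' _ (f₁ := fun x => w x₀ * x) (by
      filter_upwards [eventually_ge_atTop 0] with x hx
      have := mono' hx
      simp only [Z0] at this
      linarith) (tendsto_id.const_mul_atTop hm))
    (tendsto_atBot_mono' _ (f₁ := fun x => w x₀ * x) (by
      filter_upwards [eventually_le_atBot 0] with x hx
      have := mono' hx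
      simp only [Z0] at this
      linarith) (tendsto_id.const_mul_atBot hm))
  set e := mono.orderIsoOfSurjective Z surj with he
  have hes : ∀ x, e.symm (Z x) = x := fun x => e.symm_apply_apply x
  have hZe : ∀ z, Z (e.symm z) = z := fun z => e.apply_symm_apply z
  have s0 : e.symm 0 = 0 := by rw [← Z0, hes]; exact Z0.symm
  have sℓ : e.symm (Z ℓ) = ℓ := hes ℓ
  have maps : MapsTo e.symm (Icc 0 (Z ℓ)) (Icc 0 ℓ) := fun z hz =>
    ⟨by rw [← s0]; exact e.symm.monotone hz.1, by rw [← sℓ]; exact e.symm.monotone hz.2⟩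
  refine ⟨Z ℓ, by rw [← Z0]; exact mono hℓ, e.symm, s0, maps, fun z hz =>
    ⟨by rw [← s0]; exact e.symm.strictMono hz.1, by rw [← sℓ]; exact e.symm.strictMono hz.2⟩,
    fun x hx => ⟨Z x, ⟨?_, mono.monotone hx.2⟩, hes x⟩, fun z hz => ?_⟩
  · rw [← Z0]
    exact mono.monotone hx.1
  · rw [← eW _ (maps hz)]
    exact HasDerivAt.of_local_left_inverse e.symm.continuous.continuousAt (dZ _)
      (hm.trans_le (hWm _)).ne' (Eventually.of_forall hZe)

/-- The Liouville transform of a function of class `C^{1,2}`. -/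
theorem IsC12.liouville {T ℓ L : ℝ} {u ut ux uxx : ℝ → ℝ → ℂ} (hu : IsC12 T ℓ u ut ux uxx)
    {ν ν₁ ν₂ X : ℝ → ℝ} (hν : ∀ x ∈ Icc 0 ℓ, HasDerivWithinAt ν (ν₁ x) (Icc 0 ℓ) x)
    (hν₁ : ∀ x ∈ Icc 0 ℓ, HasDerivWithinAt ν₁ (ν₂ x) (Icc 0 ℓ) x)
    (hν₂ : ContinuousOn ν₂ (Icc 0 ℓ)) (hpos : ∀ x ∈ Icc 0 ℓ, 0 < ν x)
    (hX : MapsTo X (Icc 0 L) (Icc 0 ℓ)) (hX' : ∀ z ∈ Icc 0 L, HasDerivAt X (ν (X z) ^ 2)⁻¹ z) :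
    IsC12 T L (fun t z => ν (X z) * u t (X z)) (fun t z => ν (X z) * ut t (X z))
      (fun t z => (ν₁ (X z) * u t (X z) + ν (X z) * ux t (X z)) / ν (X z) ^ 2)
      (fun t z => (ν₂ (X z) / ν (X z) ^ 4 - 2 * ν₁ (X z) ^ 2 / ν (X z) ^ 5) * u t (X z) +
        uxx t (X z) / ν (X z) ^ 3) := by
  obtain ⟨hd, hcu, hct, hcx, hcxx⟩ := hu
  have hne : ∀ z ∈ Icc 0 L, (ν (X z) : ℂ) ≠ 0 := fun z hz =>
    Complex.ofReal_ne_zero.2 (hpos _ (hX hz)).ne'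
  have lift : ∀ {f : ℝ → ℂ} {f' : ℂ} {z : ℝ}, z ∈ Icc 0 L →
      HasDerivWithinAt f f' (Icc 0 ℓ) (X z) →
      HasDerivWithinAt (fun z => f (X z)) (f' / ν (X z) ^ 2) (Icc 0 L) z := by
    intro f f' z hz hf
    refine (hf.scomp z (hX' z hz).hasDerivWithinAt hX).congr_deriv ?_
    rw [Complex.real_smul]
    push_cast
    field_simp
  have cX : ContinuousOn X (Icc 0 L) := fun z hz => (hX' z hz).continuousAt.continuousWithinAt
  have cX2 : ContinuousOn (fun w : ℝ × ℝ => X w.2) (Icc 0 T ×ˢ Icc 0 L) :=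
    cX.comp continuousOn_snd fun w hw => hw.2
  have real : ∀ {f : ℝ → ℝ}, ContinuousOn f (Icc 0 ℓ) →
      ContinuousOn (fun w : ℝ × ℝ => (f (X w.2) : ℂ)) (Icc 0 T ×ˢ Icc 0 L) := fun {f} hf =>
    Complex.continuous_ofReal.comp_continuousOn (hf.comp cX2 fun w hw => hX hw.2)
  have plane : ∀ {f : ℝ → ℝ → ℂ}, ContinuousOn (fun z : ℝ × ℝ => f z.1 z.2) (Icc 0 T ×ˢ Icc 0 ℓ) →
      ContinuousOn (fun w : ℝ × ℝ => f w.1 (X w.2)) (Icc 0 T ×ˢ Icc 0 L) := fun {f} hf =>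
    hf.comp (f := fun w : ℝ × ℝ => (w.1, X w.2)) (continuousOn_fst.prodMk cX2)
      fun w hw => ⟨hw.1, hX hw.2⟩
  have c0 := real fun x hx => (hν x hx).continuousWithinAt
  have c1 := real fun x hx => (hν₁ x hx).continuousWithinAt
  have c2 := real hν₂
  have hne' : ∀ k : ℕ, ∀ w ∈ Icc 0 T ×ˢ Icc 0 L, (ν (X w.2) : ℂ) ^ k ≠ 0 := fun k w hw =>
    pow_ne_zero k (hne w.2 hw.2)
  refine ⟨fun t ht z hz => ⟨(hd t ht _ (hX hz)).1.const_mul _, ?_, ?_⟩, c0.mul (plane hcu),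
    c0.mul (plane hct), ((c1.mul (plane hcu)).add (c0.mul (plane hcx))).div (c0.pow 2) (hne' 2),
    (((c2.div (c0.pow 4) (hne' 4)).sub ((continuousOn_const.mul (c1.pow 2)).div (c0.pow 5)
      (hne' 5))).mul (plane hcu)).add ((plane hcxx).div (c0.pow 3) (hne' 3))⟩
  all_goals
    have h0 := lift hz (hν _ (hX hz)).ofReal_comp
    have h1 := lift hz (hν₁ _ (hX hz)).ofReal_comp
    have hu := lift hz (hd t ht _ (hX hz)).2.1
    have hux := lift hz (hd t ht _ (hX hz)).2.2
    have hn := hne z hz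
  · refine (h0.mul hu).congr_deriv ?_
    field_simp
  · refine (((h1.mul hu).add (h0.mul hux)).div (h0.pow 2) (pow_ne_zero 2 hn)).congr_deriv ?_
    simp only [Pi.add_apply, Pi.mul_apply, Pi.pow_apply]
    field_simp
    ring

end LiouvilleTransform

theorem stmt_0
    (T ℓ : ℝ) (hT : 0 < T) (hℓ : 0 < ℓ)
    (σ : ℂ) (hσ : σ ≠ 0)
    (p q a : ℝ → ℝ)
    (hp : ContDiffOn ℝ 1 p (Icc 0 ℓ)) (hq : ContDiffOn ℝ 1 q (Icc 0 ℓ))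
    (ha : ContDiffOn ℝ 2 a (Icc 0 ℓ)) (hapos : ∀ x ∈ Icc (0:ℝ) ℓ, 0 < a x)
    (b : ℝ → ℂ) (hb : ContDiffOn ℝ 3 b (Icc 0 ℓ))
    (hbfin : {x ∈ Icc (0:ℝ) ℓ | b x = 0}.Finite)
    (hbord : ∀ x ∈ Icc (0:ℝ) ℓ, b x = 0 → derivWithin b (Icc 0 ℓ) x ≠ 0)
    (u ut ux uxx v vt vx vxx : ℝ → ℝ → ℂ)
    (hu : IsC12 T ℓ u ut ux uxx) (hv : IsC12 T ℓ v vt vx vxx)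
    (hupde : ∀ t ∈ Ioo (0:ℝ) T, ∀ x ∈ Ioo (0:ℝ) ℓ,
      σ * ut t x = a x * uxx t x - p x * u t x)
    (hvpde : ∀ t ∈ Ioo (0:ℝ) T, ∀ x ∈ Ioo (0:ℝ) ℓ,
      σ * vt t x = a x * vxx t x - q x * v t x)
    (hinit : ∀ x ∈ Ioo (0:ℝ) ℓ, u 0 x = b x ∧ v 0 x = b x)
    (hdir : ∀ t ∈ Ioo (0:ℝ) T, u t 0 = v t 0)
    (hneu : ∀ t ∈ Ioo (0:ℝ) T, ux t 0 = 0 ∧ vx t 0 = 0)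
    : ∀ x ∈ Icc (0:ℝ) ℓ, p x = q x := by
  have uniq : UniqueDiffOn ℝ (Icc 0 ℓ) := uniqueDiffOn_Icc hℓ
  have h0T : (0 : ℝ) ∈ Icc 0 T := ⟨le_rfl, hT.le⟩
  have h0ℓ : (0 : ℝ) ∈ Icc 0 ℓ := ⟨le_rfl, hℓ.le⟩
  set ν : ℝ → ℝ := fun x => a x ^ (-(1 / 4) : ℝ) with hν_def
  have hνpos : ∀ x ∈ Icc 0 ℓ, 0 < ν x := fun x hx => Real.rpow_pos_of_pos (hapos x hx) _
  have hνa : ∀ x ∈ Icc 0 ℓ, a x * ν x ^ 4 = 1 := fun x hx => by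
    have h := hapos x hx
    have h4 : ν x ^ 4 = (a x)⁻¹ := by
      rw [hν_def, ← Real.rpow_natCast, ← Real.rpow_mul h.le, ← Real.rpow_neg_one]
      norm_num
    rw [h4, mul_inv_cancel₀ h.ne']
  have hνC : ContDiffOn ℝ 2 ν (Icc 0 ℓ) := ha.rpow_const_of_ne fun x hx => (hapos x hx).ne'
  have hνC' : ContDiffOn ℝ 1 (derivWithin ν (Icc 0 ℓ)) (Icc 0 ℓ) :=
    hνC.derivWithin uniq (by norm_num)
  set ν₁ := derivWithin ν (Icc 0 ℓ)
  set ν₂ := derivWithin ν₁ (Icc 0 ℓ)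
  have dν : ∀ x ∈ Icc 0 ℓ, HasDerivWithinAt ν (ν₁ x) (Icc 0 ℓ) x := fun x hx =>
    (hνC.differentiableOn (by norm_num) x hx).hasDerivWithinAt
  have dν₁ : ∀ x ∈ Icc 0 ℓ, HasDerivWithinAt ν₁ (ν₂ x) (Icc 0 ℓ) x := fun x hx =>
    (hνC'.differentiableOn (by norm_num) x hx).hasDerivWithinAt
  have cν₂ : ContinuousOn ν₂ (Icc 0 ℓ) := hνC'.continuousOn_derivWithin uniq le_rfl
  obtain ⟨L, hL, X, X0, hX, hXo, hXs, dX⟩ := exists_change_of_variable hℓ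
    (hνC.continuousOn.pow 2) fun x hx => pow_pos (hνpos x hx) 2
  have hne : ∀ z ∈ Icc 0 L, (ν (X z) : ℂ) ≠ 0 := fun z hz =>
    Complex.ofReal_ne_zero.2 (hνpos _ (hX hz)).ne'
  have potential : ∀ r : ℝ → ℝ, ContinuousOn r (Icc 0 ℓ) → ∃ R : ℝ → ℂ, Continuous R ∧
      ∀ z ∈ Icc 0 L, R z = r (X z) + ν₂ (X z) / ν (X z) ^ 5 - 2 * ν₁ (X z) ^ 2 / ν (X z) ^ 6 := by
    intro r hr
    have c : ContinuousOn (fun x => r x + ν₂ x / ν x ^ 5 - 2 * ν₁ x ^ 2 / ν x ^ 6) (Icc 0 ℓ) :=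
      (hr.add (cν₂.div (hνC.continuousOn.pow 5) fun x hx => pow_ne_zero 5 (hνpos x hx).ne')).sub
        ((continuousOn_const.mul (hνC'.continuousOn.pow 2)).div (hνC.continuousOn.pow 6)
          fun x hx => pow_ne_zero 6 (hνpos x hx).ne')
    have c' := Complex.continuous_ofReal.comp_continuousOn
      (c.comp (fun z hz => (dX z hz).continuousAt.continuousWithinAt) hX)
    refine ⟨_, (continuousOn_iff_continuous_domRestrict.1 c').Icc_extend' (h := hL.le), fun z hz => ?_⟩
    rw [IccExtend_of_mem _ _ hz]
    simp
  have transformed : ∀ {w wt wx wxx : ℝ → ℝ → ℂ} {r : ℝ → ℝ} {R : ℝ → ℂ},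
      (∀ t ∈ Ioo 0 T, ∀ x ∈ Ioo 0 ℓ, σ * wt t x = a x * wxx t x - r x * w t x) →
      (∀ z ∈ Icc 0 L,
        R z = r (X z) + ν₂ (X z) / ν (X z) ^ 5 - 2 * ν₁ (X z) ^ 2 / ν (X z) ^ 6) →
      ∀ t ∈ Ioo 0 T, ∀ z ∈ Ioo 0 L, σ * (ν (X z) * wt t (X z)) =
        ((ν₂ (X z) / ν (X z) ^ 4 - 2 * ν₁ (X z) ^ 2 / ν (X z) ^ 5) * w t (X z) +
          wxx t (X z) / ν (X z) ^ 3) - R z * (ν (X z) * w t (X z)) := by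
    intro w wt wx wxx r R hpde hR t ht z hz
    have hz' := Ioo_subset_Icc_self hz
    have hn := hne z hz'
    have ha' : (a (X z) : ℂ) = 1 / ν (X z) ^ 4 := by
      rw [eq_div_iff (pow_ne_zero 4 hn)]
      exact_mod_cast hνa _ (hX hz')
    rw [mul_left_comm, hpde t ht _ (hXo hz), hR z hz', ha']
    field_simp
    ring
  have b_eq : ∀ {w wt wx wxx : ℝ → ℝ → ℂ}, IsC12 T ℓ w wt wx wxx →
      (∀ x ∈ Ioo 0 ℓ, w 0 x = b x) → ∀ x ∈ Icc 0 ℓ, w 0 x = b x := fun {w wt wx wxx} hw h =>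
    eqOn_Icc_of_eqOn_Ioo hℓ h (fun x hx => (hw.1 0 h0T x hx).2.1.continuousWithinAt)
      hb.continuousOn
  have ub := b_eq hu fun x hx => (hinit x hx).1
  have vb := b_eq hv fun x hx => (hinit x hx).2
  have robin : ∀ w : ℂ, (ν₁ (X 0) * w + ν (X 0) * 0) / (ν (X 0) : ℂ) ^ 2 =
      ν₁ 0 / (ν 0 : ℂ) ^ 3 * (ν (X 0) * w) := fun w => by
    have := hne 0 ⟨le_rfl, hL.le⟩
    rw [X0] at this ⊢
    field_simp
    ring
  obtain ⟨P, cP, hP⟩ := potential p hp.continuousOn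
  obtain ⟨Q, cQ, hQ⟩ := potential q hq.continuousOn
  have key := potential_eq_of_normal_form hT hL (h := ν₁ 0 / (ν 0 : ℂ) ^ 3) cP cQ
    (hu.liouville dν dν₁ cν₂ hνpos hX dX) (hv.liouville dν dν₁ cν₂ hνpos hX dX)
    (transformed (wx := ux) hupde hP) (transformed (wx := vx) hvpde hQ)
    (fun z hz => by rw [ub _ (hX hz), vb _ (hX hz)])
    (fun t ht => by rw [X0, hdir t ht])
    (fun t ht => by rw [← robin, X0, (hneu t ht).1])
    (fun t ht => by rw [← robin, X0, (hneu t ht).2])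
    (fun z hz h => by
      have hn := hne z hz
      have hu0 : u 0 (X z) = 0 := (mul_eq_zero.1 h).resolve_left hn
      have hux : ux 0 (X z) ≠ 0 := by
        have hd := (hu.1 0 h0T _ (hX hz)).2.1.congr (f₁ := b) (fun x hx => (ub x hx).symm)
          (ub _ (hX hz)).symm
        rw [← hd.derivWithin (uniq _ (hX hz))]
        exact hbord _ (hX hz) (by rw [← ub _ (hX hz), hu0])
      rw [hu0, mul_zero, zero_add]
      exact div_ne_zero (mul_ne_zero hn hux) (pow_ne_zero 2 hn))
  intro x hx
  obtain ⟨z, hz, rfl⟩ := hXs hx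
  have h1 := key z hz
  rw [hP z hz, hQ z hz] at h1
  have h2 : (p (X z) : ℂ) = q (X z) := by linear_combination h1
  exact_mod_cast h2
end
end

section
/- Let σ ∈ ℂ\{0}, let p, q ∈ C¹([0,ℓ];ℝ), a ∈ C²([0,ℓ];ℝ) with a(x) > 0 on [0,ℓ], and let b ∈ C³([0,ℓ];ℂ) be such that its set of zeros in [0,ℓ] is finite and every zero is of order at most one (i.e. b(x)=0 implies b'(x)≠0). Suppose u, ũ ∈ C^{1,2}([0,T]×[0,ℓ];ℂ) satisfy σ∂_t u = a(x)∂_x²u − p(x)u and σ∂_t ũ = a(x)∂_x²ũ − q(x)ũ for 0<t<T, 0<x<ℓ, together with u(0,·) = ũ(0,·) = b on (0,ℓ), u(t,0) = ũ(t,0) and ∂_x u(t,0) = ∂_x ũ(t,0) for 0<t<T. If moreover there exists ε ∈ (0,ℓ) such that p = q on [0,ε], then p = q on [0,ℓ]. -/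
open Set MeasureTheory intervalIntegral

noncomputable section

open Filter Topology

/-! ### Uniqueness in the lateral Cauchy problem -/

lemma integral_sub_mul_pow_div_factorial (α x : ℝ) (m : ℕ) :
    ∫ y in α..x, (x - y) * ((y - α) ^ m / m.factorial) =
      (x - α) ^ (m + 2) / (m + 2).factorial := by
  have hd : ∀ y ∈ uIcc α x, HasDerivAt
      (fun y => (x - y) * ((y - α) ^ (m + 1) / (m + 1).factorial) +
        (y - α) ^ (m + 2) / (m + 2).factorial)
      ((x - y) * ((y - α) ^ m / m.factorial)) y := by
    intro y _
    have h1 := ((hasDerivAt_id y).sub_const α).pow (m + 1)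
    have h2 := ((hasDerivAt_id y).sub_const α).pow (m + 2)
    have h3 := (hasDerivAt_id y).const_sub x
    refine ((h3.mul (h1.div_const ((m + 1).factorial : ℝ))).add
      (h2.div_const ((m + 2).factorial : ℝ))).congr_deriv ?_
    have e1 : ((m + 1).factorial : ℝ) = (m + 1) * m.factorial := by
      rw [Nat.factorial_succ]; push_cast; ring
    have e2 : ((m + 2).factorial : ℝ) = (m + 2) * ((m + 1) * m.factorial) := by
      rw [Nat.factorial_succ, Nat.factorial_succ]; push_cast; ring
    have e3 : (m.factorial : ℝ) ≠ 0 := by positivity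
    have e4 : (m : ℝ) + 1 ≠ 0 := by positivity
    have e5 : (m : ℝ) + 2 ≠ 0 := by positivity
    rw [e2, e1]
    simp only [id, Nat.add_sub_cancel, show m + 2 - 1 = m + 1 from rfl, Pi.pow_apply]
    push_cast
    field_simp
    ring
  rw [integral_eq_sub_of_hasDerivAt hd (Continuous.intervalIntegrable (by fun_prop) _ _)]
  simp

/-- Taylor's formula with integral remainder, for vanishing Cauchy data. -/
lemma eq_integral_of_hasDerivAt_two {α x : ℝ} (hx : α ≤ x) {w w' w'' : ℝ → ℂ}
    (hw : ContinuousOn w (Icc α x)) (hw' : ContinuousOn w' (Icc α x))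
    (hw'' : ContinuousOn w'' (Icc α x))
    (h1 : ∀ y ∈ Ioo α x, HasDerivAt w (w' y) y) (h2 : ∀ y ∈ Ioo α x, HasDerivAt w' (w'' y) y)
    (h0 : w α = 0) (h0' : w' α = 0) :
    w x = ∫ y in α..x, ((x - y : ℝ) : ℂ) * w'' y := by
  have := integral_eq_sub_of_hasDerivAt_of_le (f := fun y => ((x - y : ℝ) : ℂ) * w' y + w y)
    (f' := fun y => ((x - y : ℝ) : ℂ) * w'' y) hx
    (((Complex.continuous_ofReal.comp (by fun_prop)).continuousOn.mul hw').add hw)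
    (fun y hy => by
      have h3 : HasDerivAt (fun y => ((x - y : ℝ) : ℂ)) (((-1 : ℝ)) : ℂ) y :=
        HasDerivAt.ofReal_comp ((hasDerivAt_id y).const_sub x)
      refine ((h3.mul (h2 y hy)).add (h1 y hy)).congr_deriv ?_
      push_cast; ring)
    (ContinuousOn.intervalIntegrable (by
      rw [uIcc_of_le hx]
      exact (Complex.continuous_ofReal.comp (by fun_prop)).continuousOn.mul hw''))
  rw [this]
  simp [h0, h0']

lemma norm_le_of_volterra {α β C B : ℝ} (hC : 0 ≤ C) {c₀ c₁ : ℝ → ℂ}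
    (h₀ : ∀ y ∈ Icc α β, ‖c₀ y‖ ≤ C) (h₁ : ∀ y ∈ Icc α β, ‖c₁ y‖ ≤ C) {V : ℕ → ℝ → ℂ} {N : ℕ}
    (hV : ∀ n < N, ∀ x ∈ Icc α β,
      V n x = ∫ y in α..x, ((x - y : ℝ) : ℂ) * (c₀ y * V n y - c₁ y * V (n + 1) y))
    (hVB : ∀ n ≤ N, ∀ x ∈ Icc α β, ‖V n x‖ ≤ B) (k : ℕ) :
    ∀ n, n + k ≤ N → ∀ x ∈ Icc α β,
      ‖V n x‖ ≤ (2 * C) ^ k * B * ((x - α) ^ (2 * k) / (2 * k).factorial) := by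
  induction k with
  | zero => intro n hn x hx; simpa using hVB n hn x hx
  | succ k ih =>
    intro n hn x hx
    rw [hV n (by omega) x hx]
    have key : ∀ y ∈ Icc α x, ‖((x - y : ℝ) : ℂ) * (c₀ y * V n y - c₁ y * V (n + 1) y)‖ ≤
        (2 * C) ^ (k + 1) * B * ((x - y) * ((y - α) ^ (2 * k) / (2 * k).factorial)) := by
      intro y hy
      have hy' : y ∈ Icc α β := ⟨hy.1, hy.2.trans hx.2⟩
      have b1 := ih n (by omega) y hy'
      have b2 := ih (n + 1) (by omega) y hy'
      set S := (2 * C) ^ k * B * ((y - α) ^ (2 * k) / (2 * k).factorial)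
      have hxy : 0 ≤ x - y := sub_nonneg.2 hy.2
      have hS : 0 ≤ S := (norm_nonneg _).trans b1
      calc _ = (x - y) * ‖c₀ y * V n y - c₁ y * V (n + 1) y‖ := by
            rw [norm_mul, Complex.norm_real, Real.norm_of_nonneg hxy]
        _ ≤ (x - y) * (C * S + C * S) := by
            gcongr
            refine (norm_sub_le _ _).trans ?_
            rw [norm_mul, norm_mul]
            exact add_le_add (mul_le_mul (h₀ y hy') b1 (norm_nonneg _) hC)
              (mul_le_mul (h₁ y hy') b2 (norm_nonneg _) hC)
        _ = _ := by simp only [S]; ring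
    refine (norm_integral_le_of_norm_le hx.1 (g := fun y => (2 * C) ^ (k + 1) * B *
      ((x - y) * ((y - α) ^ (2 * k) / (2 * k).factorial))) ?_
      (Continuous.intervalIntegrable (by fun_prop) _ _)).trans ?_
    · exact Eventually.of_forall fun y hy => key y ⟨hy.1.le, hy.2⟩
    · rw [intervalIntegral.integral_const_mul, integral_sub_mul_pow_div_factorial]
      exact le_rfl

/-- The `n`-th derivative of the peak polynomial `(1 - τ²) ^ N`. -/
def peak (N n : ℕ) (τ : ℝ) : ℂ :=
  (Polynomial.derivative^[n] ((1 - Polynomial.X ^ 2 : Polynomial ℂ) ^ N)).eval (τ : ℂ)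

lemma peak_zero (N : ℕ) (τ : ℝ) : peak N 0 τ = ((((1 - τ ^ 2) ^ N : ℝ)) : ℂ) := by
  simp [peak]

lemma hasDerivAt_peak (N n : ℕ) (τ : ℝ) : HasDerivAt (peak N n) (peak N (n + 1) τ) τ := by
  unfold peak
  rw [Function.iterate_succ_apply']
  exact (Polynomial.hasDerivAt _ _).comp_ofReal

lemma continuous_peak (N n : ℕ) : Continuous (peak N n) :=
  continuous_iff_continuousAt.2 fun τ => (hasDerivAt_peak N n τ).continuousAt

lemma peak_eq_zero {N n : ℕ} (hn : n < N) {τ : ℝ} (hτ : τ ^ 2 = 1) : peak N n τ = 0 := by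
  obtain ⟨r, hr⟩ := Polynomial.pow_sub_dvd_iterate_derivative_pow
    (1 - Polynomial.X ^ 2 : Polynomial ℂ) N n
  rw [peak, hr, Polynomial.eval_mul, Polynomial.eval_pow]
  have : ((τ : ℂ)) ^ 2 = 1 := by exact_mod_cast hτ
  simp [this, Nat.sub_ne_zero_of_lt hn]

lemma norm_peak_le (N n : ℕ) {τ : ℝ} (hτ : |τ| ≤ 1) : ‖peak N n τ‖ ≤ n.factorial * 5 ^ N := by
  have hd : ∀ P : Polynomial ℂ, iteratedDeriv n (fun z => P.eval z) =
      fun z => (Polynomial.derivative^[n] P).eval z := by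
    induction n with
    | zero => intro P; simp
    | succ n ih =>
      intro P
      rw [iteratedDeriv_succ, ih]
      funext z
      rw [Polynomial.deriv, Function.iterate_succ_apply']
  have := Complex.norm_iteratedDeriv_le_of_forall_mem_sphere_norm_le (c := (τ : ℂ)) (R := 1)
    (C := 5 ^ N) (f := fun z => ((1 - Polynomial.X ^ 2 : Polynomial ℂ) ^ N).eval z) n one_pos
    (Polynomial.differentiable _).diffContOnCl ?_
  · rw [hd] at this
    simpa [peak] using this
  · intro z hz
    rw [mem_sphere_iff_norm] at hz
    have hz2 : ‖z‖ ≤ 2 := by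
      calc ‖z‖ = ‖(z - τ) + τ‖ := by ring_nf
        _ ≤ 1 + 1 := (norm_add_le _ _).trans (add_le_add hz.le (by simpa using hτ))
        _ = 2 := by norm_num
    simp only [Polynomial.eval_pow, Polynomial.eval_sub, Polynomial.eval_one, Polynomial.eval_X,
      norm_pow]
    gcongr
    calc ‖1 - z ^ 2‖ ≤ ‖(1 : ℂ)‖ + ‖z ^ 2‖ := norm_sub_le _ _
      _ ≤ 1 + 2 ^ 2 := by rw [norm_pow, norm_one]; gcongr
      _ = 5 := by norm_num

lemma inv_integral_one_sub_sq_pow_le (n : ℕ) :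
    (∫ τ in Icc (-1 : ℝ) 1, (1 - τ ^ 2) ^ n)⁻¹ ≤ (n : ℝ) + 1 := by
  have h1 : ∫ τ in (0 : ℝ)..1, (1 - τ) ^ n = 1 / (n + 1) := by
    rw [integral_comp_sub_left (fun τ : ℝ => τ ^ n) 1]
    simp
  have h2 : ∫ τ in (0 : ℝ)..1, (1 - τ) ^ n ≤ ∫ τ in (0 : ℝ)..1, (1 - τ ^ 2) ^ n := by
    refine integral_mono_on zero_le_one (Continuous.intervalIntegrable (by fun_prop) _ _)
      (Continuous.intervalIntegrable (by fun_prop) _ _) fun τ hτ => ?_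
    have : 0 ≤ 1 - τ := sub_nonneg.2 hτ.2
    gcongr
    nlinarith [hτ.1, hτ.2]
  have h3 : ∫ τ in (0 : ℝ)..1, (1 - τ ^ 2) ^ n ≤ ∫ τ in (-1 : ℝ)..1, (1 - τ ^ 2) ^ n := by
    refine integral_mono_interval (by norm_num) zero_le_one le_rfl ?_
      (Continuous.intervalIntegrable (by fun_prop) _ _)
    refine (ae_restrict_iff' measurableSet_Ioc).2 (Eventually.of_forall fun τ hτ => ?_)
    have : 0 ≤ 1 - τ ^ 2 := by nlinarith [hτ.1, hτ.2]
    simp only [Pi.zero_apply]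
    positivity
  rw [integral_Icc_eq_integral_Ioc, ← integral_of_le (by norm_num : (-1 : ℝ) ≤ 1)]
  have h4 : (1 : ℝ) / (n + 1) ≤ ∫ τ in (-1 : ℝ)..1, (1 - τ ^ 2) ^ n := h1 ▸ h2.trans h3
  rw [one_div] at h4
  exact inv_le_of_inv_le₀ (by positivity) h4

lemma tendsto_succ_mul_pow_mul_factorial_div (K A : ℝ) :
    Tendsto (fun n : ℕ => ((n : ℝ) + 1) * (K * (A ^ n * n.factorial / (2 * n).factorial)))
      atTop (𝓝 0) := by
  have h := (FloorSemiring.tendsto_pow_div_factorial_atTop (2 * |A|)).const_mul |K|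
  rw [mul_zero] at h
  refine squeeze_zero_norm (fun n => ?_) h
  have e1 : ((n : ℝ) + 1) ≤ 2 ^ n := by exact_mod_cast Nat.lt_two_pow_self
  have e2 : (n.factorial : ℝ) * n.factorial ≤ (2 * n).factorial := by
    rw [two_mul]
    exact_mod_cast Nat.le_of_dvd (Nat.factorial_pos _) (Nat.factorial_mul_factorial_dvd_factorial_add n n)
  have e3 : (n.factorial : ℝ) / (2 * n).factorial ≤ 1 / n.factorial := by
    rw [div_le_div_iff₀ (by positivity) (by positivity)]
    linarith
  calc _ = ((n : ℝ) + 1) * (|K| * (|A| ^ n * (n.factorial / (2 * n).factorial))) := by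
        rw [Real.norm_eq_abs, abs_mul, abs_mul, abs_div, abs_mul, abs_pow,
          abs_of_nonneg (by positivity : (0 : ℝ) ≤ n + 1), Nat.abs_cast, Nat.abs_cast, mul_div_assoc]
    _ ≤ 2 ^ n * (|K| * (|A| ^ n * (1 / n.factorial))) := by gcongr
    _ = _ := by rw [mul_pow]; ring

lemma eq_zero_of_volterra_deriv {α β : ℝ} {v vt : ℝ → ℝ → ℂ} {c₀ c₁ : ℝ → ℂ}
    (hv : Continuous fun z : ℝ × ℝ => v z.1 z.2) (hvt : Continuous fun z : ℝ × ℝ => vt z.1 z.2)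
    (hc₀ : Continuous c₀) (hc₁ : Continuous c₁)
    (ht : ∀ τ ∈ Icc (-1 : ℝ) 1, ∀ x ∈ Icc α β, HasDerivAt (fun s => v s x) (vt τ x) τ)
    (hvol : ∀ τ ∈ Icc (-1 : ℝ) 1, ∀ x ∈ Icc α β,
      v τ x = ∫ y in α..x, ((x - y : ℝ) : ℂ) * (c₀ y * v τ y + c₁ y * vt τ y))
    {x : ℝ} (hx : x ∈ Icc α β) : v 0 x = 0 := by
  obtain ⟨C₀, hC₀⟩ := isCompact_Icc.exists_bound_of_continuousOn (s := Icc α β) hc₀.continuousOn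
  obtain ⟨C₁, hC₁⟩ := isCompact_Icc.exists_bound_of_continuousOn (s := Icc α β) hc₁.continuousOn
  obtain ⟨K, hK⟩ := (isCompact_Icc.prod isCompact_Icc).exists_bound_of_continuousOn
    (s := Icc (-1 : ℝ) 1 ×ˢ Icc α β) hv.continuousOn
  set C := max C₀ C₁ with hC
  have hC_nonneg : 0 ≤ C := (norm_nonneg _).trans ((hC₀ x hx).trans (le_max_left _ _))
  have hm : (-1 : ℝ) ≤ 1 := by norm_num
  have cv : ∀ y, Continuous fun τ => v τ y := fun y => by fun_prop
  have cvt : ∀ y, Continuous fun τ => vt τ y := fun y => by fun_prop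
  have bound : ∀ N : ℕ, ‖∫ τ in (-1 : ℝ)..1, peak N 0 τ * v τ x‖ ≤
      (2 * K) * ((10 * C * (x - α) ^ 2) ^ N * N.factorial / (2 * N).factorial) := by
    intro N
    have cp := continuous_peak N
    have parts : ∀ n < N, ∀ y ∈ Icc α β, ∫ τ in (-1 : ℝ)..1, peak N n τ * vt τ y =
        - ∫ τ in (-1 : ℝ)..1, peak N (n + 1) τ * v τ y := by
      intro n hn y hy
      rw [integral_mul_deriv_eq_deriv_mul_of_hasDerivAt (u := peak N n) (v := fun τ => v τ y)
        (u' := peak N (n + 1)) (cp n).continuousOn (cv y).continuousOn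
        (fun τ _ => hasDerivAt_peak N n τ)
        (fun τ hτ => ht τ (by simp at hτ; exact ⟨hτ.1.le, hτ.2.le⟩) y hy)
        ((cp _).intervalIntegrable _ _) ((cvt y).intervalIntegrable _ _),
        peak_eq_zero hn (by norm_num), peak_eq_zero hn (by norm_num)]
      simp
    have main := norm_le_of_volterra (α := α) (β := β) (C := C) (B := N.factorial * 5 ^ N * K * 2)
      (c₀ := c₀) (c₁ := c₁) hC_nonneg
      (fun y hy => (hC₀ y hy).trans (le_max_left _ _))
      (fun y hy => (hC₁ y hy).trans (le_max_right _ _))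
      (V := fun n y => ∫ τ in (-1 : ℝ)..1, peak N n τ * v τ y) (N := N) ?_ ?_ N 0 (by simp) x hx
    · refine main.trans (le_of_eq ?_)
      rw [pow_mul, show 10 * C * (x - α) ^ 2 = 5 * (2 * C) * (x - α) ^ 2 by ring,
        mul_pow (5 * (2 * C)), mul_pow 5 (2 * C)]
      ring
    · intro n hn z hz
      have e1 : ∫ τ in (-1 : ℝ)..1, peak N n τ * v τ z = ∫ τ in (-1 : ℝ)..1, ∫ y in α..z,
          peak N n τ * (((z - y : ℝ) : ℂ) * (c₀ y * v τ y + c₁ y * vt τ y)) := by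
        refine integral_congr fun τ hτ => ?_
        rw [uIcc_of_le hm] at hτ
        rw [hvol τ hτ z hz, intervalIntegral.integral_const_mul]
      have cF : Continuous (Function.uncurry fun τ y =>
          peak N n τ * (((z - y : ℝ) : ℂ) * (c₀ y * v τ y + c₁ y * vt τ y))) := by
        have := cp n
        unfold Function.uncurry
        fun_prop
      rw [e1, intervalIntegral_intervalIntegral_swap
        ((cF.continuousOn.integrableOn_compact (isCompact_uIcc.prod isCompact_uIcc)).mono_set
          (prod_mono uIoc_subset_uIcc uIoc_subset_uIcc))]
      refine integral_congr fun y hy => ?_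
      rw [uIcc_of_le hz.1] at hy
      have e3 := neg_eq_iff_eq_neg.2 (parts n hn y ⟨hy.1, hy.2.trans hz.2⟩)
      rw [← e3, mul_neg, sub_neg_eq_add,
        ← intervalIntegral.integral_const_mul, ← intervalIntegral.integral_const_mul,
        ← intervalIntegral.integral_add, ← intervalIntegral.integral_const_mul]
      · refine integral_congr fun τ _ => ?_
        ring
      · exact Continuous.intervalIntegrable (((cp n).mul (cv y)).const_mul _) _ _
      · exact Continuous.intervalIntegrable (((cp n).mul (cvt y)).const_mul _) _ _
    · intro n hn y hy
      have := norm_integral_le_of_norm_le_const (a := -1) (b := 1)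
        (f := fun τ => peak N n τ * v τ y) (C := N.factorial * 5 ^ N * K) ?_
      · convert this using 2; norm_num
      · intro τ hτ
        rw [uIoc_of_le hm] at hτ
        rw [norm_mul]
        refine mul_le_mul ((norm_peak_le N n (abs_le.2 ⟨hτ.1.le, hτ.2⟩)).trans ?_)
          (hK (τ, y) ⟨⟨hτ.1.le, hτ.2⟩, hy⟩) (norm_nonneg _) (by positivity)
        gcongr
  have lim := tendsto_setIntegral_pow_smul_of_unique_maximum_of_isCompact_of_continuousOn
    (μ := volume) (x₀ := (0 : ℝ)) (g := fun τ => v τ x) (isCompact_Icc (a := (-1 : ℝ)) (b := 1))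
    (c := fun τ => 1 - τ ^ 2) (by fun_prop)
    (fun y _ hy0 => by have := sq_pos_of_ne_zero hy0; nlinarith)
    (fun y hy => by nlinarith [hy.1, hy.2]) (by norm_num)
    (by rw [interior_Icc]; exact subset_closure (by simp)) (cv x).continuousOn
  refine tendsto_nhds_unique lim (squeeze_zero_norm (fun N => ?_)
    (tendsto_succ_mul_pow_mul_factorial_div (2 * K) (10 * C * (x - α) ^ 2)))
  rw [norm_smul, norm_inv]
  have e2 : ∫ τ in Icc (-1 : ℝ) 1, (1 - τ ^ 2) ^ N • v τ x =
      ∫ τ in (-1 : ℝ)..1, peak N 0 τ * v τ x := by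
    rw [integral_Icc_eq_integral_Ioc, ← integral_of_le hm]
    simp_rw [peak_zero, Complex.real_smul]
  rw [e2]
  refine mul_le_mul ?_ (bound N) (norm_nonneg _) (by positivity)
  rw [Real.norm_of_nonneg]
  · exact inv_integral_one_sub_sq_pow_le N
  · refine setIntegral_nonneg measurableSet_Icc fun τ hτ => ?_
    have : 0 ≤ 1 - τ ^ 2 := by nlinarith [hτ.1, hτ.2]
    positivity

/-- Uniqueness for the lateral Cauchy problem `∂ₓ²v = c₀ v + c₁ ∂ₜv`, without initial data. -/
theorem lateral_uniqueness {T α β : ℝ} {v vx vt : ℝ → ℝ → ℂ} {c₀ c₁ : ℝ → ℂ}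
    (hv : Continuous fun z : ℝ × ℝ => v z.1 z.2) (hvx : Continuous fun z : ℝ × ℝ => vx z.1 z.2)
    (hvt : Continuous fun z : ℝ × ℝ => vt z.1 z.2)
    (hc₀ : Continuous c₀) (hc₁ : Continuous c₁)
    (ht : ∀ t ∈ Ioo 0 T, ∀ x ∈ Icc α β, HasDerivAt (fun s => v s x) (vt t x) t)
    (h1 : ∀ t ∈ Ioo 0 T, ∀ x ∈ Ioo α β, HasDerivAt (v t) (vx t x) x)
    (h2 : ∀ t ∈ Ioo 0 T, ∀ x ∈ Ioo α β, HasDerivAt (vx t) (c₀ x * v t x + c₁ x * vt t x) x)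
    (h0 : ∀ t ∈ Ioo 0 T, v t α = 0) (h0' : ∀ t ∈ Ioo 0 T, vx t α = 0)
    {t x : ℝ} (htT : t ∈ Ioo 0 T) (hx : x ∈ Icc α β) : v t x = 0 := by
  obtain ⟨r, hr, hrT⟩ : ∃ r > 0, ∀ τ ∈ Icc (-1 : ℝ) 1, t + r * τ ∈ Ioo 0 T := by
    refine ⟨min t (T - t) / 2, by have := htT.1; have := sub_pos.2 htT.2; positivity, ?_⟩
    intro τ hτ
    have m1 := min_le_left t (T - t)
    have m2 := min_le_right t (T - t)
    have m3 : 0 < min t (T - t) := lt_min htT.1 (sub_pos.2 htT.2)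
    constructor <;> nlinarith [hτ.1, hτ.2]
  have key := eq_zero_of_volterra_deriv (α := α) (β := β) (v := fun τ x => v (t + r * τ) x)
    (vt := fun τ x => r * vt (t + r * τ) x) (c₀ := c₀) (c₁ := fun y => c₁ y / r)
    (by fun_prop) (by fun_prop) hc₀ (by fun_prop) ?_ ?_ hx
  · simpa using key
  · intro τ hτ y hy
    have ha : HasDerivAt (fun s : ℝ => t + r * s) r τ := by
      simpa using ((hasDerivAt_id τ).const_mul r).const_add t
    have := (ht _ (hrT τ hτ) y hy).scomp τ ha
    rwa [Complex.real_smul] at this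
  · intro τ hτ y hy
    have hs : Ioo α y ⊆ Ioo α β := Ioo_subset_Ioo_right hy.2
    rw [eq_integral_of_hasDerivAt_two hy.1 (w := v (t + r * τ)) (w' := vx (t + r * τ))
      (w'' := fun x => c₀ x * v (t + r * τ) x + c₁ x * vt (t + r * τ) x)
      (Continuous.continuousOn (by fun_prop)) (Continuous.continuousOn (by fun_prop))
      (Continuous.continuousOn (by fun_prop)) (fun z hz => h1 _ (hrT τ hτ) z (hs hz))
      (fun z hz => h2 _ (hrT τ hτ) z (hs hz)) (h0 _ (hrT τ hτ)) (h0' _ (hrT τ hτ))]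
    refine integral_congr fun z _ => ?_
    have : (r : ℂ) ≠ 0 := by exact_mod_cast hr.ne'
    field_simp

/-! ### Kernels on a triangle -/

lemma integral_integral_triangle_swap {F : ℝ → ℝ → ℂ}
    (hF : Continuous fun z : ℝ × ℝ => F z.1 z.2) {X : ℝ} (hX : 0 ≤ X) :
    ∫ η in (0 : ℝ)..X, ∫ x in η..X, F x η = ∫ x in (0 : ℝ)..X, ∫ η in (0 : ℝ)..x, F x η := by
  have hm : MeasurableSet {z : ℝ × ℝ | z.2 ≤ z.1} :=
    (isClosed_le continuous_snd continuous_fst).measurableSet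
  have hint : IntegrableOn (Function.uncurry fun x η => ({z : ℝ × ℝ | z.2 ≤ z.1}).indicator
      (fun z => F z.1 z.2) (x, η)) (uIoc 0 X ×ˢ uIoc 0 X) (volume.prod volume) :=
    ((hF.continuousOn.integrableOn_compact (isCompact_uIcc.prod isCompact_uIcc)).mono_set
      (prod_mono uIoc_subset_uIcc uIoc_subset_uIcc)).indicator hm
  have hswap := intervalIntegral_intervalIntegral_swap hint
  have e1 : ∀ x ∈ uIcc 0 X, ∫ η in (0 : ℝ)..X, ({z : ℝ × ℝ | z.2 ≤ z.1}).indicator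
      (fun z => F z.1 z.2) (x, η) = ∫ η in (0 : ℝ)..x, F x η := by
    intro x hx
    rw [uIcc_of_le hX] at hx
    rw [← intervalIntegral.integral_indicator hx]
    rfl
  have e2 : ∀ η ∈ uIcc 0 X, ∫ x in (0 : ℝ)..X, ({z : ℝ × ℝ | z.2 ≤ z.1}).indicator
      (fun z => F z.1 z.2) (x, η) = ∫ x in η..X, F x η := by
    intro η hη
    rw [uIcc_of_le hX] at hη
    rw [intervalIntegral.integral_of_le hX, intervalIntegral.integral_of_le hη.2,
      ← integral_Icc_eq_integral_Ioc, ← integral_Icc_eq_integral_Ioc,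
      show (fun x => ({z : ℝ × ℝ | z.2 ≤ z.1}).indicator (fun z => F z.1 z.2) (x, η)) =
        (Ici η).indicator (fun x => F x η) from rfl, setIntegral_indicator measurableSet_Ici]
    congr 2
    ext x
    exact ⟨fun h => ⟨h.2, h.1.2⟩, fun h => ⟨⟨hη.1.trans h.1, h.2⟩, h.1⟩⟩
  rw [← integral_congr e1, ← integral_congr e2, hswap]

/-- The fundamental theorem of calculus for `X ↦ ∫ k (X - η) η dη`, derivative in the first
variable. -/
lemma integral_triangle_fst {k k' : ℝ → ℝ → ℂ} (hk : Continuous fun z : ℝ × ℝ => k z.1 z.2)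
    (hk' : Continuous fun z : ℝ × ℝ => k' z.1 z.2) {X : ℝ} (hX : 0 ≤ X)
    (hd : ∀ η ∈ Icc 0 X, ∀ ξ ∈ Ioo 0 (X - η), HasDerivAt (fun s => k s η) (k' ξ η) ξ) :
    ∫ η in (0 : ℝ)..X, k (X - η) η = (∫ η in (0 : ℝ)..X, k 0 η) +
      ∫ x in (0 : ℝ)..X, ∫ η in (0 : ℝ)..x, k' (x - η) η := by
  rw [← integral_integral_triangle_swap (F := fun x η => k' (x - η) η)
    (hk'.comp (by fun_prop : Continuous fun z : ℝ × ℝ => (z.1 - z.2, z.2))) hX,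
    ← intervalIntegral.integral_add]
  · refine integral_congr fun η hη => ?_
    rw [uIcc_of_le hX] at hη
    have := integral_eq_sub_of_hasDerivAt_of_le (f := fun s => k s η) (f' := fun s => k' s η)
      (sub_nonneg.2 hη.2) (by fun_prop) (hd η hη) (Continuous.intervalIntegrable (by fun_prop) _ _)
    simp only [intervalIntegral.integral_comp_sub_right (fun s => k' s η) η, sub_self]
    rw [this]
    ring
  · exact Continuous.intervalIntegrable (by fun_prop) _ _
  · refine Continuous.intervalIntegrable ?_ _ _
    simp_rw [fun η => intervalIntegral.integral_comp_sub_right (a := η) (b := X)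
      (fun s => k' s η) η, sub_self]
    exact intervalIntegral.continuous_parametric_intervalIntegral_of_continuous
      (f := fun η s => k' s η)
      (hk'.comp (by fun_prop : Continuous fun z : ℝ × ℝ => (z.2, z.1))) (by fun_prop)

/-- The fundamental theorem of calculus for `X ↦ ∫ k (X - η) η dη`, derivative in the second
variable. -/
lemma integral_triangle_snd {k k' : ℝ → ℝ → ℂ} (hk : Continuous fun z : ℝ × ℝ => k z.1 z.2)
    (hk' : Continuous fun z : ℝ × ℝ => k' z.1 z.2) {X : ℝ} (hX : 0 ≤ X)
    (hd : ∀ ξ ∈ Icc 0 X, ∀ η ∈ Ioo 0 (X - ξ), HasDerivAt (fun s => k ξ s) (k' ξ η) η) :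
    ∫ η in (0 : ℝ)..X, k (X - η) η = (∫ ξ in (0 : ℝ)..X, k ξ 0) +
      ∫ x in (0 : ℝ)..X, ∫ η in (0 : ℝ)..x, k' (x - η) η := by
  have flip : ∀ (j : ℝ → ℝ → ℂ) (x : ℝ),
      ∫ η in (0 : ℝ)..x, j (x - η) η = ∫ η in (0 : ℝ)..x, j η (x - η) := by
    intro j x
    have := intervalIntegral.integral_comp_sub_left (a := 0) (b := x) (fun η => j η (x - η)) x
    simpa using this
  have := integral_triangle_fst (k := fun a b => k b a) (k' := fun a b => k' b a)
    (hk.comp (by fun_prop : Continuous fun z : ℝ × ℝ => (z.2, z.1)))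
    (hk'.comp (by fun_prop : Continuous fun z : ℝ × ℝ => (z.2, z.1))) hX hd
  rw [flip k, this]
  simp_rw [flip k']

lemma norm_integral_integral_le {F : ℝ → ℝ → ℂ} {B R ξ η : ℝ} (hξ : ξ ∈ Icc 0 R)
    (hη : η ∈ Icc 0 R) (hB : 0 ≤ B) (hF : ∀ s ∈ Icc 0 ξ, ∀ r ∈ Icc 0 η, ‖F s r‖ ≤ B) :
    ‖∫ s in (0 : ℝ)..ξ, ∫ r in (0 : ℝ)..η, F s r‖ ≤ B * R ^ 2 := by
  have h1 : ∀ s ∈ uIoc 0 ξ, ‖∫ r in (0 : ℝ)..η, F s r‖ ≤ B * R := by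
    intro s hs
    rw [uIoc_of_le hξ.1] at hs
    refine (intervalIntegral.norm_integral_le_of_norm_le_const (C := B) fun r hr => ?_).trans ?_
    · rw [uIoc_of_le hη.1] at hr
      exact hF s ⟨hs.1.le, hs.2⟩ r ⟨hr.1.le, hr.2⟩
    · rw [sub_zero, abs_of_nonneg hη.1]
      exact mul_le_mul_of_nonneg_left hη.2 hB
  refine (intervalIntegral.norm_integral_le_of_norm_le_const h1).trans ?_
  rw [sub_zero, abs_of_nonneg hξ.1, pow_two, ← mul_assoc]
  exact mul_le_mul_of_nonneg_left hξ.2 (mul_nonneg hB (hη.1.trans hη.2))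

lemma continuous_integral_integral {F : ℝ → ℝ → ℂ} (hF : Continuous fun z : ℝ × ℝ => F z.1 z.2) :
    Continuous fun z : ℝ × ℝ => ∫ s in (0 : ℝ)..z.1, ∫ r in (0 : ℝ)..z.2, F s r :=
  intervalIntegral.continuous_parametric_intervalIntegral_of_continuous
    (f := fun (z : ℝ × ℝ) s => ∫ r in (0 : ℝ)..z.2, F s r)
    (intervalIntegral.continuous_parametric_intervalIntegral_of_continuous
      (f := fun (w : (ℝ × ℝ) × ℝ) r => F w.2 r)
      (hF.comp (by fun_prop : Continuous fun y : ((ℝ × ℝ) × ℝ) × ℝ => (y.1.2, y.2)))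
      (by fun_prop)) (by fun_prop)

/-- Solvability of a small Goursat problem in integrated form. -/
lemma exists_goursat {R C : ℝ} (hR : 0 ≤ R) {g : ℝ → ℂ} (hg : Continuous g) {c : ℝ → ℝ → ℂ}
    (hc : Continuous fun z : ℝ × ℝ => c z.1 z.2)
    (hC : ∀ ξ ∈ Icc 0 R, ∀ η ∈ Icc 0 R, ‖c ξ η‖ ≤ C) (hCR : C * R ^ 2 ≤ 1 / 2) :
    ∃ H : ℝ → ℝ → ℂ, (Continuous fun z : ℝ × ℝ => H z.1 z.2) ∧
      ∀ ξ ∈ Icc 0 R, ∀ η ∈ Icc 0 R,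
        H ξ η = g ξ + ∫ s in (0 : ℝ)..ξ, ∫ r in (0 : ℝ)..η, c s r * H s r := by
  have hC0 : 0 ≤ C := (norm_nonneg _).trans (hC 0 ⟨le_rfl, hR⟩ 0 ⟨le_rfl, hR⟩)
  let κ : ℝ → ℝ := fun r => max 0 (min r R)
  have hκ : Continuous κ := by fun_prop
  have hκm : ∀ r, κ r ∈ Icc 0 R := fun r => ⟨le_max_left _ _, max_le hR (min_le_right _ _)⟩
  have hκe : ∀ r ∈ Icc 0 R, κ r = r := fun r hr => by
    simp only [κ, min_eq_left hr.2, max_eq_right hr.1]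
  let Ψ : (BoundedContinuousFunction (ℝ × ℝ) ℂ) → ℝ × ℝ → ℂ := fun H z =>
    g z.1 + ∫ s in (0 : ℝ)..z.1, ∫ r in (0 : ℝ)..z.2, c s r * H (s, r)
  have hΨ : ∀ H, Continuous (Ψ H) := fun H =>
    (hg.comp continuous_fst).add (continuous_integral_integral
      (F := fun s r => c s r * H (s, r)) (hc.mul H.continuous))
  have hbd : ∀ H, ∃ B, ∀ z : ℝ × ℝ, ‖Ψ H (κ z.1, κ z.2)‖ ≤ B := fun H => by
    obtain ⟨B, hB⟩ := ((isCompact_Icc (a := (0 : ℝ)) (b := R)).prod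
      (isCompact_Icc (a := (0 : ℝ)) (b := R))).exists_bound_of_continuousOn (hΨ H).continuousOn
    exact ⟨B, fun z => hB _ ⟨hκm _, hκm _⟩⟩
  choose B hB using hbd
  let Φ : BoundedContinuousFunction (ℝ × ℝ) ℂ → BoundedContinuousFunction (ℝ × ℝ) ℂ := fun H =>
    BoundedContinuousFunction.ofNormedAddCommGroup (fun z => Ψ H (κ z.1, κ z.2))
      ((hΨ H).comp (by fun_prop)) (B H) (hB H)
  have hΦ : ContractingWith (1 / 2) Φ := by
    refine ⟨by norm_num, LipschitzWith.of_dist_le_mul fun H H' => ?_⟩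
    refine (BoundedContinuousFunction.dist_le (by positivity)).2 fun z => ?_
    have hi : ∀ (H : BoundedContinuousFunction (ℝ × ℝ) ℂ) (η : ℝ), Continuous fun s =>
        ∫ r in (0 : ℝ)..η, c s r * H (s, r) := fun H η => by
      exact intervalIntegral.continuous_parametric_intervalIntegral_of_continuous
        (f := fun s r => c s r * H (s, r)) (hc.mul H.continuous) (by fun_prop)
    have hj : ∀ (H : BoundedContinuousFunction (ℝ × ℝ) ℂ) (s : ℝ), Continuous fun r =>
        c s r * H (s, r) := fun H s => by
      exact (hc.comp (by fun_prop : Continuous fun r : ℝ => (s, r))).mul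
        (H.continuous.comp (by fun_prop))
    have e : Ψ H (κ z.1, κ z.2) - Ψ H' (κ z.1, κ z.2) =
        ∫ s in (0 : ℝ)..κ z.1, ∫ r in (0 : ℝ)..κ z.2, c s r * (H (s, r) - H' (s, r)) := by
      simp only [Ψ, add_sub_add_left_eq_sub]
      rw [← intervalIntegral.integral_sub ((hi H _).intervalIntegrable _ _)
        ((hi H' _).intervalIntegrable _ _)]
      refine integral_congr fun s _ => ?_
      rw [← intervalIntegral.integral_sub ((hj H _).intervalIntegrable _ _)
        ((hj H' _).intervalIntegrable _ _)]
      simp only [mul_sub]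
    change dist (Ψ H (κ z.1, κ z.2)) (Ψ H' (κ z.1, κ z.2)) ≤ _
    rw [dist_eq_norm, e]
    refine (norm_integral_integral_le (B := C * dist H H') (hκm _) (hκm _) (by positivity)
      fun s hs r hr => ?_).trans ?_
    · rw [norm_mul, ← dist_eq_norm]
      exact mul_le_mul (hC s ⟨hs.1, hs.2.trans (hκm _).2⟩ r ⟨hr.1, hr.2.trans (hκm _).2⟩)
        (BoundedContinuousFunction.dist_coe_le_dist _) dist_nonneg hC0
    · calc C * dist H H' * R ^ 2 = C * R ^ 2 * dist H H' := by ring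
        _ ≤ 1 / 2 * dist H H' := by gcongr
        _ = _ := by norm_num
  refine ⟨fun ξ η => hΦ.fixedPoint Φ (ξ, η), (hΦ.fixedPoint Φ).continuous, fun ξ hξ η hη => ?_⟩
  have := congrArg (fun H : BoundedContinuousFunction (ℝ × ℝ) ℂ => H (ξ, η))
    hΦ.fixedPoint_isFixedPt.symm
  refine this.trans ?_
  change Ψ _ (κ ξ, κ η) = _
  rw [hκe ξ hξ, hκe η hη]

lemma norm_le_of_goursat {R C ξ₀ K : ℝ} (hR : 0 ≤ R) {g : ℝ → ℂ} {c H : ℝ → ℝ → ℂ}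
    (hH : Continuous fun z : ℝ × ℝ => H z.1 z.2)
    (hC : ∀ ξ ∈ Icc 0 R, ∀ η ∈ Icc 0 R, ‖c ξ η‖ ≤ C) (hCR : C * R ^ 2 ≤ 1 / 2)
    (h : ∀ ξ ∈ Icc 0 R, ∀ η ∈ Icc 0 R,
        H ξ η = g ξ + ∫ s in (0 : ℝ)..ξ, ∫ r in (0 : ℝ)..η, c s r * H s r)
    (hξ₀ : ξ₀ ∈ Icc 0 R) (hg : ∀ ξ ∈ Icc 0 ξ₀, ‖g ξ‖ ≤ K) :
    ∀ ξ ∈ Icc 0 ξ₀, ∀ η ∈ Icc 0 R, ‖H ξ η‖ ≤ 2 * K := by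
  have hC0 : 0 ≤ C := (norm_nonneg _).trans (hC 0 ⟨le_rfl, hR⟩ 0 ⟨le_rfl, hR⟩)
  obtain ⟨z, hz, hmax⟩ := ((isCompact_Icc (a := (0 : ℝ)) (b := ξ₀)).prod
      (isCompact_Icc (a := (0 : ℝ)) (b := R))).exists_isMaxOn
      ⟨(0, 0), ⟨le_rfl, hξ₀.1⟩, ⟨le_rfl, hR⟩⟩ hH.norm.continuousOn
  have hm : ∀ ξ ∈ Icc 0 ξ₀, ∀ η ∈ Icc 0 R, ‖H ξ η‖ ≤ ‖H z.1 z.2‖ :=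
    fun ξ hξ η hη => hmax (show (ξ, η) ∈ _ from ⟨hξ, hη⟩)
  have hz1 : z.1 ∈ Icc 0 R := ⟨hz.1.1, hz.1.2.trans hξ₀.2⟩
  have key : ‖H z.1 z.2‖ ≤ K + C * ‖H z.1 z.2‖ * R ^ 2 := by
    conv_lhs => rw [h z.1 hz1 z.2 hz.2]
    refine (norm_add_le _ _).trans (add_le_add (hg _ hz.1) ?_)
    refine norm_integral_integral_le hz1 hz.2 (by positivity) fun s hs r hr => ?_
    rw [norm_mul]
    exact mul_le_mul (hC s ⟨hs.1, hs.2.trans hz1.2⟩ r ⟨hr.1, hr.2.trans hz.2.2⟩)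
      (hm s ⟨hs.1, hs.2.trans hz.1.2⟩ r ⟨hr.1, hr.2.trans hz.2.2⟩) (norm_nonneg _) hC0
  have h2 : C * ‖H z.1 z.2‖ * R ^ 2 ≤ 1 / 2 * ‖H z.1 z.2‖ := by
    calc _ = C * R ^ 2 * ‖H z.1 z.2‖ := by ring
      _ ≤ _ := by gcongr
  intro ξ hξ η hη
  exact (hm ξ hξ η hη).trans (by linarith)

/-- The integral transform of `φ` with kernel `G` written in characteristic coordinates. -/
def kernelTransform (G : ℝ → ℝ → ℂ) (φ : ℝ → ℂ) (x : ℝ) : ℂ :=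
  ∫ η in (0 : ℝ)..x, G (x - η) η * φ (x - η - η)

lemma continuous_kernelTransform {G U : ℝ → ℝ → ℂ} (hG : Continuous fun z : ℝ × ℝ => G z.1 z.2)
    (hU : Continuous fun z : ℝ × ℝ => U z.1 z.2) :
    Continuous fun z : ℝ × ℝ => kernelTransform G (U z.1) z.2 :=
  intervalIntegral.continuous_parametric_intervalIntegral_of_continuous
    (f := fun (z : ℝ × ℝ) η => G (z.2 - η) η * U z.1 (z.2 - η - η))
    ((hG.comp (by fun_prop : Continuous fun w : (ℝ × ℝ) × ℝ => (w.1.2 - w.2, w.2))).mul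
      (hU.comp (by fun_prop : Continuous fun w : (ℝ × ℝ) × ℝ => (w.1.1, w.1.2 - w.2 - w.2))))
    (by fun_prop)

lemma continuous_kernelTransform_right {G : ℝ → ℝ → ℂ} {φ : ℝ → ℂ}
    (hG : Continuous fun z : ℝ × ℝ => G z.1 z.2) (hφ : Continuous φ) :
    Continuous (kernelTransform G φ) :=
  (continuous_kernelTransform hG (U := fun _ => φ) (by fun_prop)).comp
    (by fun_prop : Continuous fun x : ℝ => ((0 : ℝ), x))

lemma continuous_kernelTransform_integrand {G : ℝ → ℝ → ℂ} {φ : ℝ → ℂ}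
    (hG : Continuous fun z : ℝ × ℝ => G z.1 z.2) (hφ : Continuous φ) (x : ℝ) :
    Continuous fun η => G (x - η) η * φ (x - η - η) :=
  (hG.comp (by fun_prop : Continuous fun η : ℝ => (x - η, η))).mul (by fun_prop)

lemma norm_kernelTransform_le {G : ℝ → ℝ → ℂ} {φ : ℝ → ℂ} {x A B : ℝ} (hx : 0 ≤ x) (hA : 0 ≤ A)
    (hG : ∀ ξ ∈ Icc 0 x, ∀ η ∈ Icc 0 x, ‖G ξ η‖ ≤ A) (hφ : ∀ s ∈ Icc (-x) x, ‖φ s‖ ≤ B) :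
    ‖kernelTransform G φ x‖ ≤ A * B * x := by
  refine (intervalIntegral.norm_integral_le_of_norm_le_const (C := A * B) fun η hη => ?_).trans ?_
  · rw [uIoc_of_le hx] at hη
    rw [norm_mul]
    exact mul_le_mul (hG _ ⟨by linarith [hη.2], by linarith [hη.1]⟩ _ ⟨hη.1.le, hη.2⟩)
      (hφ _ ⟨by linarith [hη.2], by linarith [hη.1]⟩) (norm_nonneg _) hA
  · rw [sub_zero, abs_of_nonneg hx]

lemma kernelTransform_eq_integral {G G₁ : ℝ → ℝ → ℂ} {φ φ₁ : ℝ → ℂ} {X : ℝ}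
    (hG : Continuous fun z : ℝ × ℝ => G z.1 z.2) (hG₁ : Continuous fun z : ℝ × ℝ => G₁ z.1 z.2)
    (hφ : Continuous φ) (hφ₁ : Continuous φ₁)
    (hGd : ∀ ξ η, HasDerivAt (fun s => G s η) (G₁ ξ η) ξ) (hG0 : ∀ η, G 0 η = 0)
    (hφd : ∀ s ∈ Ioo (-X) X, HasDerivAt φ (φ₁ s) s) (hX : 0 ≤ X) :
    kernelTransform G φ X =
      ∫ x in (0 : ℝ)..X, (kernelTransform G₁ φ x + kernelTransform G φ₁ x) := by
  have := integral_triangle_fst (k := fun ξ η => G ξ η * φ (ξ - η))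
    (k' := fun ξ η => G₁ ξ η * φ (ξ - η) + G ξ η * φ₁ (ξ - η)) (by fun_prop) (by fun_prop) hX
    (fun η hη ξ hξ => (hGd ξ η).mul ((hφd (ξ - η) ⟨by linarith [hη.2, hξ.1, hξ.2, hη.1],
      by linarith [hη.1, hξ.2]⟩).comp_sub_const ξ η))
  simp only [hG0, zero_mul, intervalIntegral.integral_zero, zero_add] at this
  refine this.trans (integral_congr fun x _ => ?_)
  exact intervalIntegral.integral_add
    ((continuous_kernelTransform_integrand hG₁ hφ x).intervalIntegrable _ _)
    ((continuous_kernelTransform_integrand hG hφ₁ x).intervalIntegrable _ _)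

lemma kernelTransform_add_eq_integral {G G₁ E : ℝ → ℝ → ℂ} {γ φ φ₁ φ₂ : ℝ → ℂ} {X : ℝ}
    (hG : Continuous fun z : ℝ × ℝ => G z.1 z.2) (hG₁ : Continuous fun z : ℝ × ℝ => G₁ z.1 z.2)
    (hE : Continuous fun z : ℝ × ℝ => E z.1 z.2) (hγ : Continuous γ)
    (hφ : Continuous φ) (hφ₁ : Continuous φ₁) (hφ₂ : Continuous φ₂)
    (hGd : ∀ ξ η, HasDerivAt (fun s => G s η) (G₁ ξ η) ξ) (hG0 : ∀ η, G 0 η = 0)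
    (hG₁d : ∀ ξ η, HasDerivAt (fun s => G₁ ξ s) (E ξ η) η) (hG₁0 : ∀ ξ, G₁ ξ 0 = γ ξ)
    (hφd : ∀ s ∈ Ioo (-X) X, HasDerivAt φ (φ₁ s) s)
    (hφ₁d : ∀ s ∈ Ioo (-X) X, HasDerivAt φ₁ (φ₂ s) s) (hX : 0 ≤ X) :
    kernelTransform G₁ φ X + kernelTransform G φ₁ X =
      ∫ x in (0 : ℝ)..X, (γ x * φ x + (kernelTransform E φ x + kernelTransform G φ₂ x)) := by
  have h1 := integral_triangle_fst (k := fun ξ η => G ξ η * φ₁ (ξ - η))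
    (k' := fun ξ η => G₁ ξ η * φ₁ (ξ - η) + G ξ η * φ₂ (ξ - η)) (by fun_prop) (by fun_prop) hX
    (fun η hη ξ hξ => (hGd ξ η).mul ((hφ₁d (ξ - η) ⟨by linarith [hη.2, hξ.1, hξ.2, hη.1],
      by linarith [hη.1, hξ.2]⟩).comp_sub_const ξ η))
  have h2 := integral_triangle_snd (k := fun ξ η => G₁ ξ η * φ (ξ - η))
    (k' := fun ξ η => E ξ η * φ (ξ - η) + G₁ ξ η * -φ₁ (ξ - η)) (by fun_prop) (by fun_prop) hX
    (fun ξ hξ η hη => (hG₁d ξ η).mul ((hφd (ξ - η) ⟨by linarith [hη.2, hξ.1, hξ.2, hη.1],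
      by linarith [hη.1, hξ.2]⟩).comp_const_sub ξ η))
  simp only [hG0, zero_mul, intervalIntegral.integral_zero, zero_add] at h1
  simp only [hG₁0, sub_zero] at h2
  have e1 : ∀ x, ∫ η in (0 : ℝ)..x, (G₁ (x - η) η * φ₁ (x - η - η) +
      G (x - η) η * φ₂ (x - η - η)) = kernelTransform G₁ φ₁ x + kernelTransform G φ₂ x := fun x =>
    intervalIntegral.integral_add
      ((continuous_kernelTransform_integrand hG₁ hφ₁ x).intervalIntegrable _ _)
      ((continuous_kernelTransform_integrand hG hφ₂ x).intervalIntegrable _ _)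
  have e2 : ∀ x, ∫ η in (0 : ℝ)..x, (E (x - η) η * φ (x - η - η) +
      G₁ (x - η) η * -φ₁ (x - η - η)) = kernelTransform E φ x - kernelTransform G₁ φ₁ x := by
    intro x
    simp only [mul_neg, ← sub_eq_add_neg]
    exact intervalIntegral.integral_sub
      ((continuous_kernelTransform_integrand hE hφ x).intervalIntegrable _ _)
      ((continuous_kernelTransform_integrand hG₁ hφ₁ x).intervalIntegrable _ _)
  simp only [e1] at h1
  simp only [e2] at h2
  have c1 := continuous_kernelTransform_right hG₁ hφ₁
  have c2 := continuous_kernelTransform_right hG hφ₂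
  have c3 := continuous_kernelTransform_right hE hφ
  refine (congrArg₂ (· + ·) h2 h1).trans ?_
  rw [← intervalIntegral.integral_add, ← intervalIntegral.integral_add]
  · refine integral_congr fun x _ => ?_
    ring
  all_goals exact Continuous.intervalIntegrable (by fun_prop) _ _

/-- The transmutation kernel relating the potentials `P` and `Q` near the origin. -/
lemma exists_kernel {R C : ℝ} (hR : 0 ≤ R) {P Q : ℝ → ℂ} (hP : Continuous P) (hQ : Continuous Q)
    (hC : ∀ ξ ∈ Icc 0 R, ∀ η ∈ Icc 0 R, ‖Q (ξ + η) - P (ξ - η)‖ ≤ C)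
    (hCR : C * R ^ 2 ≤ 1 / 2) :
    ∃ G G₁ E : ℝ → ℝ → ℂ, (Continuous fun z : ℝ × ℝ => G z.1 z.2) ∧
      (Continuous fun z : ℝ × ℝ => G₁ z.1 z.2) ∧ (Continuous fun z : ℝ × ℝ => E z.1 z.2) ∧
      (∀ ξ η, HasDerivAt (fun s => G s η) (G₁ ξ η) ξ) ∧ (∀ η, G 0 η = 0) ∧
      (∀ ξ η, HasDerivAt (fun s => G₁ ξ s) (E ξ η) η) ∧ (∀ ξ, G₁ ξ 0 = Q ξ - P ξ) ∧
      (∀ ξ ∈ Icc 0 R, ∀ η ∈ Icc 0 R, E ξ η = (Q (ξ + η) - P (ξ - η)) * G ξ η) ∧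
      ∀ x ∈ Icc 0 R, ∀ S, (∀ ξ ∈ Icc 0 x, ‖Q ξ - P ξ‖ ≤ S) →
        ∀ ξ ∈ Icc 0 x, ∀ η ∈ Icc 0 R, ‖G ξ η‖ ≤ 2 * (S * x) := by
  have hf : Continuous fun s => Q s - P s := hQ.sub hP
  have hgd : ∀ ξ, HasDerivAt (fun x => ∫ s in (0 : ℝ)..x, (Q s - P s)) (Q ξ - P ξ) ξ :=
    fun ξ => hf.integral_hasStrictDerivAt 0 ξ |>.hasDerivAt
  have hg : Continuous fun x => ∫ s in (0 : ℝ)..x, (Q s - P s) :=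
    continuous_iff_continuousAt.2 fun ξ => (hgd ξ).continuousAt
  have hc : Continuous fun z : ℝ × ℝ => Q (z.1 + z.2) - P (z.1 - z.2) := by fun_prop
  obtain ⟨H, hH, hHe⟩ := exists_goursat hR hg (c := fun ξ η => Q (ξ + η) - P (ξ - η)) hc hC hCR
  have hE : Continuous fun z : ℝ × ℝ => (Q (z.1 + z.2) - P (z.1 - z.2)) * H z.1 z.2 := hc.mul hH
  have hI : Continuous fun z : ℝ × ℝ =>
      ∫ r in (0 : ℝ)..z.2, (Q (z.1 + r) - P (z.1 - r)) * H z.1 r :=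
    intervalIntegral.continuous_parametric_intervalIntegral_of_continuous
      (f := fun (z : ℝ × ℝ) r => (Q (z.1 + r) - P (z.1 - r)) * H z.1 r)
      (by fun_prop) (by fun_prop)
  refine ⟨fun ξ η => (∫ s in (0 : ℝ)..ξ, (Q s - P s)) +
      ∫ s in (0 : ℝ)..ξ, ∫ r in (0 : ℝ)..η, (Q (s + r) - P (s - r)) * H s r,
    fun ξ η => (Q ξ - P ξ) + ∫ r in (0 : ℝ)..η, (Q (ξ + r) - P (ξ - r)) * H ξ r,
    fun ξ η => (Q (ξ + η) - P (ξ - η)) * H ξ η,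
    (hg.comp continuous_fst).add (continuous_integral_integral hE),
    (hf.comp continuous_fst).add hI, hE, fun ξ η => ?_, fun η => by simp, fun ξ η => ?_,
    fun ξ => by simp, fun ξ hξ η hη => congrArg _ (hHe ξ hξ η hη), fun x hx S hS ξ hξ η hη => ?_⟩
  · have : Continuous fun s => ∫ r in (0 : ℝ)..η, (Q (s + r) - P (s - r)) * H s r :=
      hI.comp (by fun_prop : Continuous fun s : ℝ => (s, η))
    exact (hgd ξ).add (this.integral_hasStrictDerivAt 0 ξ).hasDerivAt
  · have : Continuous fun r => (Q (ξ + r) - P (ξ - r)) * H ξ r :=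
      hE.comp (by fun_prop : Continuous fun s : ℝ => (ξ, s))
    exact (this.integral_hasStrictDerivAt 0 η).hasDerivAt.const_add _
  · beta_reduce
    rw [← hHe ξ ⟨hξ.1, hξ.2.trans hx.2⟩ η hη]
    refine norm_le_of_goursat hR hH hC hCR hHe hx (fun ζ hζ => ?_) ξ hξ η hη
    have hS0 : 0 ≤ S := (norm_nonneg _).trans (hS 0 ⟨le_rfl, hx.1⟩)
    refine (intervalIntegral.norm_integral_le_of_norm_le_const (C := S) fun s hs => ?_).trans ?_
    · rw [uIoc_of_le hζ.1] at hs
      exact hS s ⟨hs.1.le, hs.2.trans hζ.2⟩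
    · rw [sub_zero, abs_of_nonneg hζ.1]
      exact mul_le_mul_of_nonneg_left hζ.2 hS0

lemma kernelTransform_potential {R : ℝ} {G E : ℝ → ℝ → ℂ} {P Q φ ψ : ℝ → ℂ} {σ : ℂ}
    (hG : Continuous fun z : ℝ × ℝ => G z.1 z.2) (hE : Continuous fun z : ℝ × ℝ => E z.1 z.2)
    (hP : Continuous P) (hφ : Continuous φ) (hψ : Continuous ψ)
    (hEG : ∀ ξ ∈ Icc 0 R, ∀ η ∈ Icc 0 R, E ξ η = (Q (ξ + η) - P (ξ - η)) * G ξ η)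
    {x : ℝ} (hx : x ∈ Icc 0 R) :
    kernelTransform E φ x + kernelTransform G (fun s => σ * ψ s + P s * φ s) x =
      Q x * kernelTransform G φ x + σ * kernelTransform G ψ x := by
  have c1 := continuous_kernelTransform_integrand hG hφ x
  have c2 := continuous_kernelTransform_integrand hG hψ x
  have c3 := continuous_kernelTransform_integrand hE hφ x
  have c4 := continuous_kernelTransform_integrand hG
    (by fun_prop : Continuous fun s => σ * ψ s + P s * φ s) x
  unfold kernelTransform
  rw [← intervalIntegral.integral_const_mul, ← intervalIntegral.integral_const_mul,
    ← intervalIntegral.integral_add (c3.intervalIntegrable _ _) (c4.intervalIntegrable _ _),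
    ← intervalIntegral.integral_add ((c1.const_mul _).intervalIntegrable _ _)
      ((c2.const_mul _).intervalIntegrable _ _)]
  refine integral_congr fun η hη => ?_
  rw [uIcc_of_le hx.1] at hη
  simp only [hEG (x - η) ⟨by linarith [hη.2], by linarith [hη.1, hx.2]⟩ η
    ⟨hη.1, hη.2.trans hx.2⟩, sub_add_cancel]
  ring

lemma hasDerivAt_kernelTransform {T x t : ℝ} {G U Ut : ℝ → ℝ → ℂ}
    (hG : Continuous fun z : ℝ × ℝ => G z.1 z.2) (hU : Continuous fun z : ℝ × ℝ => U z.1 z.2)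
    (hUt : Continuous fun z : ℝ × ℝ => Ut z.1 z.2) (hx : 0 ≤ x)
    (hd : ∀ t ∈ Ioo 0 T, ∀ s ∈ Icc (-x) x, HasDerivAt (fun τ => U τ s) (Ut t s) t)
    (ht : t ∈ Ioo 0 T) :
    HasDerivAt (fun τ => kernelTransform G (U τ) x) (kernelTransform G (Ut t) x) t := by
  have hF' : Continuous fun z : ℝ × ℝ => G (x - z.2) z.2 * Ut z.1 (x - z.2 - z.2) :=
    (hG.comp (by fun_prop : Continuous fun w : ℝ × ℝ => (x - w.2, w.2))).mul
      (hUt.comp (by fun_prop : Continuous fun w : ℝ × ℝ => (w.1, x - w.2 - w.2)))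
  obtain ⟨B, hB⟩ := ((isCompact_Icc (a := (0 : ℝ)) (b := T)).prod
    (isCompact_Icc (a := (0 : ℝ)) (b := x))).exists_bound_of_continuousOn hF'.continuousOn
  refine (intervalIntegral.hasDerivAt_integral_of_dominated_loc_of_deriv_le
    (F := fun τ η => G (x - η) η * U τ (x - η - η))
    (F' := fun τ η => G (x - η) η * Ut τ (x - η - η)) (bound := fun _ => B)
    (Ioo_mem_nhds ht.1 ht.2) (Eventually.of_forall fun τ => ?_) ?_ ?_ ?_ (by simp) ?_).2
  · exact (continuous_kernelTransform_integrand hG (by fun_prop) x).aestronglyMeasurable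
  · exact (continuous_kernelTransform_integrand hG (by fun_prop) x).intervalIntegrable _ _
  · exact (continuous_kernelTransform_integrand hG (by fun_prop) x).aestronglyMeasurable
  · refine Eventually.of_forall fun η hη τ hτ => ?_
    rw [uIoc_of_le hx] at hη
    exact hB (τ, η) ⟨⟨hτ.1.le, hτ.2.le⟩, hη.1.le, hη.2⟩
  · refine Eventually.of_forall fun η hη τ hτ => ?_
    rw [uIoc_of_le hx] at hη
    exact (hd τ hτ _ ⟨by linarith [hη.2], by linarith [hη.1]⟩).const_mul _

/-! ### Local identification of the potential -/

lemma exists_le_mul_norm {b : ℝ → ℂ} {b' : ℂ} (hb : HasDerivAt b b' 0) (h : b 0 = 0 → b' ≠ 0) :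
    ∃ C, 0 < C ∧ ∀ᶠ x in 𝓝[>] (0 : ℝ), x ≤ C * ‖b x‖ := by
  by_cases h0 : b 0 = 0
  · obtain ⟨C, hC, hbC⟩ := (HasDerivAtFilter.isTheta_sub hb (h h0)).isBigO_symm.exists_pos
    have hbound := hbC.bound
    rw [prod_pure, eventually_map] at hbound
    refine ⟨C, hC, Eventually.filter_mono nhdsWithin_le_nhds (hbound.mono fun x hx => ?_)⟩
    rw [h0, sub_zero, sub_zero] at hx
    exact (le_abs_self x).trans hx
  · refine ⟨1, one_pos, nhdsWithin_le_nhds ?_⟩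
    have hc : ContinuousAt (fun x => 1 * ‖b x‖) 0 := hb.continuousAt.norm.const_mul 1
    exact (continuousAt_id.eventually_lt hc (by simpa using h0)).mono fun x hx => hx.le

lemma eq_zero_of_norm_le_mul_sup {f : ℝ → ℂ} (hf : Continuous f) {D δ : ℝ} (hδ : 0 < δ)
    (hD0 : 0 ≤ D) (hD : D * δ ≤ 1 / 2)
    (h : ∀ x ∈ Ioc 0 δ, ∀ S, (∀ ξ ∈ Icc 0 x, ‖f ξ‖ ≤ S) → ‖f x‖ ≤ D * x * S) :
    ∀ x ∈ Icc 0 δ, f x = 0 := by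
  obtain ⟨z, hz, hmax⟩ := (isCompact_Icc (a := (0 : ℝ)) (b := δ)).exists_isMaxOn
    ⟨0, le_rfl, hδ.le⟩ hf.norm.continuousOn
  have hm : ∀ x ∈ Icc 0 δ, ‖f x‖ ≤ ‖f z‖ := fun x hx => hmax hx
  have hhalf : Ioc 0 δ ⊆ {x | ‖f x‖ ≤ 1 / 2 * ‖f z‖} := fun x hx => by
    refine (h x hx _ fun ξ hξ => hm ξ ⟨hξ.1, hξ.2.trans hx.2⟩).trans ?_
    gcongr
    exact (mul_le_mul_of_nonneg_left hx.2 hD0).trans hD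
  have hcl := (isClosed_le hf.norm continuous_const).closure_subset_iff.2 hhalf
  rw [closure_Ioc hδ.ne] at hcl
  have hz0 : ‖f z‖ ≤ 1 / 2 * ‖f z‖ := hcl hz
  intro x hx
  exact norm_le_zero_iff.1 ((hm x hx).trans (by linarith))

theorem local_uniqueness {T R : ℝ} (hT : 0 < T) (hR : 0 < R) {σ : ℂ} {P Q : ℝ → ℂ}
    {U U₁ Ut W W₁ Wt : ℝ → ℝ → ℂ} (hP : Continuous P) (hQ : Continuous Q)
    (hU : Continuous fun z : ℝ × ℝ => U z.1 z.2) (hU₁ : Continuous fun z : ℝ × ℝ => U₁ z.1 z.2)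
    (hUt : Continuous fun z : ℝ × ℝ => Ut z.1 z.2) (hW : Continuous fun z : ℝ × ℝ => W z.1 z.2)
    (hW₁ : Continuous fun z : ℝ × ℝ => W₁ z.1 z.2) (hWt : Continuous fun z : ℝ × ℝ => Wt z.1 z.2)
    (dUt : ∀ t ∈ Ioo 0 T, ∀ s ∈ Icc (-R) R, HasDerivAt (fun τ => U τ s) (Ut t s) t)
    (dU : ∀ t ∈ Ico 0 T, ∀ s ∈ Ioo (-R) R, HasDerivAt (U t) (U₁ t s) s)
    (dU₁ : ∀ t ∈ Ico 0 T, ∀ s ∈ Ioo (-R) R,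
      HasDerivAt (U₁ t) (σ * Ut t s + P s * U t s) s)
    (dWt : ∀ t ∈ Ioo 0 T, ∀ s ∈ Icc 0 R, HasDerivAt (fun τ => W τ s) (Wt t s) t)
    (dW : ∀ t ∈ Ioo 0 T, ∀ s ∈ Ioo 0 R, HasDerivAt (W t) (W₁ t s) s)
    (dW₁ : ∀ t ∈ Ioo 0 T, ∀ s ∈ Ioo 0 R,
      HasDerivAt (W₁ t) (σ * Wt t s + Q s * W t s + (P s - Q s) * U t s) s)
    (hW0 : ∀ t ∈ Ioo 0 T, W t 0 = 0) (hW₁0 : ∀ t ∈ Ioo 0 T, W₁ t 0 = 0)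
    (hWi : ∀ s ∈ Icc 0 R, W 0 s = 0) (hb : U 0 0 = 0 → U₁ 0 0 ≠ 0) :
    ∃ δ, 0 < δ ∧ δ ≤ R ∧ ∀ s ∈ Icc 0 δ, P s = Q s := by
  have hcc : Continuous fun z : ℝ × ℝ => Q (z.1 + z.2) - P (z.1 - z.2) := by fun_prop
  obtain ⟨C, hC⟩ := ((isCompact_Icc (a := (0 : ℝ)) (b := R)).prod
    (isCompact_Icc (a := (0 : ℝ)) (b := R))).exists_bound_of_continuousOn hcc.continuousOn
  obtain ⟨B, hB⟩ := (isCompact_Icc (a := -R) (b := R)).exists_bound_of_continuousOn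
    (f := Ut 0) (by fun_prop)
  have hB0 : 0 ≤ B := (norm_nonneg _).trans (hB 0 ⟨by linarith, hR.le⟩)
  obtain ⟨r, hr0, hrR, hCr⟩ : ∃ r, 0 < r ∧ r ≤ R ∧ C * r ^ 2 ≤ 1 / 2 := by
    have h1 : ∀ᶠ r in 𝓝[>] (0 : ℝ), C * r ^ 2 < 1 / 2 := nhdsWithin_le_nhds
      ((show ContinuousAt (fun r : ℝ => C * r ^ 2) 0 by fun_prop).eventually_lt_const (by simp))
    have h2 : ∀ᶠ r in 𝓝[>] (0 : ℝ), r ∈ Ioc 0 R := Ioc_mem_nhdsGT hR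
    obtain ⟨r, ⟨hr, hr'⟩, hr2⟩ := (h2.and h1).exists
    exact ⟨r, hr, hr', hr2.le⟩
  obtain ⟨G, G₁, E, hG, hG₁, hE, dG, hG0, dG₁, hG₁0, hEG, hGb⟩ := exists_kernel hr0.le hP hQ
    (fun ξ hξ η hη => hC (ξ, η) ⟨⟨hξ.1, hξ.2.trans hrR⟩, hη.1, hη.2.trans hrR⟩) hCr
  have hMN : ∀ t ∈ Ico 0 T, ∀ x ∈ Icc 0 r, kernelTransform G (U t) x =
      ∫ y in (0 : ℝ)..x, (kernelTransform G₁ (U t) y + kernelTransform G (U₁ t) y) :=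
    fun t ht x hx => kernelTransform_eq_integral hG hG₁ (by fun_prop) (by fun_prop) dG hG0
      (fun s hs => dU t ht s ⟨by linarith [hs.1, hx.2], by linarith [hs.2, hx.2]⟩) hx.1
  have hNh : ∀ t ∈ Ico 0 T, ∀ x ∈ Icc 0 r,
      kernelTransform G₁ (U t) x + kernelTransform G (U₁ t) x =
      ∫ y in (0 : ℝ)..x, ((Q y - P y) * U t y +
        (Q y * kernelTransform G (U t) y + σ * kernelTransform G (Ut t) y)) := by
    intro t ht x hx
    rw [kernelTransform_add_eq_integral hG hG₁ hE (hQ.sub hP) (by fun_prop) (by fun_prop)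
      (by fun_prop : Continuous fun s => σ * Ut t s + P s * U t s) dG hG0 dG₁ hG₁0
      (fun s hs => dU t ht s ⟨by linarith [hs.1, hx.2], by linarith [hs.2, hx.2]⟩)
      (fun s hs => dU₁ t ht s ⟨by linarith [hs.1, hx.2], by linarith [hs.2, hx.2]⟩) hx.1]
    refine integral_congr fun y hy => ?_
    rw [uIcc_of_le hx.1] at hy
    exact congrArg _ (kernelTransform_potential hG hE hP (by fun_prop) (by fun_prop) hEG
      ⟨hy.1, hy.2.trans hx.2⟩)
  have cM := continuous_kernelTransform hG hU
  have cMt := continuous_kernelTransform hG hUt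
  have cN := (continuous_kernelTransform hG₁ hU).add (continuous_kernelTransform hG hU₁)
  have ftc : ∀ {F k : ℝ → ℂ}, Continuous k → (∀ x ∈ Icc 0 r, F x = ∫ y in (0 : ℝ)..x, k y) →
      ∀ x ∈ Ioo 0 r, HasDerivAt F (k x) x := fun hk hF x hx =>
    (hk.integral_hasStrictDerivAt 0 x).hasDerivAt.congr_of_eventuallyEq
      (eventually_of_mem (Ioo_mem_nhds hx.1 hx.2) fun y hy => hF y ⟨hy.1.le, hy.2.le⟩)
  have cMx : ∀ t, Continuous fun x => kernelTransform G (U t) x := fun t =>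
    cM.comp (by fun_prop : Continuous fun x : ℝ => (t, x))
  have cMtx : ∀ t, Continuous fun x => kernelTransform G (Ut t) x := fun t =>
    cMt.comp (by fun_prop : Continuous fun x : ℝ => (t, x))
  have dM : ∀ t ∈ Ico 0 T, ∀ x ∈ Ioo 0 r, HasDerivAt (kernelTransform G (U t))
      (kernelTransform G₁ (U t) x + kernelTransform G (U₁ t) x) x := fun t ht =>
    ftc (cN.comp (by fun_prop : Continuous fun x : ℝ => (t, x))) (hMN t ht)
  have dN : ∀ t ∈ Ico 0 T, ∀ x ∈ Ioo 0 r,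
      HasDerivAt (fun x => kernelTransform G₁ (U t) x + kernelTransform G (U₁ t) x)
      ((Q x - P x) * U t x +
        (Q x * kernelTransform G (U t) x + σ * kernelTransform G (Ut t) x)) x := fun t ht =>
    ftc (k := fun x => (Q x - P x) * U t x +
        (Q x * kernelTransform G (U t) x + σ * kernelTransform G (Ut t) x))
      (((hQ.sub hP).mul (by fun_prop)).add ((hQ.mul (cMx t)).add ((cMtx t).const_mul σ)))
      (hNh t ht)
  have hzero : ∀ t ∈ Ioo 0 T, ∀ x ∈ Icc 0 r, W t x + kernelTransform G (U t) x = 0 := by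
    intro t ht x hx
    refine lateral_uniqueness (T := T) (α := 0) (β := r)
      (v := fun t x => W t x + kernelTransform G (U t) x)
      (vx := fun t x => W₁ t x + (kernelTransform G₁ (U t) x + kernelTransform G (U₁ t) x))
      (vt := fun t x => Wt t x + kernelTransform G (Ut t) x) (c₀ := Q) (c₁ := fun _ => σ)
      (hW.add cM) (hW₁.add cN) (hWt.add cMt) hQ continuous_const ?_ ?_ ?_ ?_ ?_ ht hx
    · intro t ht x hx
      exact (dWt t ht x ⟨hx.1, hx.2.trans hrR⟩).add (hasDerivAt_kernelTransform hG hU hUt hx.1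
        (fun t ht s hs => dUt t ht s
          ⟨by linarith [hs.1, hx.2], by linarith [hs.2, hx.2]⟩) ht)
    · intro t ht x hx
      exact (dW t ht x ⟨hx.1, hx.2.trans_le hrR⟩).add (dM t ⟨ht.1.le, ht.2⟩ x hx)
    · intro t ht x hx
      refine ((dW₁ t ht x ⟨hx.1, hx.2.trans_le hrR⟩).add
        (dN t ⟨ht.1.le, ht.2⟩ x hx)).congr_deriv ?_
      ring
    · intro t ht
      simp [hW0 t ht, kernelTransform]
    · intro t ht
      simp [hW₁0 t ht, kernelTransform]
  have hM0 : ∀ x ∈ Icc 0 r, kernelTransform G (U 0) x = 0 := by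
    intro x hx
    have hcl : IsClosed {t | W t x + kernelTransform G (U t) x = 0} := by
      refine isClosed_eq ?_ continuous_const
      exact (hW.add cM).comp (by fun_prop : Continuous fun t : ℝ => (t, x))
    have := hcl.closure_subset_iff.2 (fun t ht => hzero t ht x hx)
      (show (0 : ℝ) ∈ closure (Ioo 0 T) by rw [closure_Ioo hT.ne]; exact ⟨le_rfl, hT.le⟩)
    rwa [mem_ofPred_eq, hWi x ⟨hx.1, hx.2.trans hrR⟩, zero_add] at this
  have h0T : (0 : ℝ) ∈ Ico 0 T := ⟨le_rfl, hT⟩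
  have hzd : ∀ {F : ℝ → ℂ} {F' : ℂ}, ∀ x ∈ Ioo 0 r, (∀ y ∈ Ioo 0 r, F y = 0) →
      HasDerivAt F F' x → F' = 0 := fun x hx hF hd =>
    hd.unique ((hasDerivAt_const x (0 : ℂ)).congr_of_eventuallyEq
      (eventually_of_mem (Ioo_mem_nhds hx.1 hx.2) hF))
  have hN0 : ∀ x ∈ Ioo 0 r, kernelTransform G₁ (U 0) x + kernelTransform G (U₁ 0) x = 0 :=
    fun x hx => hzd x hx (fun y hy => hM0 y ⟨hy.1.le, hy.2.le⟩) (dM 0 h0T x hx)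
  have hfU : ∀ x ∈ Ioo 0 r, (Q x - P x) * U 0 x = -(σ * kernelTransform G (Ut 0) x) := by
    intro x hx
    have := hzd x hx hN0 (dN 0 h0T x hx)
    rw [hM0 x ⟨hx.1.le, hx.2.le⟩] at this
    linear_combination this
  obtain ⟨c, hc, hcU⟩ := exists_le_mul_norm (dU 0 h0T 0 ⟨by linarith, hR⟩) hb
  have hD0 : 0 ≤ 2 * c * ‖σ‖ * B := by positivity
  have h1 : ∀ᶠ δ in 𝓝[>] (0 : ℝ), 2 * c * ‖σ‖ * B * δ < 1 / 2 := nhdsWithin_le_nhds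
    ((show ContinuousAt (fun δ : ℝ => 2 * c * ‖σ‖ * B * δ) 0 by
      fun_prop).eventually_lt_const (by simp))
  have h2 : ∀ᶠ δ in 𝓝[>] (0 : ℝ), δ ∈ Ioo 0 r := Ioo_mem_nhdsGT hr0
  obtain ⟨δ₀, hδ₀, hδ⟩ := mem_nhdsGT_iff_exists_Ioo_subset.1 ((hcU.and h1).and h2)
  have hδ₀0 : 0 < δ₀ := hδ₀
  have hh : δ₀ / 2 ∈ Ioo 0 δ₀ := ⟨by linarith, by linarith⟩
  refine ⟨δ₀ / 2, hh.1, (hδ hh).2.2.le.trans hrR, fun s hs => ?_⟩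
  refine (sub_eq_zero.1 (eq_zero_of_norm_le_mul_sup (f := fun s => Q s - P s) (hQ.sub hP) hh.1 hD0
    (hδ hh).1.2.le (fun x hx S hS => ?_) s hs)).symm
  have hx' := hδ (show x ∈ Ioo 0 δ₀ from ⟨hx.1, hx.2.trans_lt hh.2⟩)
  have hxr : x ∈ Ioo 0 r := hx'.2
  have hS0 : 0 ≤ S := (norm_nonneg _).trans (hS 0 ⟨le_rfl, hx.1.le⟩)
  have hk : ‖kernelTransform G (Ut 0) x‖ ≤ 2 * (S * x) * B * x :=
    norm_kernelTransform_le hx.1.le (by have := hx.1; positivity)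
      (fun ξ hξ η hη => hGb x ⟨hxr.1.le, hxr.2.le⟩ S hS ξ hξ η ⟨hη.1, hη.2.trans hxr.2.le⟩)
      (fun s hs => hB s ⟨by linarith [hs.1, hxr.2], by linarith [hs.2, hxr.2]⟩)
  have hn : ‖Q x - P x‖ * ‖U 0 x‖ = ‖σ‖ * ‖kernelTransform G (Ut 0) x‖ := by
    rw [← norm_mul, hfU x hxr, norm_neg, norm_mul]
  have : x * ‖Q x - P x‖ ≤ x * (2 * c * ‖σ‖ * B * x * S) := by
    calc x * ‖Q x - P x‖ ≤ c * ‖U 0 x‖ * ‖Q x - P x‖ := by gcongr; exact hx'.1.1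
      _ = c * (‖σ‖ * ‖kernelTransform G (Ut 0) x‖) := by rw [← hn]; ring
      _ ≤ c * (‖σ‖ * (2 * (S * x) * B * x)) := by gcongr
      _ = _ := by ring
  exact le_of_mul_le_mul_left this hx.1

/-! ### Solutions extended continuously to the plane -/

/-- `F` composed with the retraction of the plane onto `[0,T] × [0,ℓ]`. -/
def clampRect (T ℓ : ℝ) (F : ℝ → ℝ → ℂ) (t x : ℝ) : ℂ :=
  F (max 0 (min t T)) (max 0 (min x ℓ))

lemma clamp_mem {T : ℝ} (hT : 0 ≤ T) (t : ℝ) : max 0 (min t T) ∈ Icc 0 T :=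
  ⟨le_max_left _ _, max_le hT (min_le_right _ _)⟩

lemma clamp_eq {T t : ℝ} (ht : t ∈ Icc 0 T) : max 0 (min t T) = t := by
  rw [min_eq_left ht.2, max_eq_right ht.1]

lemma clampRect_eq {T ℓ t x : ℝ} (ht : t ∈ Icc 0 T) (hx : x ∈ Icc 0 ℓ) (F : ℝ → ℝ → ℂ) :
    clampRect T ℓ F t x = F t x := by
  rw [clampRect, clamp_eq ht, clamp_eq hx]

lemma continuous_clampRect {T ℓ : ℝ} (hT : 0 ≤ T) (hℓ : 0 ≤ ℓ) {F : ℝ → ℝ → ℂ}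
    (hF : ContinuousOn (fun z : ℝ × ℝ => F z.1 z.2) (Icc 0 T ×ˢ Icc 0 ℓ)) :
    Continuous fun z : ℝ × ℝ => clampRect T ℓ F z.1 z.2 :=
  hF.comp_continuous (f := fun z : ℝ × ℝ => (max 0 (min z.1 T), max 0 (min z.2 ℓ)))
    (by fun_prop) fun z => ⟨clamp_mem hT _, clamp_mem hℓ _⟩

/-- A solution of `σ ∂ₜu = a ∂ₓ²u - p u` up to time `0`, extended continuously to the plane. -/
structure IsExtendedSolution (T ℓ : ℝ) (σ : ℂ) (a p : ℝ → ℝ) (u ut ux : ℝ → ℝ → ℂ) : Prop where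
  cont : Continuous fun z : ℝ × ℝ => u z.1 z.2
  cont_t : Continuous fun z : ℝ × ℝ => ut z.1 z.2
  cont_x : Continuous fun z : ℝ × ℝ => ux z.1 z.2
  deriv_t : ∀ t ∈ Ioo 0 T, ∀ x ∈ Icc 0 ℓ, HasDerivAt (fun τ => u τ x) (ut t x) t
  deriv_x : ∀ t ∈ Ico 0 T, ∀ x ∈ Ioo 0 ℓ, HasDerivAt (u t) (ux t x) x
  deriv_xx : ∀ t ∈ Ico 0 T, ∀ x ∈ Ioo 0 ℓ,
    HasDerivAt (ux t) ((σ * ut t x + p x * u t x) / a x) x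

lemma IsC12.isExtendedSolution {T ℓ : ℝ} (hT : 0 < T) (hℓ : 0 < ℓ) {σ : ℂ} {a p : ℝ → ℝ}
    (ha : ∀ x ∈ Icc (0 : ℝ) ℓ, 0 < a x) {u ut ux uxx : ℝ → ℝ → ℂ} (hu : IsC12 T ℓ u ut ux uxx)
    (hpde : ∀ t ∈ Ioo (0 : ℝ) T, ∀ x ∈ Ioo (0 : ℝ) ℓ,
      σ * ut t x = a x * uxx t x - p x * u t x) :
    IsExtendedSolution T ℓ σ a p (clampRect T ℓ u) (clampRect T ℓ ut) (clampRect T ℓ ux) := by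
  obtain ⟨hd, c, ct, cx, cxx⟩ := hu
  have k := continuous_clampRect hT.le hℓ.le c
  have kt := continuous_clampRect hT.le hℓ.le ct
  have kxx := continuous_clampRect hT.le hℓ.le cxx
  have ev : ∀ {x : ℝ}, x ∈ Ioo 0 ℓ → ∀ {t : ℝ}, t ∈ Ico 0 T → ∀ F : ℝ → ℝ → ℂ,
      clampRect T ℓ F t =ᶠ[𝓝 x] F t := fun hx t ht F =>
    eventually_of_mem (Ioo_mem_nhds hx.1 hx.2) fun y hy =>
      clampRect_eq ⟨ht.1, ht.2.le⟩ ⟨hy.1.le, hy.2.le⟩ F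
  refine ⟨k, kt, continuous_clampRect hT.le hℓ.le cx, fun t ht x hx => ?_, fun t ht x hx => ?_,
    fun t ht x hx => ?_⟩
  · rw [clampRect_eq ⟨ht.1.le, ht.2.le⟩ hx]
    exact ((hd t ⟨ht.1.le, ht.2.le⟩ x hx).1.hasDerivAt
      (Icc_mem_nhds ht.1 ht.2)).congr_of_eventuallyEq
      (eventually_of_mem (Ioo_mem_nhds ht.1 ht.2) fun τ hτ =>
        clampRect_eq ⟨hτ.1.le, hτ.2.le⟩ hx u)
  · rw [clampRect_eq ⟨ht.1, ht.2.le⟩ ⟨hx.1.le, hx.2.le⟩]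
    exact ((hd t ⟨ht.1, ht.2.le⟩ x ⟨hx.1.le, hx.2.le⟩).2.1.hasDerivAt
      (Icc_mem_nhds hx.1 hx.2)).congr_of_eventuallyEq (ev hx ht u)
  · have hcl : IsClosed {t | σ * clampRect T ℓ ut t x =
        a x * clampRect T ℓ uxx t x - p x * clampRect T ℓ u t x} :=
      isClosed_eq (by fun_prop) (by fun_prop)
    have hx' : x ∈ Icc 0 ℓ := ⟨hx.1.le, hx.2.le⟩
    have ht' : t ∈ Icc 0 T := ⟨ht.1, ht.2.le⟩
    have heq := hcl.closure_subset_iff.2 (fun τ (hτ : τ ∈ Ioo 0 T) => by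
      have hτ' : τ ∈ Icc 0 T := ⟨hτ.1.le, hτ.2.le⟩
      rw [mem_ofPred_eq, clampRect_eq hτ' hx', clampRect_eq hτ' hx', clampRect_eq hτ' hx']
      exact hpde τ hτ x hx) (show t ∈ closure (Ioo 0 T) by rwa [closure_Ioo hT.ne])
    rw [mem_ofPred_eq, clampRect_eq ht' hx', clampRect_eq ht' hx', clampRect_eq ht' hx'] at heq
    rw [clampRect_eq ht' hx', clampRect_eq ht' hx']
    refine (((hd t ht' x hx').2.2.hasDerivAt
      (Icc_mem_nhds hx.1 hx.2)).congr_of_eventuallyEq (ev hx ht ux)).congr_deriv ?_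
    have : (a x : ℂ) ≠ 0 := by exact_mod_cast (ha x hx').ne'
    rw [heq]
    field_simp
    ring

/-- Two solutions with the same Cauchy data at `x = 0` and the same potential on `[0,x₀]` have
the same Cauchy data at `x₀`. -/
lemma IsExtendedSolution.cauchy_data_eq {T ℓ x₀ : ℝ} {σ : ℂ} {a p q : ℝ → ℝ}
    {u ut ux v vt vx : ℝ → ℝ → ℂ} (hu : IsExtendedSolution T ℓ σ a p u ut ux)
    (hv : IsExtendedSolution T ℓ σ a q v vt vx) (hx₀ : x₀ ∈ Ioo 0 ℓ)
    (ha : ContinuousOn a (Icc 0 ℓ)) (hapos : ∀ x ∈ Icc (0 : ℝ) ℓ, 0 < a x)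
    (hq : ContinuousOn q (Icc 0 ℓ)) (hpq : ∀ x ∈ Icc 0 x₀, p x = q x)
    (h0 : ∀ t ∈ Ioo 0 T, u t 0 = v t 0) (h0' : ∀ t ∈ Ioo 0 T, ux t 0 = vx t 0) :
    ∀ t ∈ Ioo 0 T, u t x₀ = v t x₀ ∧ ux t x₀ = vx t x₀ := by
  have hℓ : 0 ≤ ℓ := (hx₀.1.trans hx₀.2).le
  obtain ⟨cu, cut, cux, dut, dux, duxx⟩ := hu
  obtain ⟨cv, cvt, cvx, dvt, dvx, dvxx⟩ := hv
  have hκ : Continuous fun x : ℝ => max 0 (min x ℓ) := by fun_prop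
  have hak := ha.comp_continuous hκ (clamp_mem hℓ)
  have hqk := hq.comp_continuous hκ (clamp_mem hℓ)
  have hane : ∀ x : ℝ, (a (max 0 (min x ℓ)) : ℂ) ≠ 0 := fun x => by
    exact_mod_cast (hapos _ (clamp_mem hℓ x)).ne'
  have hw : ∀ t ∈ Ioo 0 T, ∀ x ∈ Icc 0 x₀, u t x - v t x = 0 := by
    intro t ht x hx
    refine lateral_uniqueness (T := T) (α := 0) (β := x₀) (v := fun t x => u t x - v t x)
      (vx := fun t x => ux t x - vx t x) (vt := fun t x => ut t x - vt t x)
      (c₀ := fun x => q (max 0 (min x ℓ)) / a (max 0 (min x ℓ)))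
      (c₁ := fun x => σ / a (max 0 (min x ℓ)))
      (cu.sub cv) (cux.sub cvx) (cut.sub cvt) ?_ ?_ ?_ ?_ ?_ ?_ ?_ ht hx
    · exact (Complex.continuous_ofReal.comp hqk).div (Complex.continuous_ofReal.comp hak) hane
    · exact continuous_const.div (Complex.continuous_ofReal.comp hak) hane
    · intro t ht x hx
      have hx' : x ∈ Icc 0 ℓ := ⟨hx.1, hx.2.trans hx₀.2.le⟩
      exact (dut t ht x hx').sub (dvt t ht x hx')
    · intro t ht x hx
      have hx' : x ∈ Ioo 0 ℓ := ⟨hx.1, hx.2.trans hx₀.2⟩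
      exact (dux t ⟨ht.1.le, ht.2⟩ x hx').sub (dvx t ⟨ht.1.le, ht.2⟩ x hx')
    · intro t ht x hx
      have hx' : x ∈ Ioo 0 ℓ := ⟨hx.1, hx.2.trans hx₀.2⟩
      refine ((duxx t ⟨ht.1.le, ht.2⟩ x hx').sub (dvxx t ⟨ht.1.le, ht.2⟩ x hx')).congr_deriv ?_
      rw [clamp_eq ⟨hx'.1.le, hx'.2.le⟩, hpq x ⟨hx.1.le, hx.2.le⟩]
      ring
    · intro t ht
      simp [h0 t ht]
    · intro t ht
      simp [h0' t ht]
  intro t ht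
  refine ⟨sub_eq_zero.1 (hw t ht x₀ ⟨hx₀.1.le, le_rfl⟩), sub_eq_zero.1 ?_⟩
  have hcl : IsClosed {x | ux t x - vx t x = 0} := isClosed_eq (by fun_prop) continuous_const
  refine hcl.closure_subset_iff.2 (fun x (hx : x ∈ Ioo 0 x₀) => ?_)
    (show x₀ ∈ closure (Ioo 0 x₀) by rw [closure_Ioo hx₀.1.ne]; exact ⟨hx₀.1.le, le_rfl⟩)
  have hx' : x ∈ Ioo 0 ℓ := ⟨hx.1, hx.2.trans hx₀.2⟩
  exact ((dux t ⟨ht.1.le, ht.2⟩ x hx').sub (dvx t ⟨ht.1.le, ht.2⟩ x hx')).unique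
    ((hasDerivAt_const x (0 : ℂ)).congr_of_eventuallyEq
      (eventually_of_mem (Ioo_mem_nhds hx.1 hx.2) fun y hy => hw t ht y ⟨hy.1.le, hy.2.le⟩))

/-! ### The Liouville transformation -/

lemma exists_liouville_coordinate {ℓ x₀ : ℝ} {γ : ℝ → ℝ} (hγ : ContDiffOn ℝ 1 γ (Ioo 0 ℓ))
    (hx₀ : x₀ ∈ Ioo 0 ℓ) :
    ∃ (R : ℝ) (X : ℝ → ℝ), 0 < R ∧ Continuous X ∧ X 0 = x₀ ∧ (∀ s, X s ∈ Ioo 0 ℓ) ∧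
      ∀ s ∈ Ioo (-R) R, HasDerivAt X (γ (X s) ^ 2) s := by
  obtain ⟨X, hX0, ε, hε, hX⟩ :=
    (hγ.contDiffAt (Ioo_mem_nhds hx₀.1 hx₀.2)).pow 2
      |>.exists_forall_mem_closedBall_exists_eq_forall_mem_Ioo_hasDerivAt₀ 0
  simp only [zero_sub, zero_add] at hX
  have hc : ContinuousAt X 0 := (hX 0 ⟨by linarith, hε⟩).continuousAt
  have h1 : X ⁻¹' Ioo 0 ℓ ∈ 𝓝 (0 : ℝ) := hc (hX0 ▸ Ioo_mem_nhds hx₀.1 hx₀.2)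
  obtain ⟨R, hR, hRX⟩ := Metric.nhds_basis_closedBall.mem_iff.1
    (inter_mem h1 (Ioo_mem_nhds (by linarith : -ε < 0) hε))
  simp only [Real.closedBall_eq_Icc, zero_sub, zero_add] at hRX
  have hκ : ∀ s, max (-R) (min s R) ∈ Icc (-R) R := fun s =>
    ⟨le_max_left _ _, max_le (by linarith) (min_le_right _ _)⟩
  have hκe : ∀ s ∈ Icc (-R) R, max (-R) (min s R) = s := fun s hs => by
    rw [min_eq_left hs.2, max_eq_right hs.1]
  refine ⟨R, fun s => X (max (-R) (min s R)), hR, ?_, ?_, fun s => (hRX (hκ s)).1,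
    fun s hs => ?_⟩
  · exact ContinuousOn.comp_continuous (s := Icc (-R) R)
      (fun s hs => (hX s (hRX hs).2).continuousAt.continuousWithinAt) (by fun_prop) hκ
  · beta_reduce
    rw [hκe 0 ⟨by linarith, hR.le⟩, hX0]
  · have hs' : s ∈ Icc (-R) R := ⟨hs.1.le, hs.2.le⟩
    beta_reduce
    rw [hκe s hs']
    exact (hX s (hRX hs').2).congr_of_eventuallyEq
      (eventually_of_mem (Ioo_mem_nhds hs.1 hs.2) fun y hy =>
        congrArg X (hκe y ⟨hy.1.le, hy.2.le⟩))

lemma IsExtendedSolution.liouville {T ℓ R : ℝ} {σ : ℂ} {a p γ γ₁ γ₂ X : ℝ → ℝ}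
    {u ut ux : ℝ → ℝ → ℂ} (hu : IsExtendedSolution T ℓ σ a p u ut ux)
    (ha : ∀ x ∈ Ioo 0 ℓ, a x = γ x ^ 4) (hpos : ∀ x ∈ Ioo 0 ℓ, 0 < γ x)
    (hγ : ∀ x ∈ Ioo 0 ℓ, HasDerivAt γ (γ₁ x) x) (hγ₁ : ∀ x ∈ Ioo 0 ℓ, HasDerivAt γ₁ (γ₂ x) x)
    (hX : Continuous X) (hXm : ∀ s, X s ∈ Ioo 0 ℓ)
    (hXd : ∀ s ∈ Ioo (-R) R, HasDerivAt X (γ (X s) ^ 2) s) :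
    (Continuous fun z : ℝ × ℝ => u z.1 (X z.2) / γ (X z.2)) ∧
    (Continuous fun z : ℝ × ℝ => ux z.1 (X z.2) * γ (X z.2) - u z.1 (X z.2) * γ₁ (X z.2)) ∧
    (Continuous fun z : ℝ × ℝ => ut z.1 (X z.2) / γ (X z.2)) ∧
    (∀ t ∈ Ioo 0 T, ∀ s, HasDerivAt (fun τ => u τ (X s) / γ (X s)) (ut t (X s) / γ (X s)) t) ∧
    (∀ t ∈ Ico 0 T, ∀ s ∈ Ioo (-R) R, HasDerivAt (fun s => u t (X s) / γ (X s))
      (ux t (X s) * γ (X s) - u t (X s) * γ₁ (X s)) s) ∧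
    (∀ t ∈ Ico 0 T, ∀ s ∈ Ioo (-R) R,
      HasDerivAt (fun s => ux t (X s) * γ (X s) - u t (X s) * γ₁ (X s))
        (σ * (ut t (X s) / γ (X s)) +
          ((p (X s) - γ (X s) ^ 3 * γ₂ (X s) : ℝ) : ℂ) * (u t (X s) / γ (X s))) s) := by
  obtain ⟨cu, cut, cux, dut, dux, duxx⟩ := hu
  have hne : ∀ s, (γ (X s) : ℂ) ≠ 0 := fun s => by exact_mod_cast (hpos _ (hXm s)).ne'
  have cγ : Continuous fun s => (γ (X s) : ℂ) := Complex.continuous_ofReal.comp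
    (ContinuousOn.comp_continuous (fun x hx => (hγ x hx).continuousAt.continuousWithinAt) hX hXm)
  have cγ₁ : Continuous fun s => (γ₁ (X s) : ℂ) := Complex.continuous_ofReal.comp
    (ContinuousOn.comp_continuous (fun x hx => (hγ₁ x hx).continuousAt.continuousWithinAt) hX hXm)
  have hc : ∀ {F : ℝ → ℝ → ℂ}, (Continuous fun z : ℝ × ℝ => F z.1 z.2) →
      Continuous fun z : ℝ × ℝ => F z.1 (X z.2) := fun hF =>
    hF.comp (by fun_prop : Continuous fun z : ℝ × ℝ => (z.1, X z.2))
  have dF : ∀ {F : ℝ → ℂ} {F' : ℂ}, ∀ s ∈ Ioo (-R) R, HasDerivAt F F' (X s) →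
      HasDerivAt (fun s => F (X s)) (γ (X s) ^ 2 * F') s := fun s hs hF =>
    (hF.scomp s (hXd s hs)).congr_deriv (by simp)
  have dγ : ∀ s ∈ Ioo (-R) R, HasDerivAt (fun s => (γ (X s) : ℂ)) (γ (X s) ^ 2 * γ₁ (X s)) s :=
    fun s hs => dF (F := fun x => (γ x : ℂ)) s hs (hγ _ (hXm s)).ofReal_comp
  have dγ₁ : ∀ s ∈ Ioo (-R) R, HasDerivAt (fun s => (γ₁ (X s) : ℂ)) (γ (X s) ^ 2 * γ₂ (X s)) s :=
    fun s hs => dF (F := fun x => (γ₁ x : ℂ)) s hs (hγ₁ _ (hXm s)).ofReal_comp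
  refine ⟨(hc cu).div (cγ.comp continuous_snd) fun z => hne z.2,
    ((hc cux).mul (cγ.comp continuous_snd)).sub ((hc cu).mul (cγ₁.comp continuous_snd)),
    (hc cut).div (cγ.comp continuous_snd) fun z => hne z.2, fun t ht s => ?_,
    fun t ht s hs => ?_, fun t ht s hs => ?_⟩
  · exact (dut t ht _ ⟨(hXm s).1.le, (hXm s).2.le⟩).div_const _
  · refine ((dF s hs (dux t ht _ (hXm s))).div (dγ s hs) (hne s)).congr_deriv ?_
    have := hne s
    field_simp
  · refine (((dF s hs (duxx t ht _ (hXm s))).mul (dγ s hs)).sub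
      ((dF s hs (dux t ht _ (hXm s))).mul (dγ₁ s hs))).congr_deriv ?_
    have := hne s
    rw [ha _ (hXm s)]
    push_cast
    field_simp
    ring

/-- Coincidence of the potentials on `[0,x₀]` propagates beyond `x₀`. -/
lemma IsExtendedSolution.exists_gt_potential_eq {T ℓ x₀ : ℝ} {σ : ℂ} {a p q : ℝ → ℝ}
    {u ut ux v vt vx : ℝ → ℝ → ℂ} (hT : 0 < T) (hu : IsExtendedSolution T ℓ σ a p u ut ux)
    (hv : IsExtendedSolution T ℓ σ a q v vt vx) (hx₀ : x₀ ∈ Ioo 0 ℓ)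
    (ha : ContDiffOn ℝ 2 a (Icc 0 ℓ)) (hapos : ∀ x ∈ Icc (0 : ℝ) ℓ, 0 < a x)
    (hp : ContinuousOn p (Icc 0 ℓ)) (hq : ContinuousOn q (Icc 0 ℓ))
    (hpq : ∀ x ∈ Icc 0 x₀, p x = q x)
    (h0 : ∀ t ∈ Ioo 0 T, u t 0 = v t 0) (h0' : ∀ t ∈ Ioo 0 T, ux t 0 = vx t 0)
    (hi : ∀ x ∈ Ioo 0 ℓ, u 0 x = v 0 x) (hb : u 0 x₀ = 0 → ux 0 x₀ ≠ 0) :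
    ∃ y, x₀ < y ∧ ∀ x ∈ Icc x₀ y, p x = q x := by
  have hdata := hu.cauchy_data_eq hv hx₀ ha.continuousOn hapos hq hpq h0 h0'
  let γ : ℝ → ℝ := fun x => a x ^ (1 / 4 : ℝ)
  have hpos : ∀ x ∈ Ioo 0 ℓ, 0 < γ x := fun x hx =>
    Real.rpow_pos_of_pos (hapos x ⟨hx.1.le, hx.2.le⟩) _
  have haγ : ∀ x ∈ Ioo 0 ℓ, a x = γ x ^ 4 := fun x hx => by
    rw [← Real.rpow_natCast, ← Real.rpow_mul (hapos x ⟨hx.1.le, hx.2.le⟩).le]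
    norm_num
  have hγ : ContDiffOn ℝ 2 γ (Ioo 0 ℓ) :=
    (ha.mono Ioo_subset_Icc_self).rpow_const_of_ne fun x hx =>
      (hapos x ⟨hx.1.le, hx.2.le⟩).ne'
  have hγ₁ : ContDiffOn ℝ 1 (deriv γ) (Ioo 0 ℓ) := hγ.deriv_of_isOpen isOpen_Ioo (by norm_num)
  have hγ₂ : ContinuousOn (deriv (deriv γ)) (Ioo 0 ℓ) :=
    hγ₁.continuousOn_deriv_of_isOpen isOpen_Ioo (by norm_num)
  have dγ : ∀ x ∈ Ioo 0 ℓ, HasDerivAt γ (deriv γ x) x := fun x hx =>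
    ((hγ.contDiffAt (Ioo_mem_nhds hx.1 hx.2)).differentiableAt (by norm_num)).hasDerivAt
  have dγ₁ : ∀ x ∈ Ioo 0 ℓ, HasDerivAt (deriv γ) (deriv (deriv γ) x) x := fun x hx =>
    ((hγ₁.contDiffAt (Ioo_mem_nhds hx.1 hx.2)).differentiableAt (by norm_num)).hasDerivAt
  obtain ⟨R, X, hR, hX, hX0, hXm, hXd⟩ := exists_liouville_coordinate
    (hγ.of_le (by norm_num)) hx₀
  obtain ⟨cU, cU₁, cUt, dUt, dU, dU₁⟩ := hu.liouville haγ hpos dγ dγ₁ hX hXm hXd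
  obtain ⟨cV, cV₁, cVt, dVt, dV, dV₁⟩ := hv.liouville haγ hpos dγ dγ₁ hX hXm hXd
  have cm : Continuous fun s => γ (X s) ^ 3 * deriv (deriv γ) (X s) :=
    ((hγ.continuousOn.comp_continuous hX hXm).pow 3).mul (hγ₂.comp_continuous hX hXm)
  have hpX : Continuous fun s => p (X s) :=
    (hp.mono Ioo_subset_Icc_self).comp_continuous hX hXm
  have hqX : Continuous fun s => q (X s) :=
    (hq.mono Ioo_subset_Icc_self).comp_continuous hX hXm
  have hγ0 : (γ x₀ : ℂ) ≠ 0 := by exact_mod_cast (hpos x₀ hx₀).ne'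
  obtain ⟨δ, hδ, hδR, hδe⟩ := local_uniqueness hT hR (σ := σ)
    (P := fun s => ((p (X s) - γ (X s) ^ 3 * deriv (deriv γ) (X s) : ℝ) : ℂ))
    (Q := fun s => ((q (X s) - γ (X s) ^ 3 * deriv (deriv γ) (X s) : ℝ) : ℂ))
    (W := fun t s => u t (X s) / γ (X s) - v t (X s) / γ (X s))
    (W₁ := fun t s => (ux t (X s) * γ (X s) - u t (X s) * deriv γ (X s)) -
      (vx t (X s) * γ (X s) - v t (X s) * deriv γ (X s)))
    (Wt := fun t s => ut t (X s) / γ (X s) - vt t (X s) / γ (X s))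
    (Complex.continuous_ofReal.comp (hpX.sub cm)) (Complex.continuous_ofReal.comp (hqX.sub cm))
    cU cU₁ cUt (cU.sub cV) (cU₁.sub cV₁) (cUt.sub cVt)
    (fun t ht s _ => dUt t ht s) dU dU₁ (fun t ht s _ => (dUt t ht s).sub (dVt t ht s))
    (fun t ht s hs => (dU t ⟨ht.1.le, ht.2⟩ s ⟨by linarith [hs.1], hs.2⟩).sub
      (dV t ⟨ht.1.le, ht.2⟩ s ⟨by linarith [hs.1], hs.2⟩))
    (fun t ht s hs => ((dU₁ t ⟨ht.1.le, ht.2⟩ s ⟨by linarith [hs.1], hs.2⟩).sub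
      (dV₁ t ⟨ht.1.le, ht.2⟩ s ⟨by linarith [hs.1], hs.2⟩)).congr_deriv
        (by push_cast; ring))
    (fun t ht => by simp only [hX0, (hdata t ht).1, sub_self])
    (fun t ht => by simp only [hX0, (hdata t ht).1, (hdata t ht).2, sub_self])
    (fun s _ => by rw [hi _ (hXm s), sub_self])
    (fun h => by
      rw [hX0, div_eq_zero_iff, or_iff_left hγ0] at h
      rw [hX0, h, zero_mul, sub_zero]
      exact mul_ne_zero (hb h) hγ0)
  have hmono : StrictMonoOn X (Icc 0 δ) := by
    refine strictMonoOn_of_deriv_pos (convex_Icc 0 δ) hX.continuousOn fun s hs => ?_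
    rw [interior_Icc] at hs
    rw [(hXd s ⟨by linarith [hs.1], hs.2.trans_le hδR⟩).deriv]
    exact pow_pos (hpos _ (hXm s)) 2
  refine ⟨X δ, ?_, fun x hx => ?_⟩
  · rw [← hX0]
    exact hmono ⟨le_rfl, hδ.le⟩ ⟨hδ.le, le_rfl⟩ hδ
  · rw [← hX0] at hx
    obtain ⟨s, hs, rfl⟩ := intermediate_value_Icc hδ.le hX.continuousOn hx
    have := Complex.ofReal_injective (hδe s hs)
    linarith

theorem stmt_1
    (T ℓ : ℝ) (hT : 0 < T) (hℓ : 0 < ℓ)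
    (σ : ℂ) (hσ : σ ≠ 0)
    (p q a : ℝ → ℝ)
    (hp : ContDiffOn ℝ 1 p (Icc 0 ℓ)) (hq : ContDiffOn ℝ 1 q (Icc 0 ℓ))
    (ha : ContDiffOn ℝ 2 a (Icc 0 ℓ)) (hapos : ∀ x ∈ Icc (0:ℝ) ℓ, 0 < a x)
    (b : ℝ → ℂ) (hb : ContDiffOn ℝ 3 b (Icc 0 ℓ))
    (hbfin : {x ∈ Icc (0:ℝ) ℓ | b x = 0}.Finite)
    (hbord : ∀ x ∈ Icc (0:ℝ) ℓ, b x = 0 → derivWithin b (Icc 0 ℓ) x ≠ 0)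
    (u ut ux uxx v vt vx vxx : ℝ → ℝ → ℂ)
    (hu : IsC12 T ℓ u ut ux uxx) (hv : IsC12 T ℓ v vt vx vxx)
    (hupde : ∀ t ∈ Ioo (0:ℝ) T, ∀ x ∈ Ioo (0:ℝ) ℓ,
      σ * ut t x = a x * uxx t x - p x * u t x)
    (hvpde : ∀ t ∈ Ioo (0:ℝ) T, ∀ x ∈ Ioo (0:ℝ) ℓ,
      σ * vt t x = a x * vxx t x - q x * v t x)
    (hinit : ∀ x ∈ Ioo (0:ℝ) ℓ, u 0 x = b x ∧ v 0 x = b x)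
    (hdir : ∀ t ∈ Ioo (0:ℝ) T, u t 0 = v t 0)
    (hneu : ∀ t ∈ Ioo (0:ℝ) T, ux t 0 = vx t 0)
    (hcoin : ∃ ε : ℝ, 0 < ε ∧ ε < ℓ ∧ ∀ x ∈ Icc (0:ℝ) ε, p x = q x)
    : ∀ x ∈ Icc (0:ℝ) ℓ, p x = q x := by
  obtain ⟨ε, hε, hεℓ, hpq⟩ := hcoin
  have hU := hu.isExtendedSolution hT hℓ hapos hupde
  have hV := hv.isExtendedSolution hT hℓ hapos hvpde
  have h0T : (0 : ℝ) ∈ Icc 0 T := ⟨le_rfl, hT.le⟩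
  have h0ℓ : (0 : ℝ) ∈ Icc 0 ℓ := ⟨le_rfl, hℓ.le⟩
  have hstep : ∀ x₀ ∈ Ioo 0 ℓ, (∀ x ∈ Icc 0 x₀, p x = q x) →
      ∃ y, x₀ < y ∧ ∀ x ∈ Icc x₀ y, p x = q x := by
    intro x₀ hx₀ hpq
    have hx₀' : x₀ ∈ Icc 0 ℓ := ⟨hx₀.1.le, hx₀.2.le⟩
    refine hU.exists_gt_potential_eq hT hV hx₀ ha hapos hp.continuousOn hq.continuousOn hpq
      (fun t ht => ?_) (fun t ht => ?_) (fun x hx => ?_) fun h => ?_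
    · rw [clampRect_eq ⟨ht.1.le, ht.2.le⟩ h0ℓ, clampRect_eq ⟨ht.1.le, ht.2.le⟩ h0ℓ, hdir t ht]
    · rw [clampRect_eq ⟨ht.1.le, ht.2.le⟩ h0ℓ, clampRect_eq ⟨ht.1.le, ht.2.le⟩ h0ℓ, hneu t ht]
    · rw [clampRect_eq h0T ⟨hx.1.le, hx.2.le⟩, clampRect_eq h0T ⟨hx.1.le, hx.2.le⟩,
        (hinit x hx).1, (hinit x hx).2]
    · have hbu : HasDerivAt b (clampRect T ℓ ux 0 x₀) x₀ :=
        (hU.deriv_x 0 ⟨le_rfl, hT⟩ x₀ hx₀).congr_of_eventuallyEq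
          (eventually_of_mem (Ioo_mem_nhds hx₀.1 hx₀.2) fun y hy => by
            rw [clampRect_eq h0T ⟨hy.1.le, hy.2.le⟩, (hinit y hy).1])
      rw [clampRect_eq h0T hx₀', (hinit x₀ hx₀).1] at h
      rw [← hbu.hasDerivWithinAt.derivWithin (uniqueDiffOn_Icc hℓ x₀ hx₀')]
      exact hbord x₀ hx₀' h
  let Z : Set ℝ := {x | p (max 0 (min x ℓ)) = q (max 0 (min x ℓ))}
  have hκ : Continuous fun x : ℝ => max 0 (min x ℓ) := by fun_prop
  have hZ : IsClosed Z := isClosed_eq (hp.continuousOn.comp_continuous hκ (clamp_mem hℓ.le))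
    (hq.continuousOn.comp_continuous hκ (clamp_mem hℓ.le))
  have hZe : ∀ x ∈ Icc 0 ℓ, (x ∈ Z ↔ p x = q x) := fun x hx => by
    rw [mem_ofPred_eq, clamp_eq hx]
  let S : Set ℝ := {x | ∀ y, 0 ≤ y → y ∉ Z → x ≤ y}
  have hSclosed : IsClosed S := by
    simp only [S, ofPred_forall]
    exact isClosed_iInter fun y => isClosed_iInter fun _ => isClosed_iInter fun _ => isClosed_Iic
  have hS : ∀ x, 0 < x → x ≤ ℓ → x ∈ S → ∀ y ∈ Icc 0 x, p y = q y := by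
    intro x hx0 hxℓ hxS y hy
    have h1 : Ico 0 x ⊆ Z := fun y hy => by
      by_contra hyZ
      exact (hxS y hy.1 hyZ).not_gt hy.2
    have h2 := hZ.closure_subset_iff.2 h1
    rw [closure_Ico hx0.ne] at h2
    exact (hZe y ⟨hy.1, hy.2.trans hxℓ⟩).1 (h2 hy)
  have hS' : ∀ x, x ≤ ℓ → (∀ y ∈ Icc 0 x, p y = q y) → x ∈ S := by
    intro x hxℓ h y hy0 hyZ
    by_contra! hyx
    exact hyZ ((hZe y ⟨hy0, hyx.le.trans hxℓ⟩).2 (h y ⟨hy0, hyx.le⟩))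
  have hsub : Icc ε ℓ ⊆ S := by
    refine (hSclosed.inter isClosed_Icc).Icc_subset_of_forall_exists_gt (hS' ε hεℓ.le hpq) ?_
    rintro x ⟨hxS, hxε, hxℓ⟩ y hy
    have hx0 : 0 < x := hε.trans_le hxε
    obtain ⟨z, hxz, hz⟩ := hstep x ⟨hx0, hxℓ⟩ (hS x hx0 hxℓ.le hxS)
    refine ⟨min (min y z) ℓ, hS' _ (min_le_right _ _) fun s hs => ?_,
      lt_min (lt_min hy hxz) hxℓ, (min_le_left _ _).trans (min_le_left _ _)⟩
    rcases le_total s x with hsx | hsx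
    · exact hS x hx0 hxℓ.le hxS s ⟨hs.1, hsx⟩
    · exact hz s ⟨hsx, hs.2.trans ((min_le_left _ _).trans (min_le_right _ _))⟩
  exact hS ℓ hℓ le_rfl (hsub ⟨hεℓ.le, le_rfl⟩)
end
end
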